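/- Let Ω be a bounded Lipschitz domain in ℝ^N (N ≥ 2), a > 0 and V ∈ 𝒱(Ω,a). Let u be a nonnegative solution of Δu − Vu = 0 in Ω. Suppose that for every P ∈ ∂Ω and every ε > 0 there is a sequence {x_n} in Ω converging nontangentially to P such that liminf u(x_n) ≤ ε. Then u ≡ 0 in Ω. -/

import Mathlib

open MeasureTheory Metric Set Filter Topology
open scoped ENNReal NNReal

noncomputable section

namespace Anc

abbrev ES (N : ℕ) := EuclideanSpace ℝ (Fin N)

/-- `δ_Ω(x)`: the distance from `x` to the complement of `Ω`. -/
def dista {N : ℕ} (Ω : Set (ES N)) (x : ES N) : ℝ := infDist x Ωᶜ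

/-- Pointwise Laplacian (junk values where the derivatives do not exist). -/
def lap {N : ℕ} (u : ES N → ℝ) (x : ES N) : ℝ :=
  ∑ i : Fin N,
    fderiv ℝ (fun y => fderiv ℝ u y (EuclideanSpace.single i 1)) x (EuclideanSpace.single i 1)

/-- Smooth compactly supported test functions in `Ω`. -/
def IsTestFun {N : ℕ} (Ω : Set (ES N)) (φ : ES N → ℝ) : Prop :=
  ContDiff ℝ (⊤ : ℕ∞) φ ∧ IsCompact (tsupport φ) ∧ tsupport φ ⊆ Ω

/-- `u` is a continuous weak solution of `Δu - V·u = 0` in `Ω` (i.e. `L_V`-harmonic). -/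
def LVHarmonic {N : ℕ} (Ω : Set (ES N)) (V u : ES N → ℝ) : Prop :=
  ContinuousOn u Ω ∧ LocallyIntegrableOn u Ω ∧
    LocallyIntegrableOn (fun x => V x * u x) Ω ∧
    ∀ φ, IsTestFun Ω φ → ∫ x in Ω, u x * lap φ x = ∫ x in Ω, V x * u x * φ x

/-- `s` is `L_V`-superharmonic in `Ω` (weakly, `Δs - V·s ≤ 0`, `s` l.s.c.). -/
def LVSuperharmonic {N : ℕ} (Ω : Set (ES N)) (V s : ES N → ℝ) : Prop :=
  LowerSemicontinuousOn s Ω ∧ LocallyIntegrableOn s Ω ∧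
    LocallyIntegrableOn (fun x => V x * s x) Ω ∧
    ∀ φ, IsTestFun Ω φ → (∀ x, 0 ≤ φ x) →
      ∫ x in Ω, s x * lap φ x ≤ ∫ x in Ω, V x * s x * φ x

/-- The class `𝒱(Ω,a)` of nonnegative Borel potentials with `V(x) ≤ a/δ_Ω(x)²`. -/
def VClass {N : ℕ} (Ω : Set (ES N)) (a : ℝ) (V : ES N → ℝ) : Prop :=
  Measurable V ∧ ∀ x ∈ Ω, 0 ≤ V x ∧ V x * dista Ω x ^ 2 ≤ a

/-- Lipschitz domain: open, connected, and near every boundary point, after an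
orthogonal change of coordinates, the domain is the region above the graph of a
Lipschitz function. -/
def IsLipschitzDomain {N : ℕ} (Ω : Set (ES N)) : Prop :=
  IsOpen Ω ∧ IsConnected Ω ∧
    ∀ z ∈ frontier Ω, ∃ (g : ES N ≃ₗᵢ[ℝ] ES N) (i : Fin N) (f : ES N → ℝ)
      (L : ℝ≥0) (ε : ℝ), 0 < ε ∧ LipschitzWith L f ∧
      (∀ x w : ES N, (∀ j, j ≠ i → x j = w j) → f x = f w) ∧
      ∀ x ∈ ball z ε, (x ∈ Ω ↔ f (g x) < g x i)

/-- `Ω` has a `C^{1,α}` boundary near `y`. -/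
def IsC1AlphaNear {N : ℕ} (Ω : Set (ES N)) (α : ℝ) (y : ES N) : Prop :=
  ∃ (g : ES N ≃ₗᵢ[ℝ] ES N) (i : Fin N) (f : ES N → ℝ) (C : ℝ≥0) (ε : ℝ),
    0 < ε ∧ ContDiff ℝ 1 f ∧ HolderWith C α.toNNReal (fderiv ℝ f) ∧
    (∀ x w : ES N, (∀ j, j ≠ i → x j = w j) → f x = f w) ∧
    ∀ x ∈ ball y ε, (x ∈ Ω ↔ f (g x) < g x i)

/-- `K` is the `L_V`-Martin kernel of `Ω` with pole `y ∈ ∂Ω`, normalized at `x₀`: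
the unique positive `L_V`-harmonic function vanishing on `∂Ω ∖ {y}` with `K x₀ = 1`. -/
def IsMartinKernel {N : ℕ} (Ω : Set (ES N)) (V : ES N → ℝ) (x₀ y : ES N)
    (K : ES N → ℝ) : Prop :=
  LVHarmonic Ω V K ∧ (∀ x ∈ Ω, 0 < K x) ∧ K x₀ = 1 ∧
    ∀ z ∈ frontier Ω, z ≠ y → Tendsto K (𝓝[Ω] z) (𝓝 0)

/-- `G` is the `L_V`-Green function of `Ω` with pole `y ∈ Ω`:
positive, vanishing at the boundary, and `L_V G = -δ_y` weakly. -/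
def IsGreenFunction {N : ℕ} (Ω : Set (ES N)) (V : ES N → ℝ) (y : ES N)
    (G : ES N → ℝ) : Prop :=
  ContinuousOn G (Ω \ {y}) ∧ (∀ x ∈ Ω \ {y}, 0 < G x) ∧ LocallyIntegrableOn G Ω ∧
    (∀ z ∈ frontier Ω, Tendsto G (𝓝[Ω \ {y}] z) (𝓝 0)) ∧
    ∀ φ, IsTestFun Ω φ → ∫ x in Ω, G x * (lap φ x - V x * φ x) = -φ y

/-- `y ∈ ∂Ω` is finely regular w.r.t. `V`, `Ky` being the classical Martin kernel at
`y`: the greatest `L_V`-harmonic minorant of `Ky` is positive, equivalently `Ky`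
admits a positive `L_V`-harmonic minorant. -/
def FinelyRegular {N : ℕ} (Ω : Set (ES N)) (V Ky : ES N → ℝ) : Prop :=
  ∃ h, LVHarmonic Ω V h ∧ (∀ x ∈ Ω, 0 < h x) ∧ ∀ x ∈ Ω, h x ≤ Ky x

/-- `h` is the greatest nonnegative `L_V`-harmonic minorant of `w` in `Ω`. -/
def IsGreatestLVHarmMinorant {N : ℕ} (Ω : Set (ES N)) (V w h : ES N → ℝ) : Prop :=
  LVHarmonic Ω V h ∧ (∀ x ∈ Ω, 0 ≤ h x ∧ h x ≤ w x) ∧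
    ∀ g, LVHarmonic Ω V g → (∀ x ∈ Ω, 0 ≤ g x ∧ g x ≤ w x) → ∀ x ∈ Ω, g x ≤ h x

/-- Classical superharmonicity via the sub-mean value property. -/
def IsSuperharmonicOn {N : ℕ} (W : Set (ES N)) (s : ES N → ℝ) : Prop :=
  LowerSemicontinuousOn s W ∧ LocallyIntegrableOn s W ∧
    ∀ x ∈ W, ∀ t > (0:ℝ), closedBall x t ⊆ W → ⨍ z in ball x t, s z ≤ s x

/-- The réduite of `w` over `A` in `W`: infimum of the nonnegative superharmonic
functions in `W` dominating `w` on `A`. -/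
def reduite {N : ℕ} (W : Set (ES N)) (w : ES N → ℝ) (A : Set (ES N)) (x : ES N) : ℝ :=
  sInf {v | ∃ s : ES N → ℝ, IsSuperharmonicOn W s ∧ (∀ z ∈ W, 0 ≤ s z) ∧
    (∀ z ∈ A, w z ≤ s z) ∧ v = s x}

/-- The lower semicontinuous regularization `R̂` of the réduite. -/
def reduiteReg {N : ℕ} (W : Set (ES N)) (w : ES N → ℝ) (A : Set (ES N)) (x : ES N) : ℝ :=
  liminf (reduite W w A) (𝓝[W] x)

/-- Nontangential approach region at `y` with aperture `κ`. -/
def ntRegion {N : ℕ} (Ω : Set (ES N)) (y : ES N) (κ : ℝ) : Set (ES N) :=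
  {x | x ∈ Ω ∧ dist x y ≤ κ * dista Ω x}

/-- `g` tends to `l` nontangentially at `y`. -/
def TendstoNT {N : ℕ} (Ω : Set (ES N)) (g : ES N → ℝ) (y : ES N) (l : Filter ℝ) : Prop :=
  ∀ κ > (0:ℝ), Tendsto g (𝓝[ntRegion Ω y κ] y) l

/-- Truncated cone `{y + t(ν+v) : 0 < t ≤ η, ‖v‖ ≤ η}` with vertex `y`. -/
def truncCone {N : ℕ} (y ν : ES N) (η : ℝ) : Set (ES N) :=
  {x | ∃ (t : ℝ) (v : ES N), 0 < t ∧ t ≤ η ∧ ‖v‖ ≤ η ∧ x = y + t • (ν + v)}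

/-- Last coordinate of a point of `ℝ^{n+1}`. -/
def lastC {n : ℕ} (x : ES (n + 1)) : ℝ := x (Fin.last n)

/-- First `n` coordinates of a point of `ℝ^{n+1}`. -/
def firstC {n : ℕ} (x : ES (n + 1)) : ES n :=
  (EuclideanSpace.equiv (Fin n) ℝ).symm fun i => x i.castSucc

/-- The region `U_f(r,ρ) = {(x',x_N) : |x'| < r, f(x') < x_N < ρ}`. -/
def Ucyl {n : ℕ} (f : ES n → ℝ) (r ρ : ℝ) : Set (ES (n + 1)) :=
  {x | ‖firstC x‖ < r ∧ f (firstC x) < lastC x ∧ lastC x < ρ}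

/-- The cylinder `T(t) = B_{N-1}(0,tr) × (-tρ, tρ)`. -/
def Tcyl (n : ℕ) (r ρ t : ℝ) : Set (ES (n + 1)) :=
  {x | ‖firstC x‖ < t * r ∧ |lastC x| < t * ρ}

/-- The graph part `∂_#U` of the boundary of `U_f(r,ρ)`. -/
def graphBdry {n : ℕ} (f : ES n → ℝ) (r ρ : ℝ) : Set (ES (n + 1)) :=
  frontier (Ucyl f r ρ) ∩ {x | ‖firstC x‖ < r ∧ lastC x = f (firstC x)}

/-- directional derivative along the `i`-th axis -/
def pd {N : ℕ} (i : Fin N) (v : ES N → ℝ) (x : ES N) : ℝ := fderiv ℝ v x (EuclideanSpace.single i 1)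

/-- smoothness -/
abbrev Sm {N : ℕ} (v : ES N → ℝ) : Prop := ContDiff ℝ (⊤ : ℕ∞) v

theorem lap_eq {N : ℕ} (v : ES N → ℝ) (x : ES N) : lap v x = ∑ i, pd i (pd i v) x := rfl

theorem Sm.pd {N : ℕ} {v : ES N → ℝ} (hv : Sm v) (i : Fin N) : Sm (pd i v) := by
  have h : ContDiff ℝ (⊤ : ℕ∞) (fderiv ℝ v) := hv.fderiv_right (by simp)
  exact h.clm_apply contDiff_const

theorem Sm.lap {N : ℕ} {v : ES N → ℝ} (hv : Sm v) : Sm (lap v) := by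
  have : Anc.lap v = fun x => ∑ i, Anc.pd i (Anc.pd i v) x := rfl
  rw [this]
  exact ContDiff.sum fun i _ => (hv.pd i).pd i

theorem Sm.diff {N : ℕ} {v : ES N → ℝ} (hv : Sm v) (x : ES N) : DifferentiableAt ℝ v x :=
  (hv.differentiable (by simp)).differentiableAt

theorem pd_congr {N : ℕ} {v w : ES N → ℝ} {x : ES N} (i : Fin N) (h : v =ᶠ[𝓝 x] w) :
    pd i v =ᶠ[𝓝 x] pd i w := by
  filter_upwards [h.eventuallyEq_nhds] with y hy
  simp only [pd, hy.fderiv_eq]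

theorem lap_congr {N : ℕ} {v w : ES N → ℝ} {x : ES N} (h : v =ᶠ[𝓝 x] w) : lap v x = lap w x := by
  rw [lap_eq, lap_eq]
  exact Finset.sum_congr rfl fun i _ => (pd_congr i (pd_congr i h)).eq_of_nhds

theorem pd_add {N : ℕ} {v w : ES N → ℝ} (hv : Sm v) (hw : Sm w) (i : Fin N) :
    pd i (fun x => v x + w x) = fun x => pd i v x + pd i w x := by
  funext x; simp only [pd]; rw [fderiv_fun_add (hv.diff x) (hw.diff x)]; rfl

theorem pd_mul_const {N : ℕ} {v : ES N → ℝ} (c : ℝ) (hv : Sm v) (i : Fin N) :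
    pd i (fun x => c * v x) = fun x => c * pd i v x := by
  funext x; simp only [pd]; rw [fderiv_const_mul (hv.diff x)]; rfl

theorem lap_add {N : ℕ} {v w : ES N → ℝ} (hv : Sm v) (hw : Sm w) (x : ES N) :
    lap (fun x => v x + w x) x = lap v x + lap w x := by
  simp only [lap_eq, pd_add hv hw, pd_add (hv.pd _) (hw.pd _), Finset.sum_add_distrib]

theorem lap_const_mul {N : ℕ} {v : ES N → ℝ} (c : ℝ) (hv : Sm v) (x : ES N) :
    lap (fun x => c * v x) x = c * lap v x := by
  simp only [lap_eq, pd_mul_const c hv, pd_mul_const c (hv.pd _), Finset.mul_sum]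

theorem lap_neg {N : ℕ} {v : ES N → ℝ} (hv : Sm v) (x : ES N) :
    lap (fun x => - v x) x = - lap v x := by
  have := lap_const_mul (-1) hv x
  simpa using this

theorem lap_zero {N : ℕ} (x : ES N) : lap (fun _ : ES N => (0 : ℝ)) x = 0 := by
  simp [lap]

theorem lap_sum {N : ℕ} {ι : Type*} (s : Finset ι) {v : ι → ES N → ℝ} (hv : ∀ i, Sm (v i)) (x : ES N) :
    lap (fun x => ∑ i ∈ s, v i x) x = ∑ i ∈ s, lap (v i) x := by
  classical
  induction s using Finset.induction_on with
  | empty => simp [lap_zero]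
  | insert a s ha ih =>
    simp only [Finset.sum_insert ha]
    rw [lap_add (hv a) (ContDiff.sum fun i _ => hv i), ih]

theorem pd_refl {N : ℕ} (v : ES N → ℝ) (hv : Sm v) (a : ES N) (i : Fin N) :
    pd i (fun y => v (a - y)) = fun y => - pd i v (a - y) := by
  funext y
  have h := (hv.diff (a - y)).hasFDerivAt.comp y ((hasFDerivAt_id y).const_sub a)
  have h2 : fderiv ℝ (fun y => v (a - y)) y = _ := h.fderiv
  simp only [pd, h2]
  simp

theorem Sm.refl {N : ℕ} {v : ES N → ℝ} (hv : Sm v) (a : ES N) : Sm (fun y => v (a - y)) :=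
  hv.comp (contDiff_const.sub contDiff_id)

theorem lap_refl {N : ℕ} {v : ES N → ℝ} (hv : Sm v) (a y : ES N) :
    lap (fun y => v (a - y)) y = lap v (a - y) := by
  simp only [lap_eq]
  refine Finset.sum_congr rfl fun i _ => ?_
  rw [pd_refl v hv]
  have h : Anc.pd i (fun y => - pd i v (a - y)) y = - Anc.pd i (fun y => pd i v (a - y)) y := by
    simp only [pd]; rw [fderiv_fun_neg]; rfl
  rw [h, pd_refl _ (hv.pd i)]; simp

theorem tsupport_pd {N : ℕ} (v : ES N → ℝ) (i : Fin N) : tsupport (pd i v) ⊆ tsupport v := by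
  refine closure_minimal ?_ isClosed_closure
  intro x hx
  by_contra h
  have := pd_congr i (notMem_tsupport_iff_eventuallyEq.1 h)
  apply hx
  rw [this.eq_of_nhds]
  simp [pd, Pi.zero_def]

theorem lap_zero_off {N : ℕ} {v : ES N → ℝ} {x : ES N} (h : x ∉ tsupport v) : lap v x = 0 := by
  rw [lap_congr (notMem_tsupport_iff_eventuallyEq.1 h)]; exact lap_zero x

theorem tsupport_lap {N : ℕ} (v : ES N → ℝ) : tsupport (lap v) ⊆ tsupport v := by
  refine closure_minimal ?_ isClosed_closure
  intro x hx
  by_contra h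
  exact hx (lap_zero_off h)

theorem IsTestFun.sm {N : ℕ} {O : Set (ES N)} {φ : ES N → ℝ} (h : IsTestFun O φ) : Sm φ := h.1
theorem IsTestFun.cs {N : ℕ} {O : Set (ES N)} {φ : ES N → ℝ} (h : IsTestFun O φ) :
    HasCompactSupport φ := h.2.1
theorem IsTestFun.mono {N : ℕ} {O O' : Set (ES N)} {φ : ES N → ℝ} (h : IsTestFun O φ) (hO : O ⊆ O') :
    IsTestFun O' φ := ⟨h.1, h.2.1, h.2.2.trans hO⟩
theorem IsTestFun.lapcs {N : ℕ} {O : Set (ES N)} {φ : ES N → ℝ} (h : IsTestFun O φ) :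
    HasCompactSupport (lap φ) := h.cs.mono' ((subset_tsupport _).trans (tsupport_lap φ))

theorem IsTestFun.of_sub {N : ℕ} {O : Set (ES N)} {φ ψ : ES N → ℝ} (h : IsTestFun O φ) (hψ : Sm ψ)
    (hs : tsupport ψ ⊆ tsupport φ) : IsTestFun O ψ :=
  ⟨hψ, h.cs.of_isClosed_subset (isClosed_tsupport _) hs, hs.trans h.2.2⟩

theorem IsTestFun.neg {N : ℕ} {O : Set (ES N)} {φ : ES N → ℝ} (h : IsTestFun O φ) :
    IsTestFun O (fun x => - φ x) :=
  h.of_sub h.sm.neg (closure_mono (fun x hx => by simpa using hx))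

theorem IsTestFun.const_mul {N : ℕ} {O : Set (ES N)} {φ : ES N → ℝ} (h : IsTestFun O φ) (c : ℝ) :
    IsTestFun O (fun x => c * φ x) :=
  h.of_sub (contDiff_const.mul h.sm) (closure_mono (fun x hx => by
    simp at hx ⊢; exact hx.2))

theorem IsTestFun.mul_left {N : ℕ} {O : Set (ES N)} {φ ψ : ES N → ℝ} (h : IsTestFun O φ) (hψ : Sm ψ) :
    IsTestFun O (fun x => ψ x * φ x) :=
  h.of_sub (hψ.mul h.sm) (closure_mono (fun x hx => by
    simp at hx ⊢; exact hx.2))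

theorem IsTestFun.add {N : ℕ} {O : Set (ES N)} {φ ψ : ES N → ℝ} (h : IsTestFun O φ)
    (h' : IsTestFun O ψ) : IsTestFun O (fun x => φ x + ψ x) := by
  have hs : tsupport (fun x => φ x + ψ x) ⊆ tsupport φ ∪ tsupport ψ := by
    refine closure_minimal ?_ ((isClosed_tsupport _).union (isClosed_tsupport _))
    intro x hx
    by_contra hc
    rw [mem_union, not_or] at hc
    exact hx (by simp [image_eq_zero_of_notMem_tsupport hc.1, image_eq_zero_of_notMem_tsupport hc.2])
  exact ⟨h.sm.add h'.sm, (h.2.1.union h'.2.1).of_isClosed_subset (isClosed_tsupport _) hs,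
    hs.trans (union_subset h.2.2 h'.2.2)⟩

/-- Integrability of a locally integrable function times a continuous compactly supported one. -/
theorem intg {N : ℕ} {f φ : ES N → ℝ} (hf : LocallyIntegrable f) (hφ : Continuous φ)
    (hc : HasCompactSupport φ) : Integrable (fun x => f x * φ x) :=
  hf.integrable_smul_right_of_hasCompactSupport hφ hc

theorem Sm.li {N : ℕ} {v : ES N → ℝ} (hv : Sm v) : LocallyIntegrable v := hv.continuous.locallyIntegrable

theorem ibp {N : ℕ} {v φ : ES N → ℝ} (hv : Sm v) (hφ : Sm φ) (hc : HasCompactSupport φ) (i : Fin N) :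
    ∫ x, v x * pd i φ x = - ∫ x, pd i v x * φ x := by
  refine integral_mul_fderiv_eq_neg_fderiv_mul_of_integrable ?_ ?_ ?_ ?_ ?_
  · exact intg (hv.pd i).li hφ.continuous hc
  · exact intg hv.li (hφ.pd i).continuous (hc.mono' ((subset_tsupport _).trans (tsupport_pd φ i)))
  · exact intg hv.li hφ.continuous hc
  · intro x _; exact hv.diff x
  · intro x _; exact hφ.diff x

theorem green {N : ℕ} {v φ : ES N → ℝ} (hv : Sm v) (hφ : Sm φ) (hc : HasCompactSupport φ) :
    ∫ x, v x * lap φ x = ∫ x, lap v x * φ x := by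
  have hcp : ∀ i, HasCompactSupport (pd i φ) := fun i =>
    hc.mono' ((subset_tsupport _).trans (tsupport_pd φ i))
  have hcpp : ∀ i, HasCompactSupport (pd i (pd i φ)) := fun i =>
    (hcp i).mono' ((subset_tsupport _).trans (tsupport_pd _ i))
  simp only [lap_eq, Finset.mul_sum, Finset.sum_mul]
  rw [integral_finsetSum _ fun i _ => intg hv.li ((hφ.pd i).pd i).continuous (hcpp i),
    integral_finsetSum _ fun i _ => intg ((hv.pd i).pd i).li hφ.continuous hc]
  refine Finset.sum_congr rfl fun i _ => ?_
  rw [ibp hv (hφ.pd i) (hcp i), ibp (hv.pd i) hφ hc, neg_neg]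

theorem pd_comp {N : ℕ} {v : ES N → ℝ} (hv : Sm v) {β : ℝ → ℝ} (hβ : ContDiff ℝ (⊤ : ℕ∞) β) (i : Fin N) :
    pd i (fun x => β (v x)) = fun x => deriv β (v x) * pd i v x := by
  funext x
  have hb : HasDerivAt β (deriv β (v x)) (v x) :=
    ((hβ.differentiable (by simp)).differentiableAt).hasDerivAt
  have := hb.comp_hasFDerivAt x (hv.diff x).hasFDerivAt
  have h2 : fderiv ℝ (fun x => β (v x)) x = _ := this.fderiv
  simp only [pd, h2]
  simp

theorem pd_mul {N : ℕ} {v w : ES N → ℝ} (hv : Sm v) (hw : Sm w) (i : Fin N) :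
    pd i (fun x => v x * w x) = fun x => v x * pd i w x + w x * pd i v x := by
  funext x; simp only [pd]; rw [fderiv_fun_mul (hv.diff x) (hw.diff x)]; simp

theorem lap_comp {N : ℕ} {v : ES N → ℝ} (hv : Sm v) {β : ℝ → ℝ} (hβ : ContDiff ℝ (⊤ : ℕ∞) β) (x : ES N) :
    lap (fun x => β (v x)) x
      = deriv β (v x) * lap v x + deriv (deriv β) (v x) * ∑ i, (pd i v x) ^ 2 := by
  have hβ' : ContDiff ℝ (⊤ : ℕ∞) (deriv β) := by
    have : ContDiff ℝ ((⊤ : ℕ∞) + 1 : WithTop ℕ∞) β := by simpa using hβ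
    exact (contDiff_succ_iff_deriv.1 this).2.2
  simp only [lap_eq, pd_comp hv hβ, Finset.mul_sum, ← Finset.sum_add_distrib]
  refine Finset.sum_congr rfl fun i _ => ?_
  rw [pd_mul (v := fun x => deriv β (v x)) (hβ'.comp hv) (hv.pd i), pd_comp hv hβ']
  ring

theorem pd_normsq {N : ℕ} (i : Fin N) : pd i (fun x : ES N => ‖x‖ ^ 2) = fun x => 2 * x i := by
  funext x
  have h : fderiv ℝ (fun x : ES N => ‖x‖ ^ 2) x = _ := ((hasStrictFDerivAt_norm_sq x).hasFDerivAt).fderiv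
  simp only [pd, h]
  simp [EuclideanSpace.inner_single_right]

theorem sm_normsq {N : ℕ} : Sm (fun x : ES N => ‖x‖ ^ 2) := contDiff_norm_sq ℝ

theorem pd_coord {N : ℕ} (i : Fin N) (x : ES N) : pd i (fun x : ES N => 2 * x i) x = 2 := by
  have h : HasFDerivAt (fun x : ES N => 2 * x i) ((2 : ℝ) • (EuclideanSpace.proj i : ES N →L[ℝ] ℝ)) x :=
    ((EuclideanSpace.proj i : ES N →L[ℝ] ℝ).hasFDerivAt).const_mul 2
  simp [pd, h.fderiv]

theorem lap_normsq {N : ℕ} (x : ES N) : lap (fun x : ES N => ‖x‖ ^ 2) x = 2 * N := by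
  simp only [lap_eq, pd_normsq, pd_coord]
  simp [mul_comm]

theorem pd_sq_sum {N : ℕ} (b : ℝ) (x : ES N) : ∑ i, (pd i (fun x : ES N => b * ‖x‖ ^ 2) x) ^ 2 =
    ∑ i, (b * (2 * x i)) ^ 2 := by
  refine Finset.sum_congr rfl fun i _ => ?_
  rw [pd_mul_const b sm_normsq, pd_normsq]

theorem lap_radial {N : ℕ} {K : ℝ → ℝ} (hK : ContDiff ℝ (⊤ : ℕ∞) K) (b : ℝ) (x : ES N) :
    lap (fun x : ES N => K (b * ‖x‖ ^ 2)) x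
      = deriv K (b * ‖x‖ ^ 2) * (2 * N * b) + deriv (deriv K) (b * ‖x‖ ^ 2) * (4 * b ^ 2 * ‖x‖ ^ 2) := by
  rw [lap_comp (v := fun x : ES N => b * ‖x‖ ^ 2) (contDiff_const.mul sm_normsq) hK]
  rw [lap_const_mul b sm_normsq, lap_normsq, pd_sq_sum b]
  congr 2
  · ring
  · rw [EuclideanSpace.real_norm_sq_eq, Finset.mul_sum]
    refine Finset.sum_congr rfl fun i _ => ?_
    ring

/-- weak inequality `Δ f ≥ F` on `O` -/
def SubW {N : ℕ} (O : Set (ES N)) (f F : ES N → ℝ) : Prop :=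
  ∀ φ, IsTestFun O φ → (∀ x, 0 ≤ φ x) → ∫ x, F x * φ x ≤ ∫ x, f x * lap φ x

theorem SubW.mono {N : ℕ} {O O' : Set (ES N)} {f F : ES N → ℝ} (h : SubW O f F) (hO : O' ⊆ O) :
    SubW O' f F := fun φ hφ h0 => h φ (hφ.mono hO) h0

/-- bounded measurable functions -/
def BM {N : ℕ} (f : ES N → ℝ) : Prop := AEStronglyMeasurable f volume ∧ ∃ C, 0 ≤ C ∧ ∀ᵐ x, |f x| ≤ C

theorem BM.li {N : ℕ} {f : ES N → ℝ} (h : BM f) : LocallyIntegrable f := by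
  obtain ⟨hm, C, -, hC⟩ := h
  exact (memLp_top_of_bound hm C hC).locallyIntegrable le_top

theorem BM.add {N : ℕ} {f g : ES N → ℝ} (hf : BM f) (hg : BM g) : BM (fun x => f x + g x) := by
  obtain ⟨hm, C, hC0, hC⟩ := hf
  obtain ⟨hm', C', hC0', hC'⟩ := hg
  refine ⟨hm.add hm', C + C', by positivity, ?_⟩
  filter_upwards [hC, hC'] with x h1 h2
  exact (abs_add_le _ _).trans (add_le_add h1 h2)

theorem BM.mul {N : ℕ} {f g : ES N → ℝ} (hf : BM f) (hg : BM g) : BM (fun x => f x * g x) := by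
  obtain ⟨hm, C, hC0, hC⟩ := hf
  obtain ⟨hm', C', hC0', hC'⟩ := hg
  refine ⟨hm.mul hm', C * C', by positivity, ?_⟩
  filter_upwards [hC, hC'] with x h1 h2
  rw [abs_mul]
  exact mul_le_mul h1 h2 (abs_nonneg _) hC0

theorem BM.const {N : ℕ} (c : ℝ) : BM (fun _ : ES N => c) :=
  ⟨aestronglyMeasurable_const, |c|, abs_nonneg _, ae_of_all _ fun _ => le_rfl⟩

theorem BM.cmul {N : ℕ} {f : ES N → ℝ} (c : ℝ) (hf : BM f) : BM (fun x => c * f x) := (BM.const c).mul hf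

theorem BM.neg {N : ℕ} {f : ES N → ℝ} (hf : BM f) : BM (fun x => - f x) := by
  simpa using hf.cmul (-1)

theorem BM.sub {N : ℕ} {f g : ES N → ℝ} (hf : BM f) (hg : BM g) : BM (fun x => f x - g x) := by
  simpa [sub_eq_add_neg] using hf.add hg.neg

theorem BM.pos {N : ℕ} {f : ES N → ℝ} (hf : BM f) : BM (fun x => max (f x) 0) := by
  obtain ⟨hm, C, hC0, hC⟩ := hf
  refine ⟨hm.sup aestronglyMeasurable_const, C, hC0, ?_⟩
  filter_upwards [hC] with x h1
  rw [abs_of_nonneg (le_max_right _ _)]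
  exact max_le ((le_abs_self _).trans h1) hC0

theorem BM.of_cs {N : ℕ} {f : ES N → ℝ} (hf : Continuous f) (hc : HasCompactSupport f) : BM f := by
  obtain ⟨C, hC⟩ := hf.bounded_above_of_compact_support hc
  exact ⟨hf.aestronglyMeasurable, |C|, abs_nonneg _, ae_of_all _ fun x => (hC x).trans (le_abs_self _)⟩

/-- convolution with kernel -/
def cv {N : ℕ} (κ f : ES N → ℝ) (x : ES N) : ℝ := ∫ y, f y * κ (x - y)

theorem cv_eq {N : ℕ} (κ f : ES N → ℝ) :
    cv κ f = convolution f κ (ContinuousLinearMap.lsmul ℝ ℝ) volume := rfl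

theorem cv_sm {N : ℕ} {κ f : ES N → ℝ} (hκ : Sm κ) (hc : HasCompactSupport κ) (hf : LocallyIntegrable f) :
    Sm (cv κ f) :=
  hc.contDiff_convolution_right (ContinuousLinearMap.lsmul ℝ ℝ) hf hκ

theorem pd_cv {N : ℕ} {κ f : ES N → ℝ} (hκ : Sm κ) (hc : HasCompactSupport κ) (hf : LocallyIntegrable f)
    (i : Fin N) : pd i (cv κ f) = cv (pd i κ) f := by
  funext x
  have h := (hc.hasFDerivAt_convolution_right (ContinuousLinearMap.lsmul ℝ ℝ) hf
    (hκ.of_le (by simp)) x)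
  simp only [pd, cv_eq, h.fderiv]
  rw [convolution_precompR_apply (ContinuousLinearMap.lsmul ℝ ℝ) hf (hc.fderiv ℝ)
    (hκ.continuous_fderiv (by simp))]
  rfl

theorem lap_cv {N : ℕ} {κ f : ES N → ℝ} (hκ : Sm κ) (hc : HasCompactSupport κ) (hf : LocallyIntegrable f)
    (x : ES N) : lap (cv κ f) x = ∫ y, f y * lap (fun y => κ (x - y)) y := by
  have hcp : ∀ i, HasCompactSupport (pd i κ) := fun i =>
    hc.mono' ((subset_tsupport _).trans (tsupport_pd κ i))
  have hcpp : ∀ i, HasCompactSupport (pd i (pd i κ)) := fun i =>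
    (hcp i).mono' ((subset_tsupport _).trans (tsupport_pd _ i))
  simp only [lap_refl hκ]
  simp only [lap_eq, pd_cv hκ hc hf, pd_cv (hκ.pd _) (hcp _) hf, cv, Finset.mul_sum]
  rw [integral_finsetSum]
  intro i _
  exact intg hf (((hκ.pd i).pd i).refl x).continuous
    ((hcpp i).comp_homeomorph (Homeomorph.subLeft x))

/-- the standard bump family -/
def mb (N : ℕ) (n : ℕ) : ContDiffBump (0 : ES N) :=
  ⟨1 / (2 * (n + 1)), 1 / (n + 1), by positivity, by
    have : (0:ℝ) ≤ n := by positivity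
    exact one_div_lt_one_div_of_lt (by positivity) (by linarith)⟩

/-- the standard mollifiers -/
def eta (N : ℕ) (n : ℕ) : ES N → ℝ := (mb N n).normed volume

theorem eta_sm (N n : ℕ) : Sm (eta N n) := (mb N n).contDiff_normed
theorem eta_cs (N n : ℕ) : HasCompactSupport (eta N n) := (mb N n).hasCompactSupport_normed
theorem eta_nn (N n : ℕ) (x : ES N) : 0 ≤ eta N n x := (mb N n).nonneg_normed x
theorem eta_int (N n : ℕ) : ∫ x, eta N n x = 1 := (mb N n).integral_normed
theorem eta_ts (N n : ℕ) : tsupport (eta N n) = closedBall 0 (1 / (n + 1)) := (mb N n).tsupport_normed_eq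

theorem cs_refl {N : ℕ} {κ : ES N → ℝ} (hc : HasCompactSupport κ) (x : ES N) :
    HasCompactSupport (fun y => κ (x - y)) := hc.comp_homeomorph (Homeomorph.subLeft x)

theorem ts_refl {N : ℕ} {κ : ES N → ℝ} {ρ : ℝ} (h : tsupport κ ⊆ closedBall 0 ρ) (x : ES N) :
    tsupport (fun y => κ (x - y)) ⊆ closedBall x ρ := by
  refine closure_minimal ?_ isClosed_closedBall
  intro y hy
  have := h (subset_tsupport _ (show x - y ∈ Function.support κ from hy))
  simpa [dist_eq_norm, norm_sub_rev] using this

theorem test_refl {N : ℕ} {κ : ES N → ℝ} {ρ : ℝ} (hκ : Sm κ) (h : tsupport κ ⊆ closedBall 0 ρ) {x : ES N}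
    {O : Set (ES N)} (hO : closedBall x ρ ⊆ O) : IsTestFun O (fun y => κ (x - y)) :=
  ⟨hκ.refl x, (isCompact_closedBall x ρ).of_isClosed_subset (isClosed_tsupport _) (ts_refl h x),
    (ts_refl h x).trans hO⟩

theorem eta_test {N n : ℕ} {x : ES N} {O : Set (ES N)} (hO : closedBall x (1 / (n + 1)) ⊆ O) :
    IsTestFun O (fun y => eta N n (x - y)) := test_refl (eta_sm N n) (eta_ts N n).le hO

/-- mollification -/
def mol {N : ℕ} (n : ℕ) (f : ES N → ℝ) : ES N → ℝ := cv (eta N n) f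

theorem mol_sm {N n : ℕ} {f : ES N → ℝ} (hf : LocallyIntegrable f) : Sm (mol n f) :=
  cv_sm (eta_sm N n) (eta_cs N n) hf

theorem lap_mol {N n : ℕ} {f : ES N → ℝ} (hf : LocallyIntegrable f) (x : ES N) :
    lap (mol n f) x = ∫ y, f y * lap (fun y => eta N n (x - y)) y :=
  lap_cv (eta_sm N n) (eta_cs N n) hf x

theorem mol_tendsto {N : ℕ} {f : ES N → ℝ} (hf : LocallyIntegrable f) :
    ∀ᵐ x, Tendsto (fun n => mol n f x) atTop (𝓝 (f x)) := by
  have h1 : Tendsto (fun n => (mb N n).rOut) atTop (𝓝 0) := tendsto_one_div_add_atTop_nhds_zero_nat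
  have := ContDiffBump.ae_convolution_tendsto_right_of_locallyIntegrable (μ := (volume : Measure (ES N)))
    (φ := mb N) (l := atTop) (K := 2) h1
    (Eventually.of_forall fun n => by
      show (1 : ℝ) / (n + 1) ≤ 2 * (1 / (2 * (n + 1)))
      have : (0 : ℝ) < n + 1 := by positivity
      apply le_of_eq; field_simp) hf
  filter_upwards [this] with x hx
  refine hx.congr fun n => ?_
  rw [convolution_lsmul_swap]
  simp [mol, cv, eta, mul_comm]

theorem mol_nonneg {N n : ℕ} {f : ES N → ℝ} (hf : ∀ᵐ x, 0 ≤ f x) (x : ES N) : 0 ≤ mol n f x := by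
  apply integral_nonneg_of_ae
  filter_upwards [hf] with y hy using mul_nonneg hy (eta_nn _ _ _)

theorem mol_bound {N n : ℕ} {f : ES N → ℝ} {C : ℝ} (hf : ∀ᵐ x, |f x| ≤ C) (x : ES N) :
    |mol n f x| ≤ C := by
  have h1 : ∫ y, C * eta N n (x - y) = C := by
    rw [integral_const_mul, integral_sub_left_eq_self (eta N n) volume x, eta_int, mul_one]
  rw [← h1, ← Real.norm_eq_abs]
  refine norm_integral_le_of_norm_le ?_ ?_
  · exact (((eta_sm N n).refl x).continuous.integrable_of_hasCompactSupport
      (cs_refl (eta_cs N n) x)).const_mul C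
  · filter_upwards [hf] with y hy
    rw [Real.norm_eq_abs, abs_mul, abs_of_nonneg (eta_nn N n (x - y))]
    exact mul_le_mul_of_nonneg_right hy (eta_nn _ _ _)

theorem eta_zero {N n : ℕ} {z : ES N} (h : z ∉ closedBall (0 : ES N) (1 / (n + 1))) : eta N n z = 0 :=
  image_eq_zero_of_notMem_tsupport (by rwa [eta_ts])

theorem mol_congr {N n : ℕ} {f g : ES N → ℝ} {x : ES N}
    (h : ∀ᵐ y, y ∈ closedBall x (1 / (n + 1)) → f y = g y) : mol n f x = mol n g x := by
  apply integral_congr_ae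
  filter_upwards [h] with y hy
  by_cases hm : y ∈ closedBall x (1 / (n + 1 : ℝ))
  · rw [hy hm]
  · rw [eta_zero (n := n) (z := x - y)]
    · simp
    · simpa [dist_eq_norm, norm_sub_rev] using hm

/-- smooth cutoff -/
theorem cutoff {N : ℕ} {K O : Set (ES N)} (hK : IsCompact K) (hO : IsOpen O) (h : K ⊆ O) :
    ∃ χ : ES N → ℝ, IsTestFun O χ ∧ (∀ x, 0 ≤ χ x ∧ χ x ≤ 1) ∧ ∀ x ∈ K, χ =ᶠ[𝓝 x] fun _ => 1 := by
  obtain ⟨L, hL, hKL, hLO⟩ := exists_compact_between hK hO h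
  obtain ⟨f, hf1, hf0, hf⟩ := exists_contMDiffMap_one_nhds_of_subset_interior
    (modelWithCornersSelf ℝ (ES N)) (n := (⊤ : ℕ∞)) hK.isClosed hKL
  have hs : tsupport f ⊆ L := by
    refine closure_minimal ?_ hL.isClosed
    intro x hx
    by_contra hc
    exact hx (hf0 x hc)
  refine ⟨f, ⟨f.contMDiff.contDiff, hL.of_isClosed_subset (isClosed_tsupport _) hs, hs.trans hLO⟩,
    fun x => ⟨(hf x).1, (hf x).2⟩, fun x hx => ?_⟩
  exact (eventually_nhdsSet_iff_forall.1 hf1) x hx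

/-- If the function vanishes away from a compact set, may localise. -/
theorem SubW.congr {N : ℕ} {O : Set (ES N)} {f g F G : ES N → ℝ} (h : SubW O f F)
    (hfg : ∀ᵐ x, x ∈ O → f x = g x) (hFG : ∀ᵐ x, x ∈ O → F x = G x) : SubW O g G := by
  intro φ hφ h0
  have := h φ hφ h0
  have e1 : ∫ x, F x * φ x = ∫ x, G x * φ x := by
    apply integral_congr_ae
    filter_upwards [hFG] with x hx
    by_cases hm : x ∈ O
    · rw [hx hm]
    · rw [image_eq_zero_of_notMem_tsupport (fun hc => hm (hφ.2.2 hc))]; simp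
  have e2 : ∫ x, f x * lap φ x = ∫ x, g x * lap φ x := by
    apply integral_congr_ae
    filter_upwards [hfg] with x hx
    by_cases hm : x ∈ O
    · rw [hx hm]
    · rw [lap_zero_off (fun hc => hm (hφ.2.2 hc))]; simp
  rwa [e1, e2] at this

/-- weaken the right-hand side -/
theorem SubW.rhs {N : ℕ} {O : Set (ES N)} {f F G : ES N → ℝ} (h : SubW O f F)
    (hF : LocallyIntegrable F) (hG : LocallyIntegrable G)
    (hFG : ∀ᵐ x, x ∈ O → G x ≤ F x) : SubW O f G := by
  intro φ hφ h0
  refine le_trans ?_ (h φ hφ h0)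
  refine integral_mono_ae (intg hG hφ.sm.continuous hφ.cs) (intg hF hφ.sm.continuous hφ.cs) ?_
  filter_upwards [hFG] with x hx
  by_cases hm : x ∈ O
  · exact mul_le_mul_of_nonneg_right (hx hm) (h0 x)
  · simp [image_eq_zero_of_notMem_tsupport (fun hc => hm (hφ.2.2 hc))]

theorem SubW.add {N : ℕ} {O : Set (ES N)} {f F g G : ES N → ℝ} (h : SubW O f F) (h' : SubW O g G)
    (hf : LocallyIntegrable f) (hF : LocallyIntegrable F) (hg : LocallyIntegrable g)
    (hG : LocallyIntegrable G) : SubW O (fun x => f x + g x) (fun x => F x + G x) := by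
  intro φ hφ h0
  simp only [add_mul]
  rw [integral_add (intg hF hφ.sm.continuous hφ.cs) (intg hG hφ.sm.continuous hφ.cs),
    integral_add (intg hf hφ.sm.lap.continuous hφ.lapcs) (intg hg hφ.sm.lap.continuous hφ.lapcs)]
  exact add_le_add (h φ hφ h0) (h' φ hφ h0)

theorem SubW.cmul {N : ℕ} {O : Set (ES N)} {f F : ES N → ℝ} (h : SubW O f F) {c : ℝ} (hc : 0 ≤ c) :
    SubW O (fun x => c * f x) (fun x => c * F x) := by
  intro φ hφ h0
  simp only [mul_assoc, integral_const_mul]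
  exact mul_le_mul_of_nonneg_left (h φ hφ h0) hc

theorem subW_const {N : ℕ} {O : Set (ES N)} (c : ℝ) : SubW O (fun _ => c) (fun _ => 0) := by
  intro φ hφ h0
  rw [green contDiff_const hφ.sm hφ.cs]
  have : ∀ x : ES N, lap (fun _ : ES N => c) x = 0 := fun x => by simp [lap]
  simp [this]

theorem subW_smooth {N : ℕ} {O : Set (ES N)} {v : ES N → ℝ} (hv : Sm v) : SubW O v (lap v) := by
  intro φ hφ h0
  rw [green hv hφ.sm hφ.cs]

/-- mollified inequality -/
theorem SubW.mol {N n : ℕ} {O : Set (ES N)} {f F : ES N → ℝ} (h : SubW O f F) (hf : LocallyIntegrable f)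
    {x : ES N} (hx : closedBall x (1 / (n + 1)) ⊆ O) : Anc.mol n F x ≤ lap (Anc.mol n f) x := by
  rw [lap_mol hf]
  exact h _ (eta_test hx) fun y => eta_nn _ _ _

/-- smooth approximation of the positive part -/
def be (ε t : ℝ) : ℝ := (t + √(t ^ 2 + ε ^ 2)) / 2
def be' (ε t : ℝ) : ℝ := (1 + t / √(t ^ 2 + ε ^ 2)) / 2
/-- the limit of the derivative of the smoothed positive part -/
def sg (t : ℝ) : ℝ := if 0 < t then 1 else if t = 0 then 1 / 2 else 0

theorem be_sm {ε : ℝ} (hε : 0 < ε) : ContDiff ℝ (⊤ : ℕ∞) (be ε) := by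
  unfold be
  refine (contDiff_id.add (ContDiff.sqrt ((contDiff_id.pow 2).add contDiff_const) fun t => ?_)).div_const 2
  have : 0 < t ^ 2 + ε ^ 2 := by positivity
  exact this.ne'

theorem be_hd {ε : ℝ} (hε : 0 < ε) (t : ℝ) : HasDerivAt (be ε) (be' ε t) t := by
  have hp : 0 < t ^ 2 + ε ^ 2 := by positivity
  have h1 : HasDerivAt (fun t : ℝ => t ^ 2 + ε ^ 2) (2 * t) t := by
    simpa using (hasDerivAt_pow 2 t).add_const (ε ^ 2)
  have h2 := ((hasDerivAt_id t).add (h1.sqrt hp.ne')).div_const 2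
  refine h2.congr_deriv ?_
  unfold be'
  have : √(t ^ 2 + ε ^ 2) ≠ 0 := (Real.sqrt_pos.2 hp).ne'
  field_simp

theorem be_deriv {ε : ℝ} (hε : 0 < ε) : deriv (be ε) = be' ε := funext fun t => (be_hd hε t).deriv

theorem be_dd {ε : ℝ} (hε : 0 < ε) (t : ℝ) : 0 ≤ deriv (be' ε) t := by
  have hp : 0 < t ^ 2 + ε ^ 2 := by positivity
  have h1 : HasDerivAt (fun t : ℝ => t ^ 2 + ε ^ 2) (2 * t) t := by
    simpa using (hasDerivAt_pow 2 t).add_const (ε ^ 2)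
  have hs : 0 < √(t ^ 2 + ε ^ 2) := Real.sqrt_pos.2 hp
  have h2 : HasDerivAt (be' ε) _ t :=
    (((hasDerivAt_id t).div (h1.sqrt hp.ne') hs.ne').const_add 1).div_const 2
  rw [h2.deriv]
  have hq : √(t ^ 2 + ε ^ 2) ^ 2 = t ^ 2 + ε ^ 2 := Real.sq_sqrt hp.le
  apply div_nonneg _ (by norm_num)
  apply div_nonneg _ (by positivity)
  have : 1 * √(t ^ 2 + ε ^ 2) - id t * (2 * t / (2 * √(t ^ 2 + ε ^ 2))) = ε ^ 2 / √(t ^ 2 + ε ^ 2) := by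
    field_simp
    simp only [id]
    linarith
  rw [this]; positivity

theorem abs_le_sqrt' (t ε : ℝ) : |t| ≤ √(t ^ 2 + ε ^ 2) := by
  apply Real.le_sqrt_of_sq_le; rw [sq_abs]; nlinarith [sq_nonneg ε]

theorem be'_bd (ε t : ℝ) : 0 ≤ be' ε t ∧ be' ε t ≤ 1 := by
  have h := abs_le_sqrt' t ε
  have h3 : |t / √(t ^ 2 + ε ^ 2)| ≤ 1 := by
    rw [abs_div, abs_of_nonneg (Real.sqrt_nonneg _)]
    exact div_le_one_of_le₀ h (Real.sqrt_nonneg _)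
  rw [abs_le] at h3
  unfold be'
  constructor <;> linarith [h3.1, h3.2]

theorem be_bd {ε : ℝ} (hε : 0 < ε) (t : ℝ) : |be ε t| ≤ |t| + ε := by
  have h1 : √(t ^ 2 + ε ^ 2) ≤ |t| + ε := by
    rw [Real.sqrt_le_left (by positivity)]
    nlinarith [abs_nonneg t, sq_abs t]
  have h2 := Real.sqrt_nonneg (t ^ 2 + ε ^ 2)
  unfold be
  rw [abs_le]
  constructor <;> linarith [le_abs_self t, neg_abs_le t]

theorem be_cont {ε : ℝ} (hε : 0 < ε) : Continuous (be ε) := (be_sm hε).continuous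
theorem be'_cont {ε : ℝ} (hε : 0 < ε) : Continuous (be' ε) := by
  rw [← be_deriv hε]; exact (be_sm hε).continuous_deriv (by simp)

theorem kato_eps {N : ℕ} {O : Set (ES N)} {f F : ES N → ℝ} (hO : IsOpen O) (hf : BM f) (hF : BM F)
    (h : SubW O f F) {ε : ℝ} (hε : 0 < ε) :
    SubW O (fun x => be ε (f x)) (fun x => be' ε (f x) * F x) := by
  intro φ hφ h0
  obtain ⟨δ, hδ, hδO⟩ := hφ.2.1.exists_cthickening_subset_open hO hφ.2.2
  obtain ⟨Cf, hCf0, hCf⟩ := hf.2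
  obtain ⟨CF, hCF0, hCF⟩ := hF.2
  have key : ∀ᶠ n : ℕ in atTop,
      ∫ x, (be' ε (mol n f x) * mol n F x) * φ x ≤ ∫ x, be ε (mol n f x) * lap φ x := by
    have : ∀ᶠ n : ℕ in atTop, (1 : ℝ) / (n + 1) < δ :=
      tendsto_one_div_add_atTop_nhds_zero_nat.eventually (gt_mem_nhds hδ)
    filter_upwards [this] with n hn
    have hsm : Sm (mol n f) := mol_sm hf.li
    have hsm2 : Sm (fun x => be ε (mol n f x)) := (be_sm hε).comp hsm
    rw [green hsm2 hφ.sm hφ.cs]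
    refine integral_mono (intg ?_ hφ.sm.continuous hφ.cs) (intg hsm2.lap.li hφ.sm.continuous hφ.cs) ?_
    · exact (((be'_cont hε).comp hsm.continuous).mul (mol_sm hF.li).continuous).locallyIntegrable
    intro x
    by_cases hx : x ∈ tsupport φ
    · have hb : closedBall x (1 / (n + 1 : ℝ)) ⊆ O := by
        refine Subset.trans ?_ hδO
        exact (closedBall_subset_closedBall hn.le).trans (closedBall_subset_cthickening hx δ)
      have h1 := h.mol hf.li hb
      show _ * φ x ≤ _ * φ x
      refine mul_le_mul_of_nonneg_right ?_ (h0 x)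
      rw [lap_comp hsm (be_sm hε), be_deriv hε]
      have h2 := mul_le_mul_of_nonneg_left h1 (be'_bd ε (mol n f x)).1
      have h3 : 0 ≤ deriv (be' ε) (mol n f x) * ∑ i, (pd i (mol n f) x) ^ 2 :=
        mul_nonneg (be_dd hε _) (Finset.sum_nonneg fun i _ => sq_nonneg _)
      linarith
    · show _ * φ x ≤ _ * φ x
      rw [image_eq_zero_of_notMem_tsupport hx]; simp
  refine le_of_tendsto_of_tendsto ?_ ?_ key
  · refine tendsto_integral_of_dominated_convergence (fun x => CF * |φ x|) ?_ ?_ ?_ ?_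
    · intro n
      exact ((((be'_cont hε).comp (mol_sm hf.li).continuous).mul (mol_sm hF.li).continuous).mul
        hφ.sm.continuous).aestronglyMeasurable
    · exact ((hφ.sm.continuous.integrable_of_hasCompactSupport hφ.cs).abs).const_mul _
    · intro n
      refine ae_of_all _ fun x => ?_
      rw [Real.norm_eq_abs, abs_mul, abs_mul]
      refine mul_le_mul_of_nonneg_right ?_ (abs_nonneg _)
      have h1 := be'_bd ε (mol n f x)
      rw [abs_of_nonneg h1.1]
      have h2 := mol_bound (n := n) hCF x
      nlinarith [abs_nonneg (mol n F x)]
    · filter_upwards [mol_tendsto hf.li, mol_tendsto hF.li] with x h1 h2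
      exact ((((be'_cont hε).tendsto _).comp h1).mul h2).mul_const _
  · refine tendsto_integral_of_dominated_convergence (fun x => (Cf + ε) * |lap φ x|) ?_ ?_ ?_ ?_
    · intro n
      exact (((be_cont hε).comp (mol_sm hf.li).continuous).mul
        hφ.sm.lap.continuous).aestronglyMeasurable
    · exact ((hφ.sm.lap.continuous.integrable_of_hasCompactSupport hφ.lapcs).abs).const_mul _
    · intro n
      refine ae_of_all _ fun x => ?_
      rw [Real.norm_eq_abs, abs_mul]
      refine mul_le_mul_of_nonneg_right ?_ (abs_nonneg _)
      exact (be_bd hε _).trans (by linarith [mol_bound (n := n) hCf x])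
    · filter_upwards [mol_tendsto hf.li] with x h1
      exact (((be_cont hε).tendsto _).comp h1).mul_const _

theorem be_lim (t : ℝ) : Tendsto (fun n : ℕ => be (1 / (n + 1)) t) atTop (𝓝 (max t 0)) := by
  have h : Tendsto (fun n : ℕ => (1 : ℝ) / (n + 1)) atTop (𝓝 0) := tendsto_one_div_add_atTop_nhds_zero_nat
  have h2 : Continuous fun ε : ℝ => be ε t := by unfold be; fun_prop
  have h3 := (h2.tendsto 0).comp h
  have : be 0 t = max t 0 := by
    unfold be
    simp only [ne_eq, OfNat.ofNat_ne_zero, not_false_eq_true, zero_pow, add_zero, Real.sqrt_sq_eq_abs]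
    rcases le_total t 0 with h | h
    · rw [abs_of_nonpos h, max_eq_right h]; ring
    · rw [abs_of_nonneg h, max_eq_left h]; ring
  rw [this] at h3
  exact h3

theorem be'_lim (t : ℝ) : Tendsto (fun n : ℕ => be' (1 / (n + 1)) t) atTop (𝓝 (sg t)) := by
  by_cases ht : t = 0
  · subst ht; simp [be', sg]
  have h : Tendsto (fun n : ℕ => (1 : ℝ) / (n + 1)) atTop (𝓝 0) := tendsto_one_div_add_atTop_nhds_zero_nat
  have h2 : ContinuousAt (fun ε : ℝ => be' ε t) 0 := by
    unfold be'
    refine (continuousAt_const.add (continuousAt_const.div (by fun_prop) ?_)).div_const 2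
    simp [Real.sqrt_sq_eq_abs, ht]
  have h3 := h2.tendsto.comp h
  have : be' 0 t = sg t := by
    unfold be' sg
    simp only [ne_eq, OfNat.ofNat_ne_zero, not_false_eq_true, zero_pow, add_zero, Real.sqrt_sq_eq_abs]
    rcases lt_or_gt_of_ne ht with h | h
    · rw [abs_of_neg h, if_neg (by linarith), if_neg ht]; field_simp; ring
    · rw [abs_of_pos h, if_pos h]; field_simp; norm_num
  rw [this] at h3
  exact h3

theorem sg_bd (t : ℝ) : 0 ≤ sg t ∧ sg t ≤ 1 := by
  unfold sg; split_ifs <;> norm_num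

theorem sg_meas : Measurable sg := by
  unfold sg
  exact Measurable.ite measurableSet_Ioi measurable_const
    (Measurable.ite (measurableSet_singleton 0) measurable_const measurable_const)

theorem BM.sg {N : ℕ} {f : ES N → ℝ} (hf : BM f) : BM (fun x => sg (f x)) :=
  ⟨(sg_meas.comp_aemeasurable hf.1.aemeasurable).aestronglyMeasurable, 1, zero_le_one,
    ae_of_all _ fun x => by rw [abs_of_nonneg (sg_bd _).1]; exact (sg_bd _).2⟩

theorem kato {N : ℕ} {O : Set (ES N)} {f F : ES N → ℝ} (hO : IsOpen O) (hf : BM f) (hF : BM F)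
    (h : SubW O f F) : SubW O (fun x => max (f x) 0) (fun x => sg (f x) * F x) := by
  intro φ hφ h0
  obtain ⟨Cf, hCf0, hCf⟩ := hf.2
  obtain ⟨CF, hCF0, hCF⟩ := hF.2
  have hp : ∀ n : ℕ, (0 : ℝ) < 1 / (n + 1) := fun n => by positivity
  refine le_of_tendsto_of_tendsto' (b := (atTop : Filter ℕ)) ?_ ?_ (fun n : ℕ => kato_eps hO hf hF h (hp n) φ hφ h0)
  · refine tendsto_integral_of_dominated_convergence (fun x => CF * |φ x|) ?_ ?_ ?_ ?_
    · intro n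
      exact (((be'_cont (hp n)).comp_aestronglyMeasurable hf.1).mul hF.1).mul
        hφ.sm.continuous.aestronglyMeasurable
    · exact ((hφ.sm.continuous.integrable_of_hasCompactSupport hφ.cs).abs).const_mul _
    · intro n
      filter_upwards [hCF] with x hx
      rw [Real.norm_eq_abs, abs_mul, abs_mul]
      refine mul_le_mul_of_nonneg_right ?_ (abs_nonneg _)
      have h1 := be'_bd (1 / (n + 1)) (f x)
      rw [abs_of_nonneg h1.1]
      nlinarith [abs_nonneg (F x)]
    · exact ae_of_all _ fun x => ((be'_lim _).mul_const _).mul_const _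
  · refine tendsto_integral_of_dominated_convergence (fun x => (Cf + 1) * |lap φ x|) ?_ ?_ ?_ ?_
    · intro n
      exact ((be_cont (hp n)).comp_aestronglyMeasurable hf.1).mul
        hφ.sm.lap.continuous.aestronglyMeasurable
    · exact ((hφ.sm.lap.continuous.integrable_of_hasCompactSupport hφ.lapcs).abs).const_mul _
    · intro n
      filter_upwards [hCf] with x hx
      rw [Real.norm_eq_abs, abs_mul]
      refine mul_le_mul_of_nonneg_right ?_ (abs_nonneg _)
      have : (1 : ℝ) / (n + 1) ≤ 1 := by
        rw [div_le_one (by positivity)]; linarith [show (0 : ℝ) ≤ n by positivity]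
      exact (be_bd (hp n) _).trans (by linarith)
    · exact ae_of_all _ fun x => (be_lim _).mul_const _

theorem kato_t {N : ℕ} {O : Set (ES N)} {f W : ES N → ℝ} (hO : IsOpen O) (hf : BM f) (hW : BM W)
    (hW0 : ∀ x, 0 ≤ W x) (h : SubW O f (fun x => W x * f x)) {t : ℝ} (ht : 0 ≤ t) :
    SubW O (fun x => max (f x - t) 0) (fun x => W x * max (f x - t) 0) := by
  have h1 := (h.add (subW_const (-t)) hf.li (hW.mul hf).li (BM.const _).li (BM.const _).li)
  simp only [add_zero, ← sub_eq_add_neg] at h1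
  have hft : BM (fun x => f x - t) := hf.sub (BM.const t)
  have h2 := kato hO hft (hW.mul hf) h1
  refine h2.rhs (hft.sg.mul (hW.mul hf)).li (hW.mul hft.pos).li (ae_of_all _ fun x _ => ?_)
  have hw := hW0 x
  unfold sg
  split_ifs with c1 c2
  · rw [max_eq_left c1.le]; nlinarith
  · rw [c2, max_self]
    have : f x = t := by linarith
    rw [this, mul_zero]; positivity
  · rw [max_eq_right (by linarith)]; simp

theorem SubW.local {N : ℕ} {O : Set (ES N)} {f F : ES N → ℝ} (hf : LocallyIntegrable f)
    (hF : LocallyIntegrable F)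
    (h : ∀ x ∈ O, ∃ U : Set (ES N), IsOpen U ∧ x ∈ U ∧ SubW U f F) : SubW O f F := by
  intro φ hφ h0
  have h' : ∀ x : tsupport φ, ∃ U : Set (ES N), IsOpen U ∧ (x : ES N) ∈ U ∧ SubW U f F :=
    fun x => h x (hφ.2.2 x.2)
  choose U hUo hxU hU using h'
  obtain ⟨t, ht⟩ := hφ.2.1.elim_finite_subcover U hUo
    (fun x hx => mem_iUnion.2 ⟨⟨x, hx⟩, hxU ⟨x, hx⟩⟩)
  obtain ⟨p, hp⟩ := SmoothPartitionOfUnity.exists_isSubordinate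
    (modelWithCornersSelf ℝ (ES N)) (isClosed_tsupport φ) (fun i : t => U i) (fun i => hUo i)
    (fun x hx => by
      obtain ⟨i, hi, hxi⟩ := mem_iUnion₂.1 (ht hx)
      exact mem_iUnion.2 ⟨⟨i, hi⟩, hxi⟩)
  have hsm : ∀ i, Sm (p i) := fun i => (p i).contMDiff.contDiff
  have hsm2 : ∀ i, Sm (fun x => p i x * φ x) := fun i => (hsm i).mul hφ.sm
  have htest : ∀ i : t, IsTestFun (U i) (fun x => p i x * φ x) := fun i => by
    have h1 := hφ.mul_left (hsm i)
    refine ⟨h1.1, h1.2.1, Subset.trans ?_ (hp i)⟩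
    exact closure_mono fun x hx => by simp at hx ⊢; exact hx.1
  have hsum : ∀ x, φ x = ∑ i, p i x * φ x := by
    intro x
    by_cases hx : x ∈ tsupport φ
    · have h1 := p.sum_eq_one hx
      rw [finsum_eq_sum_of_fintype] at h1
      rw [← Finset.sum_mul, h1, one_mul]
    · rw [image_eq_zero_of_notMem_tsupport hx]; simp
  have hlap : ∀ x, lap φ x = ∑ i, lap (fun x => p i x * φ x) x := by
    intro x
    rw [← lap_sum _ hsm2]
    exact lap_congr (Eventually.of_forall hsum)
  have e1 : ∫ x, F x * φ x = ∑ i, ∫ x, F x * (p i x * φ x) := by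
    rw [← integral_finsetSum _ fun i _ => intg hF (hsm2 i).continuous (htest i).cs]
    refine integral_congr_ae (ae_of_all _ fun x => ?_)
    show F x * φ x = ∑ i, F x * (p i x * φ x)
    rw [← Finset.mul_sum, ← hsum]
  have e2 : ∫ x, f x * lap φ x = ∑ i, ∫ x, f x * lap (fun x => p i x * φ x) x := by
    rw [← integral_finsetSum _ fun i _ => intg hf (hsm2 i).lap.continuous (htest i).lapcs]
    refine integral_congr_ae (ae_of_all _ fun x => ?_)
    show f x * lap φ x = ∑ i, f x * lap (fun x => p i x * φ x) x
    rw [← Finset.mul_sum, ← hlap]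
  rw [e1, e2]
  exact Finset.sum_le_sum fun i _ => hU i _ (htest i) fun x => mul_nonneg (p.nonneg i x) (h0 x)

theorem subW_zero {N : ℕ} {U : Set (ES N)} {f F : ES N → ℝ} (hf : ∀ᵐ x, x ∈ U → f x = 0)
    (hF : ∀ᵐ x, x ∈ U → F x = 0) : SubW U f F := by
  refine (subW_const 0).congr ?_ ?_
  · filter_upwards [hf] with x hx hm; exact (hx hm).symm
  · filter_upwards [hF] with x hx hm; exact (hx hm).symm

/-- Subsolutions in `D` with vanishing boundary values extend. -/
theorem extend {N : ℕ} {B D : Set (ES N)} {f W : ES N → ℝ} (hB : IsOpen B) (hD : IsOpen D) (hf : BM f)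
    (hW : BM W) (hW0 : ∀ x, 0 ≤ W x) (h : SubW (D ∩ B) f (fun x => W x * f x))
    (hdec : ∀ z ∈ B, z ∉ D → ∀ t > 0, ∃ r > 0, ∀ᵐ y, y ∈ ball z r → f y ≤ t) :
    SubW B (fun x => max (f x) 0) (fun x => W x * max (f x) 0) := by
  have key : ∀ t > 0, SubW B (fun x => max (f x - t) 0) (fun x => W x * max (f x - t) 0) := by
    intro t ht
    have hft : BM (fun x => f x - t) := hf.sub (BM.const t)
    refine SubW.local hft.pos.li (hW.mul hft.pos).li fun x hx => ?_
    by_cases hxD : x ∈ D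
    · exact ⟨D ∩ B, hD.inter hB, ⟨hxD, hx⟩, kato_t (hD.inter hB) hf hW hW0 h ht.le⟩
    · obtain ⟨r, hr, hr2⟩ := hdec x hx hxD t ht
      refine ⟨ball x r, isOpen_ball, mem_ball_self hr, subW_zero ?_ ?_⟩
      · filter_upwards [hr2] with y hy hm
        exact max_eq_right (by linarith [hy hm])
      · filter_upwards [hr2] with y hy hm
        rw [max_eq_right (by linarith [hy hm]), mul_zero]
  intro φ hφ h0
  obtain ⟨Cf, hCf0, hCf⟩ := hf.2
  obtain ⟨CW, hCW0, hCW⟩ := hW.2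
  have hp : ∀ n : ℕ, (0 : ℝ) < 1 / (n + 1) := fun n => by positivity
  have hlim : ∀ c : ℝ, Tendsto (fun n : ℕ => max (c - 1 / ((n : ℝ) + 1)) 0) atTop (𝓝 (max c 0)) := by
    intro c
    have h1 : Tendsto (fun n : ℕ => c - 1 / ((n : ℝ) + 1)) atTop (𝓝 (c - 0)) :=
      tendsto_const_nhds.sub tendsto_one_div_add_atTop_nhds_zero_nat
    rw [sub_zero] at h1
    exact h1.max tendsto_const_nhds
  have hbd : ∀ᵐ x, ∀ n : ℕ, |max (f x - 1 / ((n : ℝ) + 1)) 0| ≤ Cf := by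
    filter_upwards [hCf] with x hx n
    rw [abs_of_nonneg (le_max_right _ _)]
    exact max_le (by linarith [le_abs_self (f x), hp n]) hCf0
  refine le_of_tendsto_of_tendsto' (b := (atTop : Filter ℕ)) ?_ ?_ (fun n : ℕ => key _ (hp n) φ hφ h0)
  · refine tendsto_integral_of_dominated_convergence (fun x => CW * Cf * |φ x|) ?_ ?_ ?_ ?_
    · intro n
      exact (hW.mul (hf.sub (BM.const _)).pos).1.mul hφ.sm.continuous.aestronglyMeasurable
    · exact ((hφ.sm.continuous.integrable_of_hasCompactSupport hφ.cs).abs).const_mul _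
    · intro n
      filter_upwards [hCW, hbd] with x h1 h2
      rw [Real.norm_eq_abs, abs_mul, abs_mul]
      exact mul_le_mul_of_nonneg_right (mul_le_mul h1 (h2 n) (abs_nonneg _) hCW0) (abs_nonneg _)
    · exact ae_of_all _ fun x => ((hlim _).const_mul _).mul_const _
  · refine tendsto_integral_of_dominated_convergence (fun x => Cf * |lap φ x|) ?_ ?_ ?_ ?_
    · intro n
      exact (hf.sub (BM.const _)).pos.1.mul hφ.sm.lap.continuous.aestronglyMeasurable
    · exact ((hφ.sm.lap.continuous.integrable_of_hasCompactSupport hφ.lapcs).abs).const_mul _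
    · intro n
      filter_upwards [hbd] with x h2
      rw [Real.norm_eq_abs, abs_mul]
      exact mul_le_mul_of_nonneg_right (h2 n) (abs_nonneg _)
    · exact ae_of_all _ fun x => (hlim _).mul_const _

/-- maximum principle in integrated form -/
theorem maxprin {N : ℕ} {O K : Set (ES N)} {f G q : ES N → ℝ} {ρ : ℝ} (hO : IsOpen O)
    (hOb : O ⊆ closedBall 0 ρ) (hK : IsCompact K) (hKO : K ⊆ O)
    (hfK : ∀ x, x ∉ K → f x = 0) (hG : LocallyIntegrable G) (hq : Integrable q) (hq0 : ∀ x, 0 ≤ q x)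
    (hGq : ∀ᵐ x, x ∈ O → - q x ≤ G x) (h : SubW O f G) :
    2 * N * ∫ x, f x ≤ ρ ^ 2 * ∫ x, q x := by
  obtain ⟨χ, hχ, hχ01, hχ1⟩ := cutoff hK hO hKO
  have hsm : Sm (fun x : ES N => ρ ^ 2 + (-1) * ‖x‖ ^ 2) := contDiff_const.add (contDiff_const.mul sm_normsq)
  set φ : ES N → ℝ := fun x => (ρ ^ 2 + (-1) * ‖x‖ ^ 2) * χ x with hφdef
  have hφ : IsTestFun O φ := hχ.mul_left hsm
  have hin : ∀ x ∈ O, 0 ≤ ρ ^ 2 + (-1) * ‖x‖ ^ 2 := by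
    intro x hx
    have : ‖x‖ ≤ ρ := by simpa using hOb hx
    nlinarith [norm_nonneg x]
  have hoff : ∀ x, x ∉ O → φ x = 0 := fun x hx =>
    image_eq_zero_of_notMem_tsupport fun hc => hx (hφ.2.2 hc)
  have hφ0 : ∀ x, 0 ≤ φ x := by
    intro x
    by_cases hx : x ∈ O
    · exact mul_nonneg (hin x hx) (hχ01 x).1
    · rw [hoff x hx]
  have hφ2 : ∀ x, φ x ≤ ρ ^ 2 := by
    intro x
    by_cases hx : x ∈ O
    · have := hin x hx
      have h2 := hχ01 x
      show (ρ ^ 2 + (-1) * ‖x‖ ^ 2) * χ x ≤ ρ ^ 2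
      nlinarith [sq_nonneg ‖x‖]
    · rw [hoff x hx]; positivity
  have hl : ∀ x ∈ K, lap φ x = - (2 * N) := by
    intro x hx
    have : φ =ᶠ[𝓝 x] fun x => ρ ^ 2 + (-1) * ‖x‖ ^ 2 := by
      filter_upwards [hχ1 x hx] with y hy
      show _ * χ y = _
      rw [hy, mul_one]
    rw [lap_congr this, lap_add (v := fun _ => ρ ^ 2) contDiff_const (contDiff_const.mul sm_normsq),
      lap_const_mul _ sm_normsq, lap_normsq]
    simp [lap]
  have h1 := h φ hφ hφ0
  have e1 : ∫ x, f x * lap φ x = - (2 * N) * ∫ x, f x := by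
    rw [← integral_const_mul]
    refine integral_congr_ae (ae_of_all _ fun x => ?_)
    by_cases hx : x ∈ K
    · show f x * lap φ x = _
      rw [hl x hx]; ring
    · show f x * lap φ x = -(2 * N) * f x
      rw [hfK x hx]; simp
  have e2 : ∫ x, - (ρ ^ 2 * q x) ≤ ∫ x, G x * φ x := by
    refine integral_mono_ae (hq.const_mul _).neg (intg hG hφ.sm.continuous hφ.cs) ?_
    filter_upwards [hGq] with x hx
    by_cases hm : x ∈ O
    · have := hx hm
      have a1 := hφ0 x
      have a2 := hφ2 x
      have a3 := hq0 x
      nlinarith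
    · show - (ρ ^ 2 * q x) ≤ G x * φ x
      rw [hoff x hm, mul_zero]
      have := mul_nonneg (sq_nonneg ρ) (hq0 x); linarith
  rw [integral_neg, integral_const_mul] at e2
  rw [e1] at h1
  linarith

/-- the convex cone used in the Hahn-Banach argument -/
def K0 {N : ℕ} (U : Set (ES N)) (W ρ0 : ES N → ℝ) : Set (Lp ℝ 2 (volume.restrict U) × ℝ) :=
  {p | ∃ φ, IsTestFun univ φ ∧ (∃ K, IsCompact K ∧ K ⊆ U ∧ ∀ x, x ∉ K → 0 ≤ φ x) ∧
    ∫ x, ρ0 x * φ x ≤ p.2 ∧ ∀ᵐ x ∂(volume.restrict U), lap φ x - W x * φ x ≤ p.1 x}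

theorem K0_convex {N : ℕ} (U : Set (ES N)) (W : ES N → ℝ) {ρ0 : ES N → ℝ} (hρ : LocallyIntegrable ρ0) :
    Convex ℝ (K0 U W ρ0) := by
  rintro p ⟨φ, h1, ⟨K, hK, hKU, hφK⟩, h3, h4⟩ q ⟨ψ, k1, ⟨L, hL, hLU, hψL⟩, k3, k4⟩ a b ha hb _
  refine ⟨fun x => a * φ x + b * ψ x, (h1.const_mul a).add (k1.const_mul b),
    ⟨K ∪ L, hK.union hL, union_subset hKU hLU, fun x hx => ?_⟩, ?_, ?_⟩
  · rw [mem_union, not_or] at hx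
    have := hφK x hx.1
    have := hψL x hx.2
    positivity
  · have e : ∫ x, ρ0 x * (a * φ x + b * ψ x) = a * (∫ x, ρ0 x * φ x) + b * (∫ x, ρ0 x * ψ x) := by
      rw [← integral_const_mul, ← integral_const_mul, ← integral_add]
      · exact integral_congr_ae (ae_of_all _ fun x => by ring)
      · exact (intg hρ h1.sm.continuous h1.cs).const_mul a
      · exact (intg hρ k1.sm.continuous k1.cs).const_mul b
    rw [e]
    simp only [Prod.snd_add, Prod.smul_snd, smul_eq_mul]
    gcongr
  · simp only [Prod.fst_add, Prod.smul_fst]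
    filter_upwards [h4, k4, Lp.coeFn_add (a • p.1) (b • q.1), Lp.coeFn_smul a p.1,
      Lp.coeFn_smul b q.1] with x m1 m2 m3 m4 m5
    rw [m3, Pi.add_apply, m4, m5, Pi.smul_apply, Pi.smul_apply, smul_eq_mul, smul_eq_mul,
      lap_add (contDiff_const.mul h1.sm) (contDiff_const.mul k1.sm), lap_const_mul a h1.sm,
      lap_const_mul b k1.sm]
    nlinarith

theorem K0_smul {N : ℕ} (U : Set (ES N)) (W : ES N → ℝ) {ρ0 : ES N → ℝ}
    {p : Lp ℝ 2 (volume.restrict U) × ℝ} (hp : p ∈ K0 U W ρ0) {a : ℝ} (ha : 0 ≤ a) :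
    a • p ∈ K0 U W ρ0 := by
  obtain ⟨φ, h1, ⟨K, hK, hKU, hφK⟩, h3, h4⟩ := hp
  refine ⟨fun x => a * φ x, (h1.const_mul a), ⟨K, hK, hKU, fun x hx => ?_⟩, ?_, ?_⟩
  · have := hφK x hx
    positivity
  · have e : ∫ x, ρ0 x * (a * φ x) = a * ∫ x, ρ0 x * φ x := by
      rw [← integral_const_mul]
      exact integral_congr_ae (ae_of_all _ fun x => by ring)
    rw [e]
    simp only [Prod.smul_snd, smul_eq_mul]
    gcongr
  · simp only [Prod.smul_fst]
    filter_upwards [h4, Lp.coeFn_smul a p.1] with x m1 m4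
    rw [m4, Pi.smul_apply, smul_eq_mul, lap_const_mul a h1.sm]
    nlinarith

theorem l1_le {N : ℕ} {U : Set (ES N)} (hU : volume U < ⊤) (hUm : MeasurableSet U) :
    ∃ C, 0 ≤ C ∧ ∀ q : Lp ℝ 2 (volume.restrict U),
      Integrable (U.indicator fun x => |q x|) ∧ ∫ x, U.indicator (fun x => |q x|) x ≤ C * ‖q‖ := by
  have : IsFiniteMeasure (volume.restrict U) := ⟨by simpa using hU⟩
  have h1 : MemLp (fun _ : ES N => (1 : ℝ)) 2 (volume.restrict U) := memLp_const 1
  refine ⟨‖h1.toLp‖, norm_nonneg _, fun q => ⟨?_, ?_⟩⟩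
  · rw [integrable_indicator_iff hUm]
    exact ((Lp.memLp q).integrable (by norm_num)).abs
  · rw [integral_indicator hUm]
    have h2 := real_inner_le_norm h1.toLp |q|
    rw [norm_abs_eq_norm, L2.inner_def] at h2
    refine le_trans (le_of_eq ?_) h2
    apply integral_congr_ae
    filter_upwards [h1.coeFn_toLp, Lp.coeFn_abs q] with x e1 e2
    rw [e1, e2]; simp

theorem K0_est {N : ℕ} (hN : 2 ≤ N) {U : Set (ES N)} (hU : IsOpen U) {ρ : ℝ} (hUb : U ⊆ closedBall 0 ρ)
    {W ρ0 : ES N → ℝ} (hW0 : ∀ x, 0 ≤ W x) (hρ0 : ∀ x, 0 ≤ ρ0 x)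
    (hρc : Continuous ρ0) (hρs : HasCompactSupport ρ0) :
    ∃ C, ∀ p ∈ K0 U W ρ0, - (C * ‖p.1‖) ≤ p.2 := by
  have hvol : volume U < ⊤ := (measure_mono hUb).trans_lt measure_closedBall_lt_top
  obtain ⟨C, hC0, hC⟩ := l1_le hvol hU.measurableSet
  obtain ⟨M, hM⟩ := hρc.bounded_above_of_compact_support hρs
  have hM0 : 0 ≤ M := (norm_nonneg _).trans (hM 0)
  refine ⟨M * (ρ ^ 2 * C), ?_⟩
  rintro p ⟨φ, h1, ⟨K, hK, hKU, hφK⟩, h3, h4⟩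
  have hv : Sm (fun x => - φ x) := h1.neg.sm
  have hvB : BM (fun x => - φ x) := BM.of_cs hv.continuous h1.neg.cs
  have hlB : BM (lap (fun x => - φ x)) := BM.of_cs hv.lap.continuous h1.neg.lapcs
  have hk := kato hU hvB hlB (subW_smooth hv)
  have hCp := hC p.1
  rw [ae_restrict_iff' hU.measurableSet] at h4
  have hm := maxprin (q := U.indicator fun x => |p.1 x|) hU hUb hK hKU (f := fun x => max (- φ x) 0)
    (fun x hx => max_eq_right (by linarith [hφK x hx])) (hvB.sg.mul hlB).li hCp.1
    (fun x => indicator_nonneg (fun x _ => abs_nonneg _) x) (by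
      filter_upwards [h4] with x hx hxU
      rw [indicator_of_mem hxU, lap_neg h1.sm]
      have h5 := hx hxU
      have h6 := le_abs_self (p.1 x)
      have h7 := abs_nonneg (p.1 x)
      have h8 := hW0 x
      unfold sg
      split_ifs with c1 c2
      · nlinarith
      · have : φ x = 0 := by linarith
        rw [this] at h5
        nlinarith
      · linarith) hk
  have hN' : (2 : ℝ) ≤ N := by exact_mod_cast hN
  have hI0 : 0 ≤ ∫ x, max (- φ x) 0 := integral_nonneg fun x => le_max_right _ _
  have hI : ∫ x, max (- φ x) 0 ≤ ρ ^ 2 * (C * ‖p.1‖) := by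
    have := mul_le_mul_of_nonneg_left hCp.2 (sq_nonneg ρ)
    nlinarith
  have hcs : HasCompactSupport (fun x => max (- φ x) 0) := h1.cs.mono (fun x hx => by
    contrapose! hx
    have : φ x = 0 := by simpa using hx
    simp [this])
  have hIi : Integrable (fun x => max (- φ x) 0) :=
    (h1.neg.sm.continuous.max continuous_const).integrable_of_hasCompactSupport hcs
  have h9 : ∫ x, - (M * max (- φ x) 0) ≤ ∫ x, ρ0 x * φ x := by
    refine integral_mono (hIi.const_mul M).neg (intg hρc.locallyIntegrable h1.sm.continuous h1.cs) ?_
    intro x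
    have a1 : ρ0 x ≤ M := (le_abs_self _).trans (hM x)
    have a2 := hρ0 x
    show - (M * max (- φ x) 0) ≤ ρ0 x * φ x
    rcases le_total (φ x) 0 with h | h
    · rw [max_eq_left (by linarith)]; nlinarith
    · rw [max_eq_right (by linarith)]; simp; positivity
  rw [integral_neg, integral_const_mul] at h9
  have := mul_le_mul_of_nonneg_left hI hM0
  nlinarith

theorem exist_g {N : ℕ} (hN : 2 ≤ N) {U : Set (ES N)} (hU : IsOpen U) {ρ : ℝ} (hUb : U ⊆ closedBall 0 ρ)
    {W ρ0 : ES N → ℝ} (hW : BM W) (hW0 : ∀ x, 0 ≤ W x) (hρ0 : ∀ x, 0 ≤ ρ0 x)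
    (hρc : Continuous ρ0) (hρs : HasCompactSupport ρ0) :
    ∃ g : ES N → ℝ, Integrable g ∧ (∀ x, 0 ≤ g x) ∧ (∀ x, x ∉ U → g x = 0) ∧
      SubW univ g (fun x => W x * g x - ρ0 x) ∧ SubW U (fun x => - g x) (fun x => -(W x * g x - ρ0 x)) := by
  have hvol : volume U < ⊤ := (measure_mono hUb).trans_lt measure_closedBall_lt_top
  have : IsFiniteMeasure (volume.restrict U) := ⟨by simpa using hvol⟩
  obtain ⟨C, hC⟩ := K0_est hN hU hUb hW0 hρ0 hρc hρs
  have hzero : (0 : Lp ℝ 2 (volume.restrict U) × ℝ) ∈ K0 U W ρ0 := by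
    refine ⟨fun _ => 0, ⟨contDiff_const, by simp [tsupport], by simp⟩, ⟨∅, isCompact_empty, by simp, by simp⟩,
      by simp, ?_⟩
    filter_upwards [Lp.coeFn_zero ℝ 2 (volume.restrict U)] with x hx
    simp only [Prod.fst_zero, hx]
    simp [lap_zero]
  have hcl : closure (K0 U W ρ0) ⊆ {p | - (C * ‖p.1‖) ≤ p.2} := by
    refine closure_minimal (fun p hp => hC p hp) ?_
    exact isClosed_le (by fun_prop) (by fun_prop)
  have hnot : ((0, -1) : Lp ℝ 2 (volume.restrict U) × ℝ) ∉ closure (K0 U W ρ0) := by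
    intro h
    have := hcl h
    simp at this
    linarith
  obtain ⟨F, u, hu1, hu2⟩ := geometric_hahn_banach_point_closed
    (K0_convex U W hρc.locallyIntegrable).closure isClosed_closure hnot
  have hu0 : u < 0 := by simpa using hu2 0 (subset_closure hzero)
  have hF : ∀ p ∈ K0 U W ρ0, 0 ≤ F p := by
    intro p hp
    by_contra hneg
    push Not at hneg
    have h1 := hu2 _ (subset_closure (K0_smul U W hp (a := u / F p) (div_nonneg_of_nonpos hu0.le hneg.le)))
    rw [map_smul, smul_eq_mul, div_mul_cancel₀ _ hneg.ne] at h1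
    exact lt_irrefl _ h1
  set c : ℝ := F (0, 1) with hc
  have hcpos : 0 < c := by
    have : F (0, -1) = - c := by
      rw [hc, ← map_neg]; simp
    linarith
  set γ : Lp ℝ 2 (volume.restrict U) :=
    (InnerProductSpace.toDual ℝ (Lp ℝ 2 (volume.restrict U))).symm
      (F.comp (ContinuousLinearMap.inl ℝ (Lp ℝ 2 (volume.restrict U)) ℝ)) with hγ
  have hFγ : ∀ (q : Lp ℝ 2 (volume.restrict U)) (r : ℝ), F (q, r) = (∫ x in U, γ x * q x) + c * r := by
    intro q r
    have e1 : F (q, r) = F (q, 0) + r * F (0, 1) := by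
      rw [← smul_eq_mul, ← map_smul, ← map_add]; simp
    have e2 : F (q, 0) = inner ℝ γ q := by
      rw [hγ, InnerProductSpace.toDual_symm_apply]; simp
    rw [e1, e2, L2.inner_def]
    simp [mul_comm, c]
  have hγ0 : ∀ᵐ x ∂(volume.restrict U), 0 ≤ γ x := by
    have hm : MemLp (fun x => max (- γ x) 0) 2 (volume.restrict U) := (Lp.memLp γ).neg.pos_part
    have h1 : (hm.toLp, (0 : ℝ)) ∈ K0 U W ρ0 := by
      refine ⟨fun _ => 0, ⟨contDiff_const, by simp [tsupport], by simp⟩,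
        ⟨∅, isCompact_empty, by simp, by simp⟩, by simp, ?_⟩
      filter_upwards [hm.coeFn_toLp] with x hx
      simp only [hx, lap_zero]
      simp
    have h2 := hF _ h1
    rw [hFγ] at h2
    have h3 : ∫ x in U, γ x * (MemLp.toLp _ hm) x = - ∫ x in U, (max (- γ x) 0) ^ 2 := by
      rw [← integral_neg]
      apply integral_congr_ae
      filter_upwards [hm.coeFn_toLp] with x hx
      rw [hx]
      rcases le_total (γ x) 0 with h | h
      · rw [max_eq_left (by linarith)]; ring
      · rw [max_eq_right (by linarith)]; simp
    rw [h3] at h2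
    have h4 : ∫ x in U, (max (- γ x) 0) ^ 2 = 0 :=
      le_antisymm (by linarith) (integral_nonneg fun x => sq_nonneg _)
    rw [integral_eq_zero_iff_of_nonneg (fun x => sq_nonneg _) hm.integrable_sq] at h4
    filter_upwards [h4] with x hx
    have hx' : max (- γ x) 0 = 0 := by simpa using hx
    have := le_max_left (- γ x) 0
    linarith
  set g : ES N → ℝ := U.indicator (fun x => max (γ x) 0 / c) with hg
  have hgU : ∀ᵐ x ∂(volume.restrict U), g x = γ x / c := by
    filter_upwards [hγ0, ae_restrict_mem hU.measurableSet] with x hx hxU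
    rw [hg, indicator_of_mem hxU, max_eq_left hx]
  have hgoff : ∀ x, x ∉ U → g x = 0 := fun x hx => indicator_of_notMem hx _
  have hgint : Integrable g := by
    rw [hg, integrable_indicator_iff hU.measurableSet]
    exact (((Lp.memLp γ).pos_part).integrable (by norm_num)).div_const c
  have key : ∀ φ, IsTestFun univ φ → (∃ K, IsCompact K ∧ K ⊆ U ∧ ∀ x, x ∉ K → 0 ≤ φ x) →
      ∫ x, (W x * g x - ρ0 x) * φ x ≤ ∫ x, g x * lap φ x := by
    intro φ hφ hφ2
    have hB : BM (fun x => lap φ x - W x * φ x) :=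
      (BM.of_cs hφ.sm.lap.continuous hφ.lapcs).sub (hW.mul (BM.of_cs hφ.sm.continuous hφ.cs))
    obtain ⟨hBm, CB, -, hCB⟩ := hB
    have hm : MemLp (fun x => lap φ x - W x * φ x) 2 (volume.restrict U) :=
      MemLp.of_bound hBm.restrict CB (ae_restrict_of_ae hCB)
    have h1 : (hm.toLp, ∫ x, ρ0 x * φ x) ∈ K0 U W ρ0 := by
      refine ⟨φ, hφ, hφ2, le_rfl, ?_⟩
      filter_upwards [hm.coeFn_toLp] with x hx
      rw [hx]
    have h2 := hF _ h1
    rw [hFγ] at h2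
    have h3 : ∫ x in U, γ x * (MemLp.toLp _ hm) x = c * ∫ x, g x * (lap φ x - W x * φ x) := by
      have e : ∫ x, g x * (lap φ x - W x * φ x) = ∫ x in U, g x * (lap φ x - W x * φ x) := by
        rw [setIntegral_eq_integral_of_forall_compl_eq_zero]
        intro x hx; rw [hgoff x hx, zero_mul]
      rw [e, ← integral_const_mul]
      apply integral_congr_ae
      filter_upwards [hm.coeFn_toLp, hgU] with x hx hx2
      rw [hx, hx2]; field_simp
    rw [h3, ← mul_add] at h2
    have h4 := nonneg_of_mul_nonneg_right h2 hcpos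
    have i1 : Integrable (fun x => g x * lap φ x) := intg hgint.locallyIntegrable hφ.sm.lap.continuous hφ.lapcs
    have i2 : Integrable (fun x => W x * g x * φ x) := by
      obtain ⟨CW, -, hCW⟩ := hW.2
      exact intg (hgint.bdd_mul hW.1 hCW).locallyIntegrable hφ.sm.continuous hφ.cs
    have i3 := intg hρc.locallyIntegrable hφ.sm.continuous hφ.cs
    have e1 : ∫ x, g x * (lap φ x - W x * φ x) = (∫ x, g x * lap φ x) - ∫ x, W x * g x * φ x := by
      rw [← integral_sub i1 i2]
      exact integral_congr_ae (ae_of_all _ fun x => by ring)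
    have e2 : ∫ x, (W x * g x - ρ0 x) * φ x = (∫ x, W x * g x * φ x) - ∫ x, ρ0 x * φ x := by
      rw [← integral_sub i2 i3]
      exact integral_congr_ae (ae_of_all _ fun x => by ring)
    rw [e2]
    rw [e1] at h4
    linarith
  refine ⟨g, hgint, fun x => indicator_nonneg (fun x _ => div_nonneg (le_max_right _ _) hcpos.le) x, hgoff,
    ?_, ?_⟩
  · intro φ hφ h0
    exact key φ hφ ⟨∅, isCompact_empty, by simp, fun x _ => h0 x⟩
  · intro φ hφ h0
    have h1 := key (fun x => - φ x) (hφ.neg.mono (subset_univ _)) ⟨tsupport φ, hφ.2.1, hφ.2.2, fun x hx => by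
      rw [image_eq_zero_of_notMem_tsupport hx, neg_zero]⟩
    simp only [lap_neg hφ.sm] at h1
    refine le_trans (le_of_eq ?_) (h1.trans (le_of_eq ?_))
    · exact integral_congr_ae (ae_of_all _ fun x => by ring)
    · exact integral_congr_ae (ae_of_all _ fun x => by ring)

/-- the mean value kernel -/
def kk {N : ℕ} (w : ES N) : ℝ := 2 * max (1 - ‖w‖ ^ 2) 0
/-- its potential -/
def Th {N : ℕ} (w : ES N) : ℝ := max (1 - ‖w‖ ^ 2) 0 ^ 2
/-- the mass of the mean value kernel -/
def cN (N : ℕ) : ℝ := ∫ w : ES N, kk w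

theorem kk_nn {N : ℕ} (w : ES N) : 0 ≤ kk w := by unfold kk; positivity
theorem Th_nn {N : ℕ} (w : ES N) : 0 ≤ Th w := by unfold Th; positivity
theorem kk_le {N : ℕ} (w : ES N) : kk w ≤ 2 := by
  unfold kk
  have : max (1 - ‖w‖ ^ 2) 0 ≤ 1 := max_le (by nlinarith [sq_nonneg ‖w‖]) (by norm_num)
  linarith
theorem Th_le {N : ℕ} (w : ES N) : Th w ≤ kk w := by
  unfold kk Th
  have h : max (1 - ‖w‖ ^ 2) 0 ≤ 1 := max_le (by nlinarith [sq_nonneg ‖w‖]) (by norm_num)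
  have h2 : 0 ≤ max (1 - ‖w‖ ^ 2) 0 := le_max_right _ _
  nlinarith
theorem kk_cont {N : ℕ} : Continuous (kk : ES N → ℝ) := by unfold kk; fun_prop
theorem Th_cont {N : ℕ} : Continuous (Th : ES N → ℝ) := by unfold Th; fun_prop
theorem kk_off {N : ℕ} {w : ES N} (h : w ∉ closedBall (0 : ES N) 1) : kk w = 0 := by
  have : 1 < ‖w‖ := by simpa using h
  unfold kk
  rw [max_eq_right (by nlinarith)]; simp
theorem Th_off {N : ℕ} {w : ES N} (h : w ∉ closedBall (0 : ES N) 1) : Th w = 0 :=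
  le_antisymm ((Th_le w).trans (kk_off h).le) (Th_nn w)
theorem kk_cs {N : ℕ} : HasCompactSupport (kk : ES N → ℝ) :=
  HasCompactSupport.intro (isCompact_closedBall 0 1) fun _ h => kk_off h
theorem Th_cs {N : ℕ} : HasCompactSupport (Th : ES N → ℝ) :=
  HasCompactSupport.intro (isCompact_closedBall 0 1) fun _ h => Th_off h
theorem kk_int {N : ℕ} : Integrable (kk : ES N → ℝ) := kk_cont.integrable_of_hasCompactSupport kk_cs
theorem Th_int {N : ℕ} : Integrable (Th : ES N → ℝ) := Th_cont.integrable_of_hasCompactSupport Th_cs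
theorem cN_pos (N : ℕ) : 0 < cN N := by
  unfold cN
  refine kk_cont.integral_pos_of_hasCompactSupport_nonneg_nonzero kk_cs kk_nn (x := 0) ?_
  simp [kk]
theorem Th_le_cN (N : ℕ) : ∫ w : ES N, Th w ≤ cN N := integral_mono Th_int kk_int fun w => Th_le w

theorem hasDerivAt_maxsq (x : ℝ) : HasDerivAt (fun x : ℝ => max x 0 ^ 2) (2 * max x 0) x := by
  rcases lt_trichotomy x 0 with h | h | h
  · rw [max_eq_right h.le, mul_zero]
    refine (hasDerivAt_const x (0:ℝ)).congr_of_eventuallyEq ?_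
    filter_upwards [Iio_mem_nhds h] with y hy
    rw [max_eq_right (le_of_lt hy)]; simp
  · subst h
    rw [hasDerivAt_iff_isLittleO]
    simp only [max_self, mul_zero, sub_zero, smul_zero]
    have : (fun x' : ℝ => x' ^ 2) =o[𝓝 0] fun x' => x' := by
      simpa using Asymptotics.isLittleO_pow_id (𝕜 := ℝ) (n := 2) (by norm_num)
    refine Asymptotics.IsBigO.trans_isLittleO ?_ this
    refine Asymptotics.IsBigO.of_bound 1 (Eventually.of_forall fun y => ?_)
    simp only [Real.norm_eq_abs, one_mul]
    rcases le_total y 0 with h | h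
    · rw [max_eq_right h]; simp; positivity
    · rw [max_eq_left h]; simp
  · rw [max_eq_left h.le]
    have := hasDerivAt_pow 2 x
    refine (HasDerivAt.congr_of_eventuallyEq (f := fun y : ℝ => y ^ 2) (by simpa using this) ?_)
    filter_upwards [Ioi_mem_nhds h] with y hy
    rw [max_eq_left (le_of_lt hy)]

theorem Th_fd {N : ℕ} (w : ES N) :
    HasFDerivAt (Th : ES N → ℝ) ((2 * max (1 - ‖w‖ ^ 2) 0) • (-(2 • (innerSL ℝ w)) : ES N →L[ℝ] ℝ)) w := by
  have h1 : HasFDerivAt (fun x : ES N => 1 - ‖x‖ ^ 2) (-(2 • (innerSL ℝ w))) w :=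
    ((hasStrictFDerivAt_norm_sq w).hasFDerivAt).const_sub 1
  exact (hasDerivAt_maxsq _).comp_hasFDerivAt w h1

theorem Th_pd {N : ℕ} (i : Fin N) (w : ES N) : pd i Th w = - (2 * w i * kk w) := by
  simp only [pd, (Th_fd w).fderiv, kk]
  simp [EuclideanSpace.inner_single_right]
  ring

theorem pd_scale {N : ℕ} {v : ES N → ℝ} (hv : Sm v) (x : ES N) (t : ℝ) (i : Fin N) (w : ES N) :
    pd i (fun w => v (x + t • w)) w = t * pd i v (x + t • w) := by
  have h := (hv.diff (x + t • w)).hasFDerivAt.comp w (((hasFDerivAt_id w).const_smul t).const_add x)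
  have h2 : fderiv ℝ (fun w => v (x + t • w)) w = _ := h.fderiv
  simp only [pd, h2]
  simp

theorem ibpTh {N : ℕ} {v : ES N → ℝ} (hv : Sm v) (i : Fin N) :
    ∫ w, v w * pd i Th w = - ∫ w, pd i v w * Th w := by
  have e : (fun w : ES N => pd i Th w) = fun w => - (2 * w i * kk w) := funext (Th_pd i)
  have hc : Continuous (pd i Th : ES N → ℝ) := by
    show Continuous (fun w : ES N => pd i Th w)
    rw [e]; have := kk_cont (N := N); fun_prop
  refine integral_mul_fderiv_eq_neg_fderiv_mul_of_integrable ?_ ?_ ?_ ?_ ?_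
  · exact intg (hv.pd i).li Th_cont Th_cs
  · exact intg hv.li hc (Th_cs.mono' ((subset_tsupport _).trans (tsupport_pd _ i)))
  · exact intg hv.li Th_cont Th_cs
  · exact fun w _ => hv.diff w
  · exact fun w _ => (Th_fd w).differentiableAt

/-- the mean value function -/
def Av {N : ℕ} (v : ES N → ℝ) (x : ES N) (t : ℝ) : ℝ := ∫ w, v (x + t • w) * kk w

theorem Av_zero {N : ℕ} (v : ES N → ℝ) (x : ES N) : Av v x 0 = cN N * v x := by
  simp [Av, cN, integral_const_mul, mul_comm]

theorem sum_coord {N : ℕ} (L : ES N →L[ℝ] ℝ) (w : ES N) : L w = ∑ i, w i * L (EuclideanSpace.single i 1) := by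
  conv_lhs => rw [← (EuclideanSpace.basisFun (Fin N) ℝ).sum_repr w]
  simp [map_sum]

theorem Sm.sc {N : ℕ} {v : ES N → ℝ} (hv : Sm v) (x : ES N) (t : ℝ) : Sm (fun w => v (x + t • w)) :=
  hv.comp (contDiff_const.add (contDiff_const_smul t))

theorem Av_deriv {N : ℕ} {v : ES N → ℝ} (hv : Sm v) (x : ES N) (t : ℝ) :
    HasDerivAt (Av v x) (t / 2 * ∫ w, lap v (x + t • w) * Th w) t := by
  have hfc : Continuous (fderiv ℝ v) := hv.continuous_fderiv (by simp)
  have hcp : IsCompact ((fun p : ℝ × ES N => x + p.1 • p.2) '' (closedBall t 1 ×ˢ closedBall 0 1)) :=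
    ((isCompact_closedBall t 1).prod (isCompact_closedBall 0 1)).image (by fun_prop)
  obtain ⟨C, hC⟩ := hcp.exists_bound_of_continuousOn hfc.continuousOn
  have key := hasDerivAt_integral_of_dominated_loc_of_deriv_le (μ := (volume : Measure (ES N)))
    (F := fun t w => v (x + t • w) * kk w) (F' := fun t w => fderiv ℝ v (x + t • w) w * kk w)
    (bound := fun w => C * kk w) (x₀ := t) (closedBall_mem_nhds t one_pos) ?_ ?_ ?_ ?_ ?_ ?_
  · have e : ∫ w, fderiv ℝ v (x + t • w) w * kk w = t / 2 * ∫ w, lap v (x + t • w) * Th w := by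
      have i1 : ∀ i : Fin N, Integrable (fun w : ES N => pd i v (x + t • w) * (w i * kk w)) := fun i =>
        intg (((hv.pd i).sc x t).li) (by have := kk_cont (N := N); fun_prop)
          ((kk_cs (N := N)).mono fun w hw => by
            contrapose! hw
            have : kk w = 0 := by simpa using hw
            simp [this])
      have i2 : ∀ i : Fin N, Integrable (fun w : ES N => pd i (pd i v) (x + t • w) * Th w) := fun i =>
        intg ((((hv.pd i).pd i).sc x t).li) Th_cont Th_cs
      have e1 : ∫ w, fderiv ℝ v (x + t • w) w * kk w = ∑ i, ∫ w : ES N, pd i v (x + t • w) * (w i * kk w) := by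
        rw [← integral_finsetSum _ fun i _ => i1 i]
        refine integral_congr_ae (ae_of_all _ fun w => ?_)
        simp only
        rw [sum_coord, Finset.sum_mul]
        refine Finset.sum_congr rfl fun i _ => ?_
        simp only [pd]; ring
      have e2 : ∫ w, lap v (x + t • w) * Th w = ∑ i, ∫ w : ES N, pd i (pd i v) (x + t • w) * Th w := by
        rw [← integral_finsetSum _ fun i _ => i2 i]
        refine integral_congr_ae (ae_of_all _ fun w => ?_)
        simp only [lap_eq, Finset.sum_mul]
      rw [e1, e2, Finset.mul_sum]
      refine Finset.sum_congr rfl fun i _ => ?_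
      have h1 := ibpTh ((hv.pd i).sc x t) i
      simp only [Th_pd, pd_scale (hv.pd i)] at h1
      have h2 : ∫ w : ES N, pd i v (x + t • w) * -(2 * w i * kk w) =
        (-2) * ∫ w : ES N, pd i v (x + t • w) * (w i * kk w) := by
        rw [← integral_const_mul]
        exact integral_congr_ae (ae_of_all _ fun w => by ring)
      have h3 : ∫ w : ES N, t * pd i (pd i v) (x + t • w) * Th w =
        t * ∫ w : ES N, pd i (pd i v) (x + t • w) * Th w := by
        rw [← integral_const_mul]
        exact integral_congr_ae (ae_of_all _ fun w => by ring)
      rw [h2, h3] at h1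
      linarith
    rw [← e]
    exact key.2
  · refine Eventually.of_forall fun s => ?_
    exact ((hv.sc x s).continuous.mul kk_cont).aestronglyMeasurable
  · exact intg (hv.sc x t).li kk_cont kk_cs
  · refine Continuous.aestronglyMeasurable ?_
    have := kk_cont (N := N)
    fun_prop
  · refine ae_of_all _ fun w s hs => ?_
    by_cases hw : w ∈ closedBall (0 : ES N) 1
    · have h1 := hC (x + s • w) ⟨(s, w), ⟨hs, hw⟩, rfl⟩
      have h2 : ‖w‖ ≤ 1 := by simpa using hw
      rw [norm_mul, Real.norm_of_nonneg (kk_nn w)]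
      refine mul_le_mul_of_nonneg_right ?_ (kk_nn w)
      refine ((fderiv ℝ v (x + s • w)).le_opNorm w).trans ?_
      have := norm_nonneg (fderiv ℝ v (x + s • w))
      have := norm_nonneg w
      nlinarith
    · simp [kk_off hw]
  · exact kk_int.const_mul C
  · refine ae_of_all _ fun w s _ => ?_
    have h1 : HasDerivAt (fun s : ℝ => x + s • w) w s := by
      simpa using ((hasDerivAt_id s).smul_const w).const_add x
    exact ((hv.diff (x + s • w)).hasFDerivAt.comp_hasDerivAt s h1).mul_const _

theorem mem_sc {N : ℕ} {x w : ES N} {t ρ : ℝ} (ht : 0 ≤ t) (htρ : t ≤ ρ) (hw : w ∈ closedBall (0 : ES N) 1) :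
    x + t • w ∈ closedBall x ρ := by
  have : ‖w‖ ≤ 1 := by simpa using hw
  rw [mem_closedBall, dist_eq_norm, add_sub_cancel_left, norm_smul, Real.norm_of_nonneg ht]
  nlinarith [norm_nonneg w]

theorem smv_sub {N : ℕ} {v : ES N → ℝ} (hv : Sm v) {C ρ : ℝ} (hC : 0 ≤ C) (hρ : 0 ≤ ρ) {x : ES N}
    (h : ∀ y ∈ closedBall x ρ, - C ≤ lap v y) : cN N * v x ≤ Av v x ρ + C * ρ ^ 2 / 4 * cN N := by
  have hd : ∀ t, HasDerivAt (fun t => Av v x t + C * t ^ 2 / 4 * cN N)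
      (t / 2 * (∫ w, lap v (x + t • w) * Th w) + C * t / 2 * cN N) t := fun t => by
    have h1 : HasDerivAt (fun t => C * t ^ 2 / 4 * cN N) (C * t / 2 * cN N) t := by
      have := (((hasDerivAt_pow 2 t).const_mul C).div_const 4).mul_const (cN N)
      refine this.congr_deriv ?_
      rw [show (2:ℕ) - 1 = 1 from rfl]; push_cast; ring
    exact (Av_deriv hv x t).add h1
  have hm : MonotoneOn (fun t => Av v x t + C * t ^ 2 / 4 * cN N) (Icc 0 ρ) := by
    refine monotoneOn_of_deriv_nonneg (convex_Icc 0 ρ) (fun t _ => (hd t).continuousAt.continuousWithinAt)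
      (fun t _ => (hd t).differentiableAt.differentiableWithinAt) ?_
    intro t ht
    rw [interior_Icc] at ht
    rw [(hd t).deriv]
    have h1 : ∫ w : ES N, (-C) * Th w ≤ ∫ w, lap v (x + t • w) * Th w := by
      refine integral_mono (Th_int.const_mul _) (intg (hv.lap.sc x t).li Th_cont Th_cs) fun w => ?_
      by_cases hw : w ∈ closedBall (0 : ES N) 1
      · exact mul_le_mul_of_nonneg_right (h _ (mem_sc ht.1.le ht.2.le hw)) (Th_nn w)
      · simp [Th_off hw]
    rw [integral_const_mul] at h1
    have h2 := Th_le_cN N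
    have h3 : 0 ≤ (∫ w, lap v (x + t • w) * Th w) + C * cN N := by nlinarith
    nlinarith [mul_nonneg ht.1.le h3]
  have := hm (left_mem_Icc.2 hρ) (right_mem_Icc.2 hρ) hρ
  simpa [Av_zero] using this

theorem smv_sup {N : ℕ} {v : ES N → ℝ} (hv : Sm v) {M ρ : ℝ} (hM : 0 ≤ M) (hρ : 0 ≤ ρ) {x : ES N}
    (h0 : ∀ y ∈ closedBall x ρ, 0 ≤ v y)
    (h : ∀ y ∈ closedBall x ρ, lap v y ≤ M * v y) : Real.exp (- (M * ρ ^ 2 / 4)) * Av v x ρ ≤ cN N * v x := by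
  have hd : ∀ t, HasDerivAt (fun t => Real.exp (- (M * t ^ 2 / 4)) * Av v x t)
      (Real.exp (- (M * t ^ 2 / 4)) * (- (M * t / 2)) * Av v x t +
        Real.exp (- (M * t ^ 2 / 4)) * (t / 2 * (∫ w, lap v (x + t • w) * Th w))) t := fun t => by
    have h1 : HasDerivAt (fun t : ℝ => - (M * t ^ 2 / 4)) (- (M * t / 2)) t := by
      have := (((hasDerivAt_pow 2 t).const_mul M).div_const 4).neg
      refine this.congr_deriv ?_
      rw [show (2:ℕ) - 1 = 1 from rfl]; push_cast; ring
    exact h1.exp.mul (Av_deriv hv x t)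
  have hm : AntitoneOn (fun t => Real.exp (- (M * t ^ 2 / 4)) * Av v x t) (Icc 0 ρ) := by
    refine antitoneOn_of_deriv_nonpos (convex_Icc 0 ρ) (fun t _ => (hd t).continuousAt.continuousWithinAt)
      (fun t _ => (hd t).differentiableAt.differentiableWithinAt) ?_
    intro t ht
    rw [interior_Icc] at ht
    rw [(hd t).deriv]
    have h1 : ∫ w, lap v (x + t • w) * Th w ≤ ∫ w : ES N, M * (v (x + t • w) * kk w) := by
      refine integral_mono (intg (hv.lap.sc x t).li Th_cont Th_cs)
        ((intg (hv.sc x t).li kk_cont kk_cs).const_mul _) fun w => ?_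
      by_cases hw : w ∈ closedBall (0 : ES N) 1
      · have hm := mem_sc (x := x) ht.1.le ht.2.le hw
        have a1 := mul_le_mul_of_nonneg_right (h _ hm) (Th_nn w)
        have a2 := mul_le_mul_of_nonneg_left (Th_le w) (mul_nonneg hM (h0 _ hm))
        simp only
        linarith
      · simp [Th_off hw, kk_off hw]
    rw [integral_const_mul] at h1
    have h2 := mul_le_mul_of_nonneg_left h1 (show 0 ≤ Real.exp (- (M * t ^ 2 / 4)) * (t / 2) from
      mul_nonneg (Real.exp_pos _).le (by linarith [ht.1]))
    unfold Av
    linarith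
  have := hm (left_mem_Icc.2 hρ) (right_mem_Icc.2 hρ) hρ
  simpa [Av_zero] using this

theorem ae_sc {N : ℕ} {p : ES N → Prop} (h : ∀ᵐ z, p z) (x : ES N) {ρ : ℝ} (hρ : ρ ≠ 0) :
    ∀ᵐ w, p (x + ρ • w) := by
  have h1 : ∀ᵐ z, p (x + z) := (measurePreserving_add_left volume x).quasiMeasurePreserving.ae h
  exact (Measure.quasiMeasurePreserving_smul (μ := (volume : Measure (ES N))) hρ).ae h1

theorem aesm_sc {N : ℕ} {f : ES N → ℝ} (h : AEStronglyMeasurable f volume) (x : ES N) {ρ : ℝ} (hρ : ρ ≠ 0) :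
    AEStronglyMeasurable (fun w => f (x + ρ • w)) volume := by
  have h1 : AEStronglyMeasurable (fun z => f (x + z)) volume :=
    h.comp_quasiMeasurePreserving (measurePreserving_add_left volume x).quasiMeasurePreserving
  exact h1.comp_quasiMeasurePreserving (Measure.quasiMeasurePreserving_smul (μ := (volume : Measure (ES N))) hρ)

theorem BM.sc {N : ℕ} {f : ES N → ℝ} (h : BM f) (x : ES N) {ρ : ℝ} (hρ : ρ ≠ 0) :
    BM (fun w => f (x + ρ • w)) := by
  obtain ⟨hm, C, hC0, hC⟩ := h
  exact ⟨aesm_sc hm x hρ, C, hC0, ae_sc hC x hρ⟩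

theorem Av_int {N : ℕ} {f : ES N → ℝ} (h : BM f) (x : ES N) {ρ : ℝ} (hρ : ρ ≠ 0) :
    Integrable (fun w => f (x + ρ • w) * kk w) := intg (h.sc x hρ).li kk_cont kk_cs

theorem mol_mono {N n : ℕ} {f g : ES N → ℝ} {x : ES N} (hf : LocallyIntegrable f) (hg : LocallyIntegrable g)
    (h : ∀ᵐ y, y ∈ closedBall x (1 / (n + 1)) → f y ≤ g y) : mol n f x ≤ mol n g x := by
  refine integral_mono_ae (intg hf ((eta_sm N n).refl x).continuous (cs_refl (eta_cs N n) x))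
    (intg hg ((eta_sm N n).refl x).continuous (cs_refl (eta_cs N n) x)) ?_
  filter_upwards [h] with y hy
  by_cases hz : y ∈ closedBall x (1 / (n + 1))
  · exact mul_le_mul_of_nonneg_right (hy hz) (eta_nn _ _ _)
  · have : eta N n (x - y) = 0 := eta_zero (by
      rw [mem_closedBall, dist_comm, dist_eq_norm] at hz; simpa using hz)
    simp [this]

theorem mol_const {N n : ℕ} (c : ℝ) (x : ES N) : mol n (fun _ => c) x = c := by
  simp only [mol, cv]
  rw [integral_const_mul, integral_sub_left_eq_self (eta N n) volume x, eta_int, mul_one]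

theorem mol_neg {N n : ℕ} (f : ES N → ℝ) (x : ES N) : mol n (fun y => - f y) x = - mol n f x := by
  simp only [mol, cv, neg_mul, integral_neg]

theorem mol_cmul {N n : ℕ} (c : ℝ) (f : ES N → ℝ) (x : ES N) : mol n (fun y => c * f y) x = c * mol n f x := by
  simp only [mol, cv, mul_assoc, integral_const_mul]

/-- Lebesgue points -/
def LP {N : ℕ} (f : ES N → ℝ) (x : ES N) : Prop := Tendsto (fun n => mol n f x) atTop (𝓝 (f x))

theorem LP.ae {N : ℕ} {f : ES N → ℝ} (hf : BM f) : ∀ᵐ x, LP f x := mol_tendsto hf.li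

theorem Av_lim {N : ℕ} {f : ES N → ℝ} (hf : BM f) (x : ES N) {ρ : ℝ} (hρ : ρ ≠ 0) :
    Tendsto (fun n => Av (mol n f) x ρ) atTop (𝓝 (Av f x ρ)) := by
  obtain ⟨C, hC0, hC⟩ := hf.2
  refine tendsto_integral_of_dominated_convergence (fun w => C * kk w) ?_ (kk_int.const_mul C) ?_ ?_
  · intro n
    exact (((mol_sm hf.li).sc x ρ).continuous.mul kk_cont).aestronglyMeasurable
  · intro n
    refine ae_of_all _ fun w => ?_
    rw [norm_mul, Real.norm_of_nonneg (kk_nn w)]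
    exact mul_le_mul_of_nonneg_right (mol_bound hC _) (kk_nn w)
  · filter_upwards [ae_sc (LP.ae hf) x hρ] with w hw
    exact hw.mul_const _

theorem unif_ball {N : ℕ} {K O : Set (ES N)} (hO : IsOpen O) (hK : IsCompact K) (h : K ⊆ O) :
    ∀ᶠ n : ℕ in atTop, ∀ y ∈ K, closedBall y (1 / ((n:ℝ) + 1)) ⊆ O := by
  obtain ⟨δ, hδ, hδO⟩ := hK.exists_cthickening_subset_open hO h
  have h1 : Tendsto (fun n : ℕ => 1 / ((n : ℝ) + 1)) atTop (𝓝 0) := tendsto_one_div_add_atTop_nhds_zero_nat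
  filter_upwards [h1.eventually (gt_mem_nhds hδ)] with n hn y hy
  refine subset_trans ?_ hδO
  exact (closedBall_subset_closedBall hn.le).trans (closedBall_subset_cthickening hy δ)

theorem mv_sub {N : ℕ} {O : Set (ES N)} (hO : IsOpen O) {f F : ES N → ℝ} (hf : BM f)
    (hF : LocallyIntegrable F) (h : SubW O f F) {C ρ : ℝ} (hC : 0 ≤ C) (hFC : ∀ᵐ x, x ∈ O → - C ≤ F x)
    (hρ : 0 < ρ) {x : ES N} (hx : closedBall x ρ ⊆ O) (hLP : LP f x) :
    cN N * f x ≤ Av f x ρ + C * ρ ^ 2 / 4 * cN N := by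
  refine le_of_tendsto_of_tendsto (hLP.const_mul (cN N)) ((Av_lim hf x hρ.ne').add_const _) ?_
  filter_upwards [unif_ball hO (isCompact_closedBall x ρ) hx] with n hn
  refine smv_sub (mol_sm hf.li) hC hρ.le fun y hy => ?_
  refine le_trans ?_ (h.mol hf.li (hn y hy))
  rw [← mol_const (n := n) (-C) y]
  refine mol_mono (BM.const _).li hF ?_
  filter_upwards [hFC] with z hz hzb using hz (hn y hy hzb)

theorem mv_sup {N : ℕ} {O : Set (ES N)} (hO : IsOpen O) {s F : ES N → ℝ} (hs : BM s)
    (hF : LocallyIntegrable F) (h : SubW O (fun x => - s x) (fun x => - F x)) {M ρ : ℝ} (hM : 0 ≤ M)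
    (hs0 : ∀ᵐ x, x ∈ O → 0 ≤ s x)
    (hFC : ∀ᵐ x, x ∈ O → F x ≤ M * s x)
    (hρ : 0 < ρ) {x : ES N} (hx : closedBall x ρ ⊆ O) (hLP : LP s x) :
    Real.exp (- (M * ρ ^ 2 / 4)) * Av s x ρ ≤ cN N * s x := by
  refine le_of_tendsto_of_tendsto ((Av_lim hs x hρ.ne').const_mul _) (hLP.const_mul (cN N)) ?_
  filter_upwards [unif_ball hO (isCompact_closedBall x ρ) hx] with n hn
  refine smv_sup (mol_sm hs.li) hM hρ.le (fun y hy => ?_) fun y hy => ?_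
  · rw [← mol_const (n := n) 0 y]
    refine mol_mono (BM.const _).li hs.li ?_
    filter_upwards [hs0] with z hz hzb using hz (hn y hy hzb)
  · have h1 := h.mol hs.neg.li (hn y hy)
    have e : lap (mol n fun x => - s x) y = - lap (mol n s) y := by
      rw [← lap_neg (mol_sm hs.li)]; congr 1; funext z; exact mol_neg s z
    rw [mol_neg, e] at h1
    have h2 : mol n F y ≤ M * mol n s y := by
      rw [← mol_cmul]
      refine mol_mono hF (hs.cmul M).li ?_
      filter_upwards [hFC] with z hz hzb using hz (hn y hy hzb)
    linarith

/-- continuity points are Lebesgue points -/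
theorem LP.of_cont {N : ℕ} {f : ES N → ℝ} (hf : LocallyIntegrable f) {x : ES N} (h : ContinuousAt f x) :
    LP f x := by
  rw [LP, Metric.tendsto_atTop]
  intro ε hε
  obtain ⟨δ, hδ, hδf⟩ := Metric.continuousAt_iff.1 h (ε / 2) (by linarith)
  have h1 : Tendsto (fun n : ℕ => 1 / ((n : ℝ) + 1)) atTop (𝓝 0) := tendsto_one_div_add_atTop_nhds_zero_nat
  obtain ⟨n0, hn0⟩ := eventually_atTop.1 (h1.eventually (gt_mem_nhds hδ))
  refine ⟨n0, fun n hn => ?_⟩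
  have hb : ∀ y ∈ closedBall x (1 / ((n:ℝ) + 1)), |f y - f x| < ε / 2 := fun y hy =>
    hδf (lt_of_le_of_lt hy (hn0 n hn))
  have a1 : mol n f x ≤ mol n (fun _ => f x + ε / 2) x := mol_mono hf (BM.const _).li
    (ae_of_all _ fun y hy => by linarith [(abs_lt.1 (hb y hy)).2])
  have a2 : mol n (fun _ => f x - ε / 2) x ≤ mol n f x := mol_mono (BM.const _).li hf
    (ae_of_all _ fun y hy => by linarith [(abs_lt.1 (hb y hy)).1])
  rw [mol_const] at a1 a2
  rw [Real.dist_eq, abs_lt]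
  constructor <;> linarith

/-- boundedness of integrable subsolutions -/
theorem bm_of_sub {N : ℕ} {f F : ES N → ℝ} (hf : Integrable f) (hf0 : ∀ x, 0 ≤ f x)
    (hF : LocallyIntegrable F) (h : SubW univ f F) {C : ℝ} (hC : 0 ≤ C) (hFC : ∀ᵐ x, - C ≤ F x) : BM f := by
  have hI : ∀ n, Integrable (mol n f) ∧ ∫ x, mol n f x = ∫ x, f x := by
    intro n
    have hη : Integrable (eta N n) := (eta_sm N n).continuous.integrable_of_hasCompactSupport (eta_cs N n)
    refine ⟨hf.integrable_convolution (ContinuousLinearMap.lsmul ℝ ℝ) hη, ?_⟩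
    have := integral_convolution (ContinuousLinearMap.lsmul ℝ ℝ) hf hη (μ := volume) (ν := volume)
    rw [eta_int] at this
    simpa [mol, cv_eq] using this
  have hb : ∀ n x, mol n f x ≤ (2 * (∫ x, f x) + C / 4 * cN N) / cN N := by
    intro n x
    rw [le_div_iff₀ (cN_pos N), mul_comm]
    have h1 := smv_sub (mol_sm (n := n) hf.locallyIntegrable) hC zero_le_one (x := x) fun y _ => by
      refine le_trans ?_ (h.mol hf.locallyIntegrable (subset_univ _))
      rw [← mol_const (n := n) (-C) y]
      refine mol_mono (BM.const _).li hF ?_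
      filter_upwards [hFC] with z hz _ using hz
    refine h1.trans (add_le_add ?_ (by simp))
    have h2 : Av (mol n f) x 1 ≤ ∫ w, 2 * mol n f (x + w) := by
      unfold Av
      refine integral_mono (intg ((mol_sm hf.locallyIntegrable).sc x 1).li kk_cont kk_cs)
        (((hI n).1.comp_add_left x).const_mul 2) fun w => ?_
      simp only [one_smul]
      have := mol_nonneg (n := n) (ae_of_all _ hf0) (x + w)
      have := kk_le w
      nlinarith
    rw [integral_const_mul, integral_add_left_eq_self (mol n f) x, (hI n).2] at h2
    exact h2
  refine ⟨hf.1, (2 * (∫ x, f x) + C / 4 * cN N) / cN N, ?_, ?_⟩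
  · have := cN_pos N
    have : 0 ≤ ∫ x, f x := integral_nonneg fun x => hf0 x
    positivity
  · filter_upwards [mol_tendsto hf.locallyIntegrable] with x hx
    rw [abs_of_nonneg (hf0 x)]
    exact le_of_tendsto hx (Eventually.of_forall fun n => hb n x)

/-- volume of a ball -/
def vv (N : ℕ) (τ : ℝ) : ℝ := (volume (ball (0 : ES N) τ)).toReal

theorem vv_pos (N : ℕ) {τ : ℝ} (h : 0 < τ) : 0 < vv N τ :=
  ENNReal.toReal_pos (measure_ball_pos _ _ h).ne' measure_ball_lt_top.ne

theorem kk_ge {N : ℕ} {w : ES N} (h : ‖w‖ ≤ 17 / 20) : 1 / 2 ≤ kk w := by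
  unfold kk
  have := le_max_left (1 - ‖w‖ ^ 2) 0
  nlinarith [norm_nonneg w]

theorem Av_low {N : ℕ} {f : ES N → ℝ} (hf : BM f) {y z : ES N} {ρ τ h : ℝ} (hρ : 0 < ρ)
    (hd : dist z y + τ ≤ 17 / 20 * ρ) (hh : 0 ≤ h) (hf0 : ∀ᵐ x, x ∈ closedBall z ρ → 0 ≤ f x)
    (hfh : ∀ᵐ x, x ∈ ball y τ → h ≤ f x) : h / 2 * vv N (τ / ρ) ≤ Av f z ρ := by
  set S : Set (ES N) := ball (ρ⁻¹ • (y - z)) (τ / ρ) with hS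
  have hSv : (volume S).toReal = vv N (τ / ρ) := by
    rw [hS, vv, ← Measure.addHaar_ball_center volume (ρ⁻¹ • (y - z)) (τ / ρ)]
  have hmem : ∀ w ∈ S, z + ρ • w ∈ ball y τ ∧ ‖w‖ ≤ 17 / 20 := by
    intro w hw
    rw [hS, mem_ball, dist_eq_norm] at hw
    have e : z + ρ • w - y = ρ • (w - ρ⁻¹ • (y - z)) := by
      rw [smul_sub, smul_smul, mul_inv_cancel₀ hρ.ne', one_smul]; abel
    have h1 : z + ρ • w ∈ ball y τ := by
      rw [mem_ball, dist_eq_norm, e, norm_smul, Real.norm_of_nonneg hρ.le]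
      rwa [lt_div_iff₀ hρ, mul_comm] at hw
    refine ⟨h1, ?_⟩
    have h2 : ‖ρ • w‖ ≤ 17 / 20 * ρ := by
      have : ρ • w = (z + ρ • w - y) + (y - z) := by abel
      rw [this]
      refine (norm_add_le _ _).trans ?_
      rw [mem_ball, dist_eq_norm] at h1
      rw [dist_comm, dist_eq_norm] at hd
      linarith
    rw [norm_smul, Real.norm_of_nonneg hρ.le] at h2
    nlinarith
  have h1 : ∫ w, S.indicator (fun _ => h / 2) w ≤ Av f z ρ := by
    refine integral_mono_ae ?_ (Av_int hf z hρ.ne') ?_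
    · rw [integrable_indicator_iff measurableSet_ball]
      exact integrableOn_const measure_ball_lt_top.ne
    · filter_upwards [ae_sc hf0 z hρ.ne', ae_sc hfh z hρ.ne'] with w h1 h2
      by_cases hw : w ∈ S
      · rw [indicator_of_mem hw]
        obtain ⟨a1, a2⟩ := hmem w hw
        have := h2 a1
        have := kk_ge a2
        nlinarith
      · rw [indicator_of_notMem hw]
        by_cases hw1 : w ∈ closedBall (0 : ES N) 1
        · exact mul_nonneg (h1 (mem_sc hρ.le le_rfl hw1)) (kk_nn w)
        · rw [kk_off hw1, mul_zero]
  rw [integral_indicator measurableSet_ball, setIntegral_const, smul_eq_mul, Measure.real, hSv] at h1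
  linarith

theorem Av_const_sub {N : ℕ} {f : ES N → ℝ} (hf : BM f) (x : ES N) {ρ : ℝ} (hρ : 0 < ρ) (S : ℝ) :
    Av (fun y => S - f y) x ρ = S * cN N - Av f x ρ := by
  unfold Av cN
  rw [← integral_const_mul, ← integral_sub (kk_int.const_mul S) (Av_int hf x hρ.ne')]
  exact integral_congr_ae (ae_of_all _ fun w => by ring)

theorem Av_cmp {N : ℕ} {f : ES N → ℝ} (hf : BM f) {y z : ES N} {ρ : ℝ} (hρ : 0 < ρ)
    (hd : dist z y ≤ 3 / 5 * ρ) (hf0 : ∀ᵐ x, x ∈ closedBall z ρ → 0 ≤ f x) :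
    Av f y (ρ / 4) ≤ 4 * 4 ^ N * Av f z ρ := by
  set G : ES N → ℝ := fun w => f (z + ρ • w) * kk w with hG
  have hGi : Integrable G := Av_int hf z hρ.ne'
  set b : ES N := ρ⁻¹ • (y - z) with hb
  have e1 : ∫ w, G (b + (1 / 4 : ℝ) • w) = 4 ^ N * Av f z ρ := by
    have := Measure.integral_comp_smul (volume : Measure (ES N)) (fun w => G (b + w)) (1 / 4 : ℝ)
    rw [this, integral_add_left_eq_self G b]
    simp [Av, hG]
  have hi : Integrable (fun w => G (b + (1 / 4 : ℝ) • w)) :=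
    (hGi.comp_add_left b).comp_smul (by norm_num)
  have e2 : ∀ w, G (b + (1 / 4 : ℝ) • w) = f (y + (ρ / 4) • w) * kk (b + (1 / 4 : ℝ) • w) := by
    intro w
    simp only [hG]
    congr 2
    rw [hb, smul_add, smul_smul, smul_smul, mul_inv_cancel₀ hρ.ne', one_smul]
    rw [show ρ * (1 / 4) = ρ / 4 by ring]; abel
  have h1 : Av f y (ρ / 4) ≤ ∫ w, 4 * G (b + (1 / 4 : ℝ) • w) := by
    refine integral_mono_ae (Av_int hf y (by positivity)) (hi.const_mul 4) ?_
    filter_upwards [ae_sc hf0 y (show ρ / 4 ≠ 0 by positivity)] with w hw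
    simp only [e2]
    by_cases hw1 : w ∈ closedBall (0 : ES N) 1
    · have hm : y + (ρ / 4) • w ∈ closedBall z ρ := by
        have h1 := mem_sc (x := y) (show 0 ≤ ρ / 4 by positivity) le_rfl hw1
        rw [mem_closedBall] at h1 ⊢
        have := dist_triangle (y + (ρ / 4) • w) y z
        rw [dist_comm] at hd
        linarith
      have h0 := hw hm
      have hbn : ‖b + (1 / 4 : ℝ) • w‖ ≤ 17 / 20 := by
        have h3 : ‖b‖ ≤ 3 / 5 := by
          rw [hb, norm_smul, Real.norm_of_nonneg (by positivity), ← dist_eq_norm, dist_comm,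
            inv_mul_le_iff₀ hρ]
          linarith
        have h4 : ‖(1 / 4 : ℝ) • w‖ ≤ 1 / 4 := by
          rw [norm_smul]
          have : ‖w‖ ≤ 1 := by simpa using hw1
          norm_num; linarith
        exact (norm_add_le _ _).trans (by linarith)
      have := kk_ge hbn
      have := kk_le w
      nlinarith
    · rw [kk_off hw1, mul_zero]
      by_cases hm : b + (1 / 4 : ℝ) • w ∈ closedBall (0 : ES N) 1
      · have hm2 := mem_sc (x := z) hρ.le le_rfl hm
        have e3 : z + ρ • (b + (1 / 4 : ℝ) • w) = y + (ρ / 4) • w := by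
          rw [hb, smul_add, smul_smul, smul_smul, mul_inv_cancel₀ hρ.ne', one_smul]
          rw [show ρ * (1 / 4) = ρ / 4 by ring]; abel
        rw [e3] at hm2
        have := hw hm2
        have := kk_nn (b + (1 / 4 : ℝ) • w)
        positivity
      · rw [kk_off hm]; simp
  rw [integral_const_mul, e1] at h1
  linarith

/-- Harnack inequality -/
theorem harn {N : ℕ} {O : Set (ES N)} (hO : IsOpen O) {f F : ES N → ℝ} (hf : BM f)
    (hF : LocallyIntegrable F) (hsub : SubW O f (fun _ => 0))
    (hsup : SubW O (fun x => - f x) (fun x => - F x)) {M ρ : ℝ} (hM : 0 ≤ M)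
    (hf0 : ∀ᵐ x, x ∈ O → 0 ≤ f x) (hFM : ∀ᵐ x, x ∈ O → F x ≤ M * f x) (hρ : 0 < ρ) {y z : ES N}
    (hy : closedBall y (ρ / 4) ⊆ O) (hz : closedBall z ρ ⊆ O) (hd : dist z y ≤ 3 / 5 * ρ)
    (hLy : LP f y) (hLz : LP f z) :
    f y ≤ 4 * 4 ^ N * Real.exp (M * ρ ^ 2 / 4) * f z := by
  have h1 := mv_sub hO hf (BM.const 0).li hsub le_rfl (by simp) (show 0 < ρ / 4 by positivity) hy hLy
  have h2 := mv_sup hO hf hF hsup hM hf0 hFM hρ hz hLz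
  have h3 := Av_cmp hf hρ hd (hf0.mono fun x hx hxz => hx (hz hxz))
  have hc := cN_pos N
  rw [Real.exp_neg, inv_mul_le_iff₀ (Real.exp_pos _)] at h2
  simp only [zero_mul, zero_div, add_zero] at h1
  have h4 : cN N * f y ≤ cN N * (4 * 4 ^ N * Real.exp (M * ρ ^ 2 / 4) * f z) := by
    calc cN N * f y ≤ 4 * 4 ^ N * Av f z ρ := h1.trans h3
      _ ≤ 4 * 4 ^ N * (Real.exp (M * ρ ^ 2 / 4) * (cN N * f z)) := by gcongr
      _ = _ := by ring
  exact le_of_mul_le_mul_left h4 hc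

/-- local geometry: an open set with the (one sided) cone property in a ball -/
structure Geo {N : ℕ} (D : Set (ES N)) (P e : ES N) (R c0 : ℝ) : Prop where
  op : IsOpen D
  ne : ‖e‖ = 1
  cpos : 0 < c0
  cle : c0 ≤ 1
  Pn : P ∉ D
  cone : ∀ x ∈ D, x ∈ ball P R → ∀ t, 0 ≤ t → ∀ v : ES N, ‖v‖ ≤ c0 * t →
    x + t • e + v ∈ ball P R → x + t • e + v ∈ D

theorem Geo.mono {N : ℕ} {D : Set (ES N)} {P e : ES N} {R R' c0 : ℝ} (h : Geo D P e R c0) (hR : R' ≤ R) :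
    Geo D P e R' c0 :=
  ⟨h.op, h.ne, h.cpos, h.cle, h.Pn, fun x hx hb t ht v hv hb' =>
    h.cone x hx (ball_subset_ball hR hb) t ht v hv (ball_subset_ball hR hb')⟩

/-- admissible potentials -/
structure Pot {N : ℕ} (D : Set (ES N)) (a : ℝ) (W : ES N → ℝ) : Prop where
  bm : BM W
  nn : ∀ x, 0 ≤ W x
  bd : ∀ x, W x * dista D x ^ 2 ≤ a
  a0 : 0 ≤ a

/-- nonnegative bounded supersolutions -/
def Spr {N : ℕ} (D B : Set (ES N)) (W s : ES N → ℝ) : Prop :=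
  BM s ∧ SubW (D ∩ B) (fun x => - s x) (fun x => - (W x * s x)) ∧ ∀ᵐ x, x ∈ D ∩ B → 0 ≤ s x

theorem dista_le {N : ℕ} {D : Set (ES N)} {P : ES N} (h : P ∉ D) (x : ES N) : dista D x ≤ dist x P :=
  infDist_le_dist_of_mem h

theorem dista_lip {N : ℕ} (D : Set (ES N)) (x y : ES N) : dista D x ≤ dista D y + dist x y :=
  infDist_le_infDist_add_dist

theorem dista_nn {N : ℕ} (D : Set (ES N)) (x : ES N) : 0 ≤ dista D x := infDist_nonneg

theorem dista_ball {N : ℕ} (D : Set (ES N)) (x : ES N) : ball x (dista D x) ⊆ D := ball_infDist_compl_subset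

theorem dista_pos {N : ℕ} {D : Set (ES N)} (hD : IsOpen D) {P : ES N} (h : P ∉ D) {x : ES N} (hx : x ∈ D) :
    0 < dista D x :=
  (hD.isClosed_compl.notMem_iff_infDist_pos ⟨P, h⟩).1 (by simpa using hx)

theorem dista_mem {N : ℕ} {D : Set (ES N)} {x : ES N} (hx : 0 < dista D x) : x ∈ D :=
  dista_ball D x (mem_ball_self hx)

theorem dista_ge {N : ℕ} {D : Set (ES N)} {P : ES N} (h : P ∉ D) {x : ES N} {r : ℝ} (hr : ball x r ⊆ D) :
    r ≤ dista D x := by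
  refine (le_infDist ⟨P, h⟩).2 fun y hy => ?_
  by_contra hlt
  push Not at hlt
  exact hy (hr (by rwa [mem_ball, dist_comm]))

theorem Geo.inner {N : ℕ} {D : Set (ES N)} {P e : ES N} {R c0 : ℝ} (h : Geo D P e R c0) {x : ES N}
    (hx : x ∈ ball P (R / 2)) : ball x (dista D x) ⊆ D ∩ ball P R := by
  refine subset_inter (dista_ball D x) fun y hy => ?_
  have h1 := dista_le h.Pn x
  rw [mem_ball] at *
  have := dist_triangle y x P
  linarith

theorem Geo.up {N : ℕ} {D : Set (ES N)} {P e : ES N} {R c0 : ℝ} (h : Geo D P e R c0) {y : ES N}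
    (hy : y ∈ ball P (R / 4)) (hyD : y ∈ D) {t : ℝ} (ht : 0 ≤ t) (htR : t ≤ R / 4) :
    dista D y + c0 * t ≤ dista D (y + t • e) := by
  refine dista_ge h.Pn fun z hz => ?_
  have hd := dista_pos h.op h.Pn hyD
  have hdP := dista_le h.Pn y
  have hc0 := h.cpos
  have hc1 := h.cle
  rw [mem_ball, dist_eq_norm] at hz
  set v := z - (y + t • e) with hv
  set L := dista D y + c0 * t with hL
  have hLpos : 0 < L := by positivity
  have e0 : z = (y + (dista D y / L) • v) + t • e + (c0 * t / L) • v := by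
    have : (dista D y / L) • v + (c0 * t / L) • v = v := by
      rw [← add_smul, ← add_div, ← hL, div_self hLpos.ne', one_smul]
    calc z = y + t • e + v := by rw [hv]; abel
      _ = y + t • e + ((dista D y / L) • v + (c0 * t / L) • v) := by rw [this]
      _ = _ := by abel
  have n1 : ‖(dista D y / L) • v‖ < dista D y := by
    rw [norm_smul, Real.norm_of_nonneg (by positivity), div_mul_eq_mul_div, div_lt_iff₀ hLpos]
    exact mul_lt_mul_of_pos_left hz hd
  have n2 : ‖(c0 * t / L) • v‖ ≤ c0 * t := by
    rw [norm_smul, Real.norm_of_nonneg (by positivity), div_mul_eq_mul_div, div_le_iff₀ hLpos]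
    exact mul_le_mul_of_nonneg_left hz.le (by positivity)
  rw [mem_ball, dist_eq_norm] at hy
  rw [dist_eq_norm] at hdP
  rw [e0]
  refine h.cone _ (dista_ball D y ?_) ?_ t ht _ n2 ?_
  · rw [mem_ball, dist_eq_norm, add_sub_cancel_left]; exact n1
  · rw [mem_ball, dist_eq_norm, add_sub_right_comm]
    refine (norm_add_le _ _).trans_lt ?_
    have := norm_nonneg (y - P)
    linarith
  · rw [← e0, mem_ball, dist_eq_norm]
    have : z - P = (y - P) + t • e + v := by rw [hv]; abel
    rw [this]
    have n3 : ‖t • e‖ = t := by rw [norm_smul, h.ne, mul_one, Real.norm_of_nonneg ht]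
    have h1 := norm_add_le ((y - P) + t • e) v
    have h2 := norm_add_le (y - P) (t • e)
    have h3 : c0 * t ≤ t := mul_le_of_le_one_left ht hc1
    linarith

/-- Harnack chain constant -/
def cH (N : ℕ) (a : ℝ) : ℝ := Real.exp (-(100 * a / 16)) * min (vv N (1 / 4) / 2 / cN N) 1

theorem cH_pos (N : ℕ) (a : ℝ) : 0 < cH N a :=
  mul_pos (Real.exp_pos _) (lt_min (div_pos (by linarith [vv_pos N (show (0:ℝ) < 1 / 4 by norm_num)]) (cN_pos N)) one_pos)

theorem cH_le {N : ℕ} {a : ℝ} (ha : 0 ≤ a) : cH N a ≤ 1 := by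
  unfold cH
  refine mul_le_one₀ (Real.exp_le_one_iff.2 (by linarith)) ?_ (min_le_right _ _)
  have := vv_pos N (show (0:ℝ) < 1 / 4 by norm_num)
  have := cN_pos N
  positivity

/-- lower bound on the Whitney ball -/
def Low {N : ℕ} (D : Set (ES N)) (s : ES N → ℝ) (y : ES N) (h : ℝ) : Prop :=
  ∀ᵐ z, z ∈ ball y (dista D y / 8) → h ≤ s z

/-- accessibility by a chain of length n -/
def Acc {N : ℕ} (D B : Set (ES N)) (W : ES N → ℝ) (a : ℝ) (n : ℕ) (y y' : ES N) : Prop :=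
  ∀ s h, Spr D B W s → 0 ≤ h → Low D s y h → Low D s y' (cH N a ^ n * h)

theorem Acc.trans {N : ℕ} {D B : Set (ES N)} {W : ES N → ℝ} {a : ℝ} {n m : ℕ} {x y z : ES N}
    (h1 : Acc D B W a n x y) (h2 : Acc D B W a m y z) : Acc D B W a (n + m) x z := by
  intro s h hs hh hl
  have := h2 s _ hs (mul_nonneg (pow_nonneg (cH_pos N a).le n) hh) (h1 s h hs hh hl)
  rw [pow_add, mul_comm (cH N a ^ n), mul_assoc]; exact this

theorem Low.mono {N : ℕ} {D : Set (ES N)} {s : ES N → ℝ} {y : ES N} {h h' : ℝ} (hl : Low D s y h) (hh : h' ≤ h) :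
    Low D s y h' := Filter.Eventually.mono hl fun _ hz hm => hh.trans (hz hm)

theorem Acc.mono {N : ℕ} {D B : Set (ES N)} {W : ES N → ℝ} {a : ℝ} (ha : 0 ≤ a) {n m : ℕ} {x y : ES N}
    (h1 : Acc D B W a n x y) (hnm : n ≤ m) : Acc D B W a m x y := fun s h hs hh hl =>
  (h1 s h hs hh hl).mono (mul_le_mul_of_nonneg_right
    (pow_le_pow_of_le_one (cH_pos N a).le (cH_le ha) hnm) hh)

theorem Pot.loc {N : ℕ} {D : Set (ES N)} {a : ℝ} {W : ES N → ℝ} (hW : Pot D a W) {y z : ES N} {r : ℝ}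
    (hr : 0 < r) (hy : r ≤ dista D y) (hz : z ∈ ball y (9 / 10 * r)) : W z ≤ 100 * a / r ^ 2 := by
  rw [le_div_iff₀ (by positivity)]
  have h1 := dista_lip D y z
  rw [mem_ball, dist_comm] at hz
  have h2 : r / 10 ≤ dista D z := by linarith
  have h3 := hW.bd z
  have h4 := hW.nn z
  have h5 : (r / 10) ^ 2 ≤ dista D z ^ 2 := pow_le_pow_left₀ (by positivity) h2 2
  have := mul_le_mul_of_nonneg_left h5 h4
  linarith

theorem acc_step {N : ℕ} {D B : Set (ES N)} {W : ES N → ℝ} {a : ℝ} (hW : Pot D a W) {y y' : ES N}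
    (hy : 0 < dista D y) (hB : ball y (dista D y) ⊆ D ∩ B) (hd : dist y' y ≤ dista D y / 8) :
    Acc D B W a 1 y y' := by
  intro s h hs hh hl
  obtain ⟨hsB, hsS, hs0⟩ := hs
  set r := dista D y with hr
  have hO : ball y (9 / 10 * r) ⊆ D ∩ B := (ball_subset_ball (by linarith)).trans hB
  have hc := cN_pos N
  filter_upwards [LP.ae hsB] with z hz hzm
  have hzy : dist z y ≤ 3 / 10 * r := by
    have h1 := dista_lip D y' y
    rw [mem_ball] at hzm
    have := dist_triangle z y' y
    linarith
  have hzb : closedBall z (r / 2) ⊆ ball y (9 / 10 * r) := by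
    refine closedBall_subset_ball' ?_
    linarith
  have h1 := mv_sup isOpen_ball hsB (hW.bm.mul hsB).li (hsS.mono hO) (M := 100 * a / r ^ 2)
    (div_nonneg (by linarith [hW.a0]) (sq_nonneg _)) (hs0.mono fun x hx hxm => hx (hO hxm))
    (hs0.mono fun x hx hxm => mul_le_mul_of_nonneg_right (hW.loc hy le_rfl hxm) (hx (hO hxm)))
    (show 0 < r / 2 by linarith) hzb hz
  have h2 := Av_low hsB (z := z) (y := y) (show 0 < r / 2 by linarith) (τ := r / 8) (h := h) (by linarith) hh
    (hs0.mono fun x hx hxm => hx (hO (hzb hxm))) hl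
  rw [show r / 8 / (r / 2) = 1 / 4 by field_simp; norm_num] at h2
  rw [show 100 * a / r ^ 2 * (r / 2) ^ 2 / 4 = 100 * a / 16 by field_simp; ring] at h1
  have h3 : Real.exp (-(100 * a / 16)) * (h / 2 * vv N (1 / 4)) ≤ cN N * s z :=
    (mul_le_mul_of_nonneg_left h2 (Real.exp_pos _).le).trans h1
  rw [pow_one, cH]
  have h4 : Real.exp (-(100 * a / 16)) * min (vv N (1 / 4) / 2 / cN N) 1 * h
      ≤ Real.exp (-(100 * a / 16)) * (vv N (1 / 4) / 2 / cN N) * h := by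
    have := (Real.exp_pos (-(100 * a / 16))).le
    gcongr
    exact min_le_left _ _
  refine h4.trans ?_
  rw [show Real.exp (-(100 * a / 16)) * (vv N (1 / 4) / 2 / cN N) * h =
    (Real.exp (-(100 * a / 16)) * (h / 2 * vv N (1 / 4))) / cN N by ring, div_le_iff₀ hc]
  linarith

theorem Geo.vert {N : ℕ} {D : Set (ES N)} {P e : ES N} {R c0 : ℝ} (hG : Geo D P e R c0) {W : ES N → ℝ} {a : ℝ}
    (hW : Pot D a W) {y : ES N} (hy : y ∈ ball P (R / 4)) (hyD : y ∈ D) (n : ℕ) :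
    ∀ t, 0 ≤ t → t ≤ R / 4 → c0 * t ≤ ((1 + c0 / 10) ^ n - 1) * dista D y →
      Acc D (ball P R) W a n y (y + t • e) ∧ Acc D (ball P R) W a n (y + t • e) y := by
  have hd := dista_pos hG.op hG.Pn hyD
  have hc0 := hG.cpos
  have hin : ∀ t, 0 ≤ t → t ≤ R / 4 → ball (y + t • e) (dista D (y + t • e)) ⊆ D ∩ ball P R := by
    intro t ht htR
    refine hG.inner ?_
    rw [mem_ball, dist_eq_norm] at *
    have n3 : ‖t • e‖ = t := by rw [norm_smul, hG.ne, mul_one, Real.norm_of_nonneg ht]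
    have := norm_add_le (y - P) (t • e)
    rw [add_sub_right_comm]
    linarith
  induction n with
  | zero =>
    intro t ht htR hct
    have : t = 0 := by
      simp at hct
      nlinarith
    subst this
    simp only [zero_smul, add_zero]
    have : Acc D (ball P R) W a 0 y y := fun s h _ _ hl => by simpa using hl
    exact ⟨this, this⟩
  | succ n ih =>
    intro t ht htR hct
    by_cases hle : c0 * t ≤ ((1 + c0 / 10) ^ n - 1) * dista D y
    · obtain ⟨h1, h2⟩ := ih t ht htR hle
      exact ⟨h1.mono hW.a0 (by omega), h2.mono hW.a0 (by omega)⟩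
    push Not at hle
    set t' := ((1 + c0 / 10) ^ n - 1) * dista D y / c0 with ht'
    have hct' : c0 * t' = ((1 + c0 / 10) ^ n - 1) * dista D y := by rw [ht']; field_simp
    have h1p : 1 ≤ (1 + c0 / 10) ^ n := one_le_pow₀ (by linarith)
    have ht'0 : 0 ≤ t' := div_nonneg (mul_nonneg (by linarith) hd.le) hc0.le
    have htt' : t' ≤ t := by
      rw [← hct'] at hle
      exact (lt_of_mul_lt_mul_left hle hc0.le).le
    obtain ⟨h1, h2⟩ := ih t' ht'0 (htt'.trans htR) hct'.le
    have hup := hG.up hy hyD ht'0 (htt'.trans htR)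
    have hup2 := hG.up hy hyD ht htR
    rw [hct'] at hup
    have hdy' : (1 + c0 / 10) ^ n * dista D y ≤ dista D (y + t' • e) := by linarith
    have hstep : t - t' ≤ dista D (y + t' • e) / 10 := by
      have : c0 * (t - t') ≤ c0 / 10 * ((1 + c0 / 10) ^ n * dista D y) := by
        rw [mul_sub, hct']; rw [pow_succ] at hct; linarith
      have h3 : c0 * (t - t') ≤ c0 * (dista D (y + t' • e) / 10) := by nlinarith
      exact le_of_mul_le_mul_left h3 hc0
    have hdist : dist (y + t • e) (y + t' • e) = t - t' := by
      rw [dist_add_left, dist_eq_norm, ← sub_smul, norm_smul, hG.ne, mul_one, Real.norm_of_nonneg (by linarith)]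
    have hp' : 0 < dista D (y + t' • e) := lt_of_lt_of_le (by positivity) hdy'
    have hp : 0 < dista D (y + t • e) := lt_of_lt_of_le (by positivity) hup2
    have hlip := dista_lip D (y + t' • e) (y + t • e)
    rw [dist_comm, hdist] at hlip
    constructor
    · exact h1.trans (acc_step hW hp' (hin t' ht'0 (htt'.trans htR)) (by linarith))
    · have := (acc_step (B := ball P R) hW hp (hin t ht htR) (y' := y + t' • e)
        (by rw [dist_comm]; linarith)).trans h2
      rwa [add_comm] at this

theorem Geo.chain (c0 : ℝ) (hc0 : 0 < c0) : ∃ n1 : ℕ, ∀ {N : ℕ} {D : Set (ES N)} {P e : ES N} {R ρ : ℝ},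
    Geo D P e R c0 → R = 160 * ρ / c0 → 0 < ρ → ∀ {W : ES N → ℝ} {a : ℝ}, Pot D a W →
    ∀ {y x : ES N}, y ∈ D → x ∈ D → y ∈ ball P (2 * ρ) → x ∈ ball P (2 * ρ) → ∀ {k k' : ℕ},
    ρ ≤ 2 ^ k * dista D y → ρ ≤ 2 ^ k' * dista D x → Acc D (ball P R) W a ((k + k' + 13) * n1) y x := by
  obtain ⟨n0, hn0⟩ := pow_unbounded_of_one_lt 2 (show 1 < 1 + c0 / 10 by linarith)
  refine ⟨n0 + 1, fun {N D P e R ρ} hG hR hρ {W a} hW {y x} hyD hxD hy hx {k k'} hk hk' => ?_⟩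
  have hn1 : 2 ≤ (1 + c0 / 10) ^ (n0 + 1) := by
    refine hn0.le.trans (pow_le_pow_right₀ (by linarith) (by omega))
  have hc1 := hG.cle
  set T := 40 * ρ / c0 with hT
  have hT0 : 0 ≤ T := by positivity
  have hTR : T ≤ R / 4 := by rw [hT, hR]; apply le_of_eq; ring
  have hcT : c0 * T = 40 * ρ := by rw [hT]; field_simp
  have hsub : ball P (2 * ρ) ⊆ ball P (R / 4) := by
    refine ball_subset_ball ?_
    have : 40 * ρ ≤ T := by rw [← hcT]; nlinarith
    linarith
  have key : ∀ {z : ES N} {j : ℕ}, z ∈ D → ρ ≤ 2 ^ j * dista D z →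
      c0 * T ≤ ((1 + c0 / 10) ^ ((j + 6) * (n0 + 1)) - 1) * dista D z := by
    intro z j hzD hj
    have hz := dista_pos hG.op hG.Pn hzD
    have h1 : (2 : ℝ) ^ (j + 6) ≤ (1 + c0 / 10) ^ ((j + 6) * (n0 + 1)) := by
      rw [mul_comm (j + 6), pow_mul]; exact pow_le_pow_left₀ (by norm_num) hn1 _
    have h2 : (1 : ℝ) ≤ 2 ^ j := one_le_pow₀ (by norm_num)
    rw [pow_add] at h1
    rw [hcT]
    have h3 : (40 * 2 ^ j : ℝ) ≤ (1 + c0 / 10) ^ ((j + 6) * (n0 + 1)) - 1 := by linarith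
    nlinarith [mul_le_mul_of_nonneg_right h3 hz.le]
  have a1 := (hG.vert hW (hsub hy) hyD _ T hT0 hTR (key hyD hk)).1
  have a3 := (hG.vert hW (hsub hx) hxD _ T hT0 hTR (key hxD hk')).2
  have hup := hG.up (hsub hy) hyD hT0 hTR
  have hz := dista_pos hG.op hG.Pn hyD
  rw [hcT] at hup
  have a2 : Acc D (ball P R) W a 1 (y + T • e) (x + T • e) := by
    refine acc_step hW (by linarith) (hG.inner ?_) ?_
    · have := hsub hy
      rw [mem_ball, dist_eq_norm] at *
      have n3 : ‖T • e‖ = T := by rw [norm_smul, hG.ne, mul_one, Real.norm_of_nonneg hT0]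
      have := norm_add_le (y - P) (T • e)
      rw [add_sub_right_comm]
      linarith
    · rw [dist_add_right]
      rw [mem_ball] at hx hy
      have := dist_triangle_right x y P
      linarith
  refine ((a1.trans a2).trans a3).mono hW.a0 ?_
  ring_nf
  omega

/-- boundary decay constant -/
def gam (N : ℕ) (c0 : ℝ) : ℝ := min (vv N (c0 / 4) / 2 / cN N) (1 / 2)

theorem gam_pos (N : ℕ) {c0 : ℝ} (h : 0 < c0) : 0 < gam N c0 :=
  lt_min (div_pos (by linarith [vv_pos N (show (0:ℝ) < c0 / 4 by linarith)]) (cN_pos N)) (by norm_num)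

theorem gam_le (N : ℕ) (c0 : ℝ) : gam N c0 ≤ 1 / 2 := min_le_right _ _

theorem Geo.ext {N : ℕ} {D : Set (ES N)} {P e : ES N} {R c0 : ℝ} (hG : Geo D P e R c0) {z : ES N}
    (hz : z ∉ D) (hzB : z ∈ ball P R) {σ : ℝ} (hσ : 0 ≤ σ) {x : ES N} (hx : x ∈ ball P R)
    (hxz : dist x (z - σ • e) ≤ c0 * σ) : x ∉ D := by
  intro hxD
  refine hz ?_
  have e0 : z = x + σ • e + (z - σ • e - x) := by abel
  have := hG.cone x hxD hx σ hσ (z - σ • e - x) (by rwa [dist_comm, dist_eq_norm] at hxz) (by rwa [← e0])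
  rwa [← e0] at this

theorem BD {N : ℕ} {D : Set (ES N)} {P e : ES N} {R c0 : ℝ} (hG : Geo D P e R c0) {f : ES N → ℝ} (hf : BM f)
    (hs : SubW (ball P R) f (fun _ => 0)) (h0 : ∀ᵐ x, x ∈ ball P R → x ∉ D → f x ≤ 0) {y : ES N} {σ S : ℝ}
    (hσ : 0 < σ) (hd : dista D y ≤ σ) (hy : ball y (5 * σ) ⊆ ball P R) (hS : 0 ≤ S)
    (hfS : ∀ᵐ x, x ∈ ball y (5 * σ) → f x ≤ S) (hLP : LP f y) : f y ≤ (1 - gam N c0) * S := by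
  have hc := cN_pos N
  have hc1 := hG.cle
  have hc0 := hG.cpos
  obtain ⟨z, hz, hzd⟩ := hG.op.isClosed_compl.exists_infDist_eq_dist ⟨P, hG.Pn⟩ y
  have hzd' : dist y z ≤ σ := by rw [← hzd]; exact hd
  have hzB : z ∈ ball P R := hy (by rw [mem_ball, dist_comm]; linarith)
  have hcs : c0 * σ ≤ σ := mul_le_of_le_one_left hσ.le hc1
  have n3 : ‖σ • e‖ = σ := by rw [norm_smul, hG.ne, mul_one, Real.norm_of_nonneg hσ.le]
  have hdz : dist y (z - σ • e) ≤ 2 * σ := by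
    have h1 := dist_triangle y z (z - σ • e)
    have h2 : dist z (z - σ • e) = σ := by rw [dist_eq_norm, sub_sub_cancel, n3]
    linarith
  have h1 := mv_sub isOpen_ball hf (BM.const 0).li (hs.mono hy) le_rfl (by simp) (show 0 < 4 * σ by linarith)
    (closedBall_subset_ball (by linarith)) hLP
  have h2 := Av_low (f := fun x => S - f x) ((BM.const S).sub hf) (z := y) (y := z - σ • e) (ρ := 4 * σ)
    (τ := c0 * σ) (h := S) (by linarith) (by linarith) hS
    (hfS.mono fun x hx hxm => by
      have := hx (closedBall_subset_ball (by linarith) hxm)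
      linarith)
    (h0.mono fun x hx hxm => by
      have hxy : x ∈ ball P R := by
        refine hy ?_
        rw [mem_ball] at *
        have := dist_triangle_right x y (z - σ • e)
        linarith
      have := hx hxy (hG.ext hz hzB hσ.le hxy (mem_ball.1 hxm).le)
      linarith)
  rw [Av_const_sub hf y (by linarith), show c0 * σ / (4 * σ) = c0 / 4 by field_simp] at h2
  have h3 : cN N * f y ≤ cN N * ((1 - vv N (c0 / 4) / 2 / cN N) * S) := by
    rw [show cN N * ((1 - vv N (c0 / 4) / 2 / cN N) * S) = S * cN N - S / 2 * vv N (c0 / 4) by field_simp]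
    linarith
  refine (le_of_mul_le_mul_left h3 hc).trans (mul_le_mul_of_nonneg_right ?_ hS)
  have : gam N c0 ≤ vv N (c0 / 4) / 2 / cN N := min_le_left _ _
  linarith

theorem BDiter {N : ℕ} {D : Set (ES N)} {P e : ES N} {R c0 : ℝ} (hG : Geo D P e R c0) {f : ES N → ℝ} (hf : BM f)
    (hs : SubW (ball P R) f (fun _ => 0)) (h0 : ∀ᵐ x, x ∈ ball P R → x ∉ D → f x ≤ 0) {Q : ES N} {r σ α : ℝ}
    (hσ : 0 < σ) (hQ : ball Q r ⊆ ball P R) (hα : 0 ≤ α)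
    (hfS : ∀ᵐ x, x ∈ ball Q r → f x ≤ α) (hfd : ∀ᵐ x, x ∈ ball Q r → σ < dista D x → f x ≤ 0) (n : ℕ) :
    ∀ᵐ x, x ∈ ball Q (r - 5 * n * σ) → f x ≤ (1 - gam N c0) ^ n * α := by
  have hg := gam_le N c0
  have hg1 : 0 ≤ 1 - gam N c0 := by linarith
  induction n with
  | zero => simpa using hfS
  | succ n ih =>
    filter_upwards [hfd, LP.ae hf] with x hx1 hx2 hxm
    have hxr : x ∈ ball Q r := ball_subset_ball (by
      push_cast
      have : (0:ℝ) ≤ 5 * (n + 1) * σ := by positivity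
      linarith) hxm
    have hp : 0 ≤ (1 - gam N c0) ^ n * α := by positivity
    have hsub : ball x (5 * σ) ⊆ ball Q (r - 5 * n * σ) := by
      refine ball_subset_ball' ?_
      rw [mem_ball] at hxm
      push_cast at hxm
      linarith
    by_cases hd : dista D x ≤ σ
    · have := BD hG hf hs h0 hσ hd (hsub.trans (Subset.trans (ball_subset_ball (by
        have : (0:ℝ) ≤ 5 * n * σ := by positivity
        linarith)) hQ)) hp (ih.mono fun z hz hzm => hz (hsub hzm)) hx2
      rw [pow_succ', mul_assoc]; exact this
    · exact (hx1 hxr (not_le.1 hd)).trans (by positivity)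

theorem BDdec {N : ℕ} {D : Set (ES N)} {P e : ES N} {R c0 : ℝ} (hG : Geo D P e R c0) {f : ES N → ℝ} (hf : BM f)
    (hs : SubW (ball P R) f (fun _ => 0)) (h0 : ∀ᵐ x, x ∈ ball P R → x ∉ D → f x ≤ 0) {z : ES N}
    (hz : z ∈ ball P R) (hzD : z ∉ D) {t : ℝ} (ht : 0 < t) : ∃ r > 0, ∀ᵐ y, y ∈ ball z r → f y ≤ t := by
  obtain ⟨C, hC0, hC⟩ := hf.2
  obtain ⟨r0, hr0, hr0B⟩ := Metric.isOpen_ball.mem_nhds hz |> Metric.mem_nhds_iff.1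
  have hg := gam_le N c0
  have hgp := gam_pos N hG.cpos
  have hg1 : 0 ≤ 1 - gam N c0 := by linarith
  have key : ∀ n : ℕ, ∃ r > 0, r ≤ r0 ∧ ∀ᵐ y, y ∈ ball z r → f y ≤ (1 - gam N c0) ^ n * C := by
    intro n
    induction n with
    | zero => exact ⟨r0, hr0, le_rfl, hC.mono fun y hy _ => by simpa using (le_abs_self _).trans hy⟩
    | succ n ih =>
      obtain ⟨r, hr, hrr, h⟩ := ih
      refine ⟨r / 6, by linarith, by linarith, ?_⟩
      filter_upwards [LP.ae hf] with x hx hxm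
      rw [mem_ball] at hxm
      have hsub : ball x (5 * (r / 6)) ⊆ ball z r := ball_subset_ball' (by linarith)
      rw [pow_succ', mul_assoc]
      exact BD hG hf hs h0 (by linarith) ((dista_le hzD x).trans hxm.le)
        (hsub.trans ((ball_subset_ball hrr).trans hr0B)) (by positivity) (h.mono fun z hz hzm => hz (hsub hzm)) hx
  have hlim : Tendsto (fun n : ℕ => (1 - gam N c0) ^ n * C) atTop (𝓝 (0 * C)) :=
    (tendsto_pow_atTop_nhds_zero_of_lt_one hg1 (by linarith)).mul_const C
  rw [zero_mul] at hlim
  obtain ⟨n, hn⟩ := (hlim.eventually (gt_mem_nhds ht)).exists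
  obtain ⟨r, hr, -, h⟩ := key n
  exact ⟨r, hr, h.mono fun y hy hm => (hy hm).trans hn.le⟩

/-- upper Harnack constant -/
def cU (N : ℕ) (a : ℝ) : ℝ := (4 * 4 ^ N * Real.exp (100 * a / 16))⁻¹

theorem cU_pos (N : ℕ) (a : ℝ) : 0 < cU N a := by unfold cU; positivity

theorem upH {N : ℕ} {D B : Set (ES N)} {W f : ES N → ℝ} {a : ℝ} (hW : Pot D a W) (hf : Spr D B W f)
    (hs : SubW (D ∩ B) f (fun _ => 0)) :
    ∀ᵐ y, 0 < dista D y → ball y (dista D y) ⊆ D ∩ B → Low D f y (cU N a * f y) := by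
  obtain ⟨hfB, hfS, hf0⟩ := hf
  filter_upwards [LP.ae hfB] with y hy hd hB
  filter_upwards [LP.ae hfB] with z hz hzm
  set r := dista D y
  have hO : ball y (9 / 10 * r) ⊆ D ∩ B := (ball_subset_ball (by linarith)).trans hB
  rw [mem_ball] at hzm
  have h1 := harn isOpen_ball hfB (hW.bm.mul hfB).li (hs.mono hO) (hfS.mono hO) (M := 100 * a / r ^ 2)
    (div_nonneg (by linarith [hW.a0]) (sq_nonneg _)) (hf0.mono fun x hx hxm => hx (hO hxm))
    (hf0.mono fun x hx hxm => mul_le_mul_of_nonneg_right (hW.loc hd le_rfl hxm) (hx (hO hxm)))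
    (show 0 < r / 2 by linarith) (y := y) (z := z) (closedBall_subset_ball (by linarith))
    (closedBall_subset_ball' (by linarith)) (by linarith) hy hz
  rw [show 100 * a / r ^ 2 * (r / 2) ^ 2 / 4 = 100 * a / 16 by field_simp; ring] at h1
  rw [cU, inv_mul_le_iff₀ (by positivity)]
  exact h1

theorem ae_loc {N : ℕ} {p : ES N → Prop} {S : Set (ES N)} (h : ∀ x ∈ S, ∃ U ∈ 𝓝 x, ∀ᵐ z, z ∈ U → p z) :
    ∀ᵐ x, x ∈ S → p x := by
  have : volume {x | x ∈ S ∧ ¬ p x} = 0 := by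
    refine measure_null_of_locally_null _ fun x hx => ?_
    obtain ⟨U, hU, hp⟩ := h x hx.1
    refine ⟨{x | x ∈ S ∧ ¬ p x} ∩ U, inter_mem_nhdsWithin _ hU, ?_⟩
    refine measure_mono_null ?_ (ae_iff.1 hp)
    rintro z ⟨hz2, hz⟩ hz3
    exact hz2.2 (hz3 hz)
  refine (ae_iff.2 ?_)
  simpa only [Classical.not_imp] using this

theorem low_ae {N : ℕ} {D S : Set (ES N)} {s : ES N → ℝ} {h : ℝ} (hS : ∀ x ∈ S, 0 < dista D x)
    (hl : ∀ x ∈ S, Low D s x h) : ∀ᵐ x, x ∈ S → h ≤ s x :=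
  ae_loc fun x hx => ⟨ball x (dista D x / 8), ball_mem_nhds _ (by linarith [hS x hx]), hl x hx⟩

/-- nonnegative solutions vanishing off D -/
structure Sol {N : ℕ} (D B : Set (ES N)) (W f : ES N → ℝ) : Prop where
  bm : BM f
  nn : ∀ᵐ x, x ∈ B → 0 ≤ f x
  off : ∀ᵐ x, x ∈ B → x ∉ D → f x = 0
  sub : SubW B f (fun x => W x * f x)
  sup : SubW (D ∩ B) (fun x => - f x) (fun x => - (W x * f x))

theorem Sol.spr {N : ℕ} {D B : Set (ES N)} {W f : ES N → ℝ} (h : Sol D B W f) : Spr D B W f :=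
  ⟨h.bm, h.sup, h.nn.mono fun _ hx hm => hx hm.2⟩

theorem Sol.sub0 {N : ℕ} {D B : Set (ES N)} {W f : ES N → ℝ} (h : Sol D B W f) (hW : BM W) (hW0 : ∀ x, 0 ≤ W x) :
    SubW B f (fun _ => 0) :=
  h.sub.rhs (hW.mul h.bm).li (BM.const 0).li (h.nn.mono fun x hx hm => mul_nonneg (hW0 x) (hx hm))

theorem Sol.mono {N : ℕ} {D B B' : Set (ES N)} {W f : ES N → ℝ} (h : Sol D B W f) (hB : B' ⊆ B) : Sol D B' W f :=
  ⟨h.bm, h.nn.mono fun _ hx hm => hx (hB hm), h.off.mono fun _ hx hm => hx (hB hm), h.sub.mono hB,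
    h.sup.mono (inter_subset_inter_right _ hB)⟩

theorem exists_h {N : ℕ} {D : Set (ES N)} {f : ES N → ℝ} (hf : BM f) {x1 : ES N} (hd : 0 < dista D x1)
    (h0 : ∀ᵐ z, z ∈ ball x1 (dista D x1 / 8) → 0 ≤ f z) :
    ∃ h, 0 ≤ h ∧ Low D f x1 h ∧ ∀ t, 0 ≤ t → Low D f x1 t → t ≤ h := by
  obtain ⟨C, hC0, hC⟩ := hf.2
  set T : Set ℝ := {t | 0 ≤ t ∧ Low D f x1 t} with hT
  have h0T : (0:ℝ) ∈ T := ⟨le_rfl, h0⟩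
  have hb : BddAbove T := by
    refine ⟨C, fun t ht => ?_⟩
    by_contra hlt
    push Not at hlt
    have : ∀ᵐ z, z ∉ ball x1 (dista D x1 / 8) := by
      filter_upwards [ht.2, hC] with z hz1 hz2 hz3
      have := hz1 hz3
      have := (le_abs_self _).trans hz2
      linarith
    have h2 := (measure_ball_pos (volume : Measure (ES N)) x1 (show 0 < dista D x1 / 8 by linarith)).ne'
    exact h2 (by simpa only [not_not, ofPred_mem_eq] using ae_iff.1 this)
  refine ⟨sSup T, le_csSup hb h0T, ?_, fun t ht hl => le_csSup hb ⟨ht, hl⟩⟩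
  have key : ∀ n : ℕ, Low D f x1 (sSup T - 1 / (n + 1)) := fun n => by
    obtain ⟨t, ht, hlt⟩ := exists_lt_of_lt_csSup ⟨0, h0T⟩
      (show sSup T - 1 / ((n:ℝ) + 1) < sSup T by
        have : (0:ℝ) < 1 / ((n:ℝ) + 1) := by positivity
        linarith)
    exact ht.2.mono hlt.le
  filter_upwards [ae_all_iff.2 key] with z hz hzm
  have h1 : Tendsto (fun n : ℕ => sSup T - 1 / ((n : ℝ) + 1)) atTop (𝓝 (sSup T - 0)) :=
    tendsto_const_nhds.sub tendsto_one_div_add_atTop_nhds_zero_nat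
  rw [sub_zero] at h1
  exact le_of_tendsto' h1 fun n => hz n hzm

/-- the chain property -/
def Ch (N : ℕ) (c0 : ℝ) (n1 : ℕ) : Prop := ∀ (D : Set (ES N)) (P e : ES N) (R ρ : ℝ),
    Geo D P e R c0 → R = 160 * ρ / c0 → 0 < ρ → ∀ (W : ES N → ℝ) (a : ℝ), Pot D a W →
    ∀ (y x : ES N), y ∈ D → x ∈ D → y ∈ ball P (2 * ρ) → x ∈ ball P (2 * ρ) → ∀ (k k' : ℕ),
    ρ ≤ 2 ^ k * dista D y → ρ ≤ 2 ^ k' * dista D x → Acc D (ball P R) W a ((k + k' + 13) * n1) y x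

theorem exists_ch (N : ℕ) {c0 : ℝ} (hc0 : 0 < c0) : ∃ n1, Ch N c0 n1 := by
  obtain ⟨n1, h⟩ := Geo.chain c0 hc0
  exact ⟨n1, fun D P e R ρ hG hR hρ W a hW y x hy hx hy2 hx2 k k' hk hk' => h hG hR hρ hW hy hx hy2 hx2 hk hk'⟩

theorem sub_R {c0 ρ R : ℝ} (hc0 : 0 < c0) (hc1 : c0 ≤ 1) (hρ : 0 < ρ) (hR : R = 160 * ρ / c0) : 160 * ρ ≤ R := by
  rw [hR, le_div_iff₀ hc0]
  nlinarith

theorem S1 {N : ℕ} {D : Set (ES N)} {P e : ES N} {R c0 ρ : ℝ} {n1 : ℕ} (hch : Ch N c0 n1) (hG : Geo D P e R c0)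
    (hR : R = 160 * ρ / c0) (hρ : 0 < ρ) {W f : ES N → ℝ} {a : ℝ} (hW : Pot D a W) (hf : Sol D (ball P R) W f)
    {x1 : ES N} {K : ℕ} (hx1 : x1 ∈ D) (hx1P : x1 ∈ ball P (2 * ρ)) (hK : ρ ≤ 2 ^ K * dista D x1) {h : ℝ}
    (hmax : ∀ t, 0 ≤ t → Low D f x1 t → t ≤ h) :
    ∀ᵐ y, y ∈ D → y ∈ ball P (2 * ρ) → ∀ k : ℕ, ρ ≤ 2 ^ k * dista D y →
      cH N a ^ ((k + K + 13) * n1) * (cU N a * f y) ≤ h := by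
  have hR' := sub_R hG.cpos hG.cle hρ hR
  filter_upwards [upH hW hf.spr ((hf.sub0 hW.bm hW.nn).mono inter_subset_right), hf.nn] with y hy hy0 hyD hyP k hk
  have h1 := hy (dista_pos hG.op hG.Pn hyD) (hG.inner (ball_subset_ball (by linarith) hyP))
  have h2 : 0 ≤ cU N a * f y := mul_nonneg (cU_pos N a).le (hy0 (ball_subset_ball (by linarith) hyP))
  exact hmax _ (mul_nonneg (pow_nonneg (cH_pos N a).le _) h2)
    (hch D P e R ρ hG hR hρ W a hW y x1 hyD hx1 hyP hx1P k K hk hK f _ hf.spr h2 h1)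

theorem exists_k {ρ d : ℝ} (hρ : 0 < ρ) (hd : 0 < d) (hdρ : d ≤ 2 * ρ) : ∃ k : ℕ, ρ ≤ 2 ^ k * d ∧ 2 ^ k * d ≤ 2 * ρ := by
  by_cases h : ρ ≤ d
  · exact ⟨0, by simpa using h, by simpa using hdρ⟩
  push Not at h
  obtain ⟨n, h1, h2⟩ := exists_nat_pow_near_of_lt_one (div_pos hd hρ) ((div_le_one hρ).2 h.le)
    (show (0:ℝ) < 1 / 2 by norm_num) (by norm_num)
  refine ⟨n + 1, ?_, ?_⟩
  · rw [lt_div_iff₀ hρ, one_div, inv_pow, inv_mul_lt_iff₀ (by positivity)] at h1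
    exact h1.le
  · rw [div_le_iff₀ hρ, one_div, inv_pow, le_inv_mul_iff₀ (by positivity)] at h2
    rw [pow_succ]; linarith

theorem S1' {N : ℕ} {D : Set (ES N)} {P e : ES N} {R c0 ρ : ℝ} {n1 : ℕ} (hch : Ch N c0 n1) (hG : Geo D P e R c0)
    (hR : R = 160 * ρ / c0) (hρ : 0 < ρ) {W f : ES N → ℝ} {a : ℝ} (hW : Pot D a W) (hf : Sol D (ball P R) W f)
    {x1 : ES N} {K : ℕ} (hx1 : x1 ∈ D) (hx1P : x1 ∈ ball P (2 * ρ)) (hK : ρ ≤ 2 ^ K * dista D x1) {h : ℝ}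
    (hmax : ∀ t, 0 ≤ t → Low D f x1 t → t ≤ h) {A : ℕ} (hA : 1 ≤ 2 ^ A * cH N a ^ n1) :
    ∀ᵐ y, y ∈ D → y ∈ ball P (2 * ρ) →
      cH N a ^ ((K + 13) * n1) * cU N a * (f y * dista D y ^ A) ≤ (2 * ρ) ^ A * h := by
  have hR' := sub_R hG.cpos hG.cle hρ hR
  filter_upwards [S1 hch hG hR hρ hW hf hx1 hx1P hK hmax, hf.nn] with y hy hy0 hyD hyP
  have hd := dista_pos hG.op hG.Pn hyD
  have hf0 := hy0 (ball_subset_ball (by linarith) hyP)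
  have hdle := (dista_le hG.Pn y).trans (mem_ball.1 hyP).le
  obtain ⟨k, hk1, hk2⟩ := exists_k hρ hd hdle
  have h1 := hy hyD hyP k hk1
  have hcH := cH_pos N a
  have hcU := cU_pos N a
  have h2 : (2 ^ k * dista D y) ^ A ≤ (2 * ρ) ^ A := pow_le_pow_left₀ (by positivity) hk2 A
  have h3 : (1:ℝ) ≤ (2 ^ A * cH N a ^ n1) ^ k := one_le_pow₀ hA
  have hh : 0 ≤ h := le_trans (by positivity) h1
  calc cH N a ^ ((K + 13) * n1) * cU N a * (f y * dista D y ^ A)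
      ≤ cH N a ^ ((K + 13) * n1) * cU N a * (f y * dista D y ^ A) * (2 ^ A * cH N a ^ n1) ^ k :=
        le_mul_of_one_le_right (by positivity) h3
    _ = (2 ^ k * dista D y) ^ A * (cH N a ^ ((k + K + 13) * n1) * (cU N a * f y)) := by
        rw [show (k + K + 13) * n1 = (K + 13) * n1 + n1 * k by ring, pow_add, mul_pow, mul_pow, pow_mul _ n1 k,
          ← pow_mul, ← pow_mul, mul_comm A k]
        ring
    _ ≤ (2 * ρ) ^ A * h := mul_le_mul h2 h1 (by positivity) (by positivity)

theorem S2step {N : ℕ} {D : Set (ES N)} {P e : ES N} {R c0 ρ : ℝ} (hG : Geo D P e R c0)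
    (hR : 160 * ρ ≤ R) (hρ : 0 < ρ) {W f : ES N → ℝ} {a : ℝ} (hW : Pot D a W) (hf : Sol D (ball P R) W f)
    {A : ℕ} {H η : ℝ} (hη : 0 < η) (hη2 : 5 * η * A ≤ gam N c0 / 2) (hη3 : 5 * η ≤ 1 / 2)
    (hH : ∀ᵐ y, y ∈ D → y ∈ ball P (2 * ρ) → f y * dista D y ^ A ≤ η ^ A * H) (hH0 : 0 ≤ H) {Q : ℝ}
    (hQ0 : 0 ≤ Q) (hQ : ∀ᵐ y, y ∈ ball P (2 * ρ) → f y * (2 * ρ - dist y P) ^ A ≤ Q) :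
    ∀ᵐ y, y ∈ ball P (2 * ρ) → f y * (2 * ρ - dist y P) ^ A ≤ max H ((1 - gam N c0 / 2) * Q) := by
  have hg := gam_le N c0
  have hgp := gam_pos N hG.cpos
  filter_upwards [hH, LP.ae hf.bm, hf.off, hf.nn] with y hy hyL hyo hyn hyP
  have hyR : y ∈ ball P R := ball_subset_ball (by linarith) hyP
  have hf0 := hyn hyR
  set τ := 2 * ρ - dist y P with hτ
  have hτ0 : 0 < τ := by rw [mem_ball] at hyP; linarith
  by_cases hyD : y ∈ D
  swap
  · rw [hyo hyR hyD, zero_mul]; exact le_max_of_le_left hH0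
  have hd := dista_pos hG.op hG.Pn hyD
  by_cases hdη : η * τ ≤ dista D y
  · refine le_max_of_le_left ?_
    have h1 := hy hyD hyP
    have h2 : (η * τ) ^ A ≤ dista D y ^ A := pow_le_pow_left₀ (by positivity) hdη A
    have h3 := (mul_le_mul_of_nonneg_left h2 hf0).trans h1
    rw [mul_pow, mul_left_comm] at h3
    exact le_of_mul_le_mul_left h3 (by positivity)
  · refine le_max_of_le_right ?_
    push Not at hdη
    have hsub : ball y (5 * (η * τ)) ⊆ ball P (2 * ρ) := ball_subset_ball' (by nlinarith)
    have hB := one_add_mul_le_pow (show (-2:ℝ) ≤ -(5 * η) by linarith) A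
    have hq : 1 - gam N c0 / 2 ≤ (1 - 5 * η) ^ A := by
      rw [← sub_eq_add_neg] at hB
      refine le_trans ?_ hB
      nlinarith
    have hqp : 0 < (1 - 5 * η) ^ A := by linarith
    have h1 := BD hG hf.bm (hf.sub0 hW.bm hW.nn) (hf.off.mono fun x hx h1 h2 => (hx h1 h2).le)
      (σ := η * τ) (S := Q / (((1 - 5 * η) ^ A) * τ ^ A)) (by positivity) hdη.le
      (hsub.trans (ball_subset_ball (by linarith))) (by positivity)
      (by
        filter_upwards [hQ, hf.nn] with x hx hxn hxm
        have hxP := hsub hxm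
        have h2 := hx hxP
        have h3 := hxn (ball_subset_ball (by linarith) hxP)
        rw [le_div_iff₀ (by positivity), ← mul_pow]
        refine le_trans (mul_le_mul_of_nonneg_left ?_ h3) h2
        refine pow_le_pow_left₀ (mul_nonneg (by linarith) hτ0.le) ?_ A
        rw [mem_ball] at hxm
        have := dist_triangle x y P
        nlinarith) hyL
    have h4 := mul_le_mul_of_nonneg_right h1 (show 0 ≤ τ ^ A by positivity)
    refine h4.trans ?_
    rw [show (1 - gam N c0) * (Q / ((1 - 5 * η) ^ A * τ ^ A)) * τ ^ A = ((1 - gam N c0) * Q) / (1 - 5 * η) ^ A by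
      field_simp, div_le_iff₀ hqp]
    have h5 : (1 - gam N c0) ≤ (1 - gam N c0 / 2) * (1 - 5 * η) ^ A := by nlinarith
    nlinarith

theorem S2 {N : ℕ} {D : Set (ES N)} {P e : ES N} {R c0 ρ : ℝ} (hG : Geo D P e R c0)
    (hR : 160 * ρ ≤ R) (hρ : 0 < ρ) {W f : ES N → ℝ} {a : ℝ} (hW : Pot D a W) (hf : Sol D (ball P R) W f)
    {A : ℕ} {H η : ℝ} (hη : 0 < η) (hη2 : 5 * η * A ≤ gam N c0 / 2) (hη3 : 5 * η ≤ 1 / 2)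
    (hH : ∀ᵐ y, y ∈ D → y ∈ ball P (2 * ρ) → f y * dista D y ^ A ≤ η ^ A * H) (hH0 : 0 ≤ H) :
    ∀ᵐ y, y ∈ ball P (2 * ρ) → f y * (2 * ρ - dist y P) ^ A ≤ H := by
  have hg := gam_le N c0
  have hgp := gam_pos N hG.cpos
  obtain ⟨C, hC0, hC⟩ := hf.bm.2
  set q := 1 - gam N c0 / 2 with hq
  have hq0 : 0 < q := by linarith
  have hq1 : q < 1 := by linarith
  have key : ∀ n : ℕ, ∀ᵐ y, y ∈ ball P (2 * ρ) →
      f y * (2 * ρ - dist y P) ^ A ≤ max H (q ^ n * (C * (2 * ρ) ^ A)) := by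
    intro n
    induction n with
    | zero =>
      filter_upwards [hC] with y hy hyP
      rw [mem_ball] at hyP
      refine le_max_of_le_right ?_
      rw [pow_zero, one_mul]
      have := dist_nonneg (x := y) (y := P)
      exact mul_le_mul ((le_abs_self _).trans hy) (pow_le_pow_left₀ (by linarith) (by linarith) A)
        (pow_nonneg (by linarith) A) hC0
    | succ n ih =>
      filter_upwards [S2step hG hR hρ hW hf hη hη2 hη3 hH hH0 (le_max_of_le_left hH0) ih] with y hy hyP
      refine (hy hyP).trans ?_
      rw [← hq, mul_max_of_nonneg _ _ hq0.le]
      refine max_le (le_max_left _ _) (max_le (le_max_of_le_left ?_) (le_max_of_le_right ?_))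
      · nlinarith
      · rw [pow_succ', mul_assoc]
  have hlim : Tendsto (fun n : ℕ => max H (q ^ n * (C * (2 * ρ) ^ A))) atTop (𝓝 (max H (0 * (C * (2 * ρ) ^ A)))) :=
    tendsto_const_nhds.max ((tendsto_pow_atTop_nhds_zero_of_lt_one hq0.le hq1).mul_const _)
  rw [zero_mul, max_eq_left hH0] at hlim
  filter_upwards [ae_all_iff.2 key] with y hy hyP
  exact ge_of_tendsto' hlim fun n => hy n hyP

theorem Geo.sub {N : ℕ} {D : Set (ES N)} {P e Q : ES N} {R r c0 : ℝ} (h : Geo D P e R c0) (hQ : Q ∉ D)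
    (hB : ball Q r ⊆ ball P R) : Geo D Q e r c0 :=
  ⟨h.op, h.ne, h.cpos, h.cle, hQ, fun x hx hb t ht v hv hb' => h.cone x hx (hB hb) t ht v hv (hB hb')⟩

theorem S3step {N : ℕ} {D : Set (ES N)} {P e : ES N} {R c0 : ℝ} (hG : Geo D P e R c0)
    {W w : ES N → ℝ} {a : ℝ} (hW : Pot D a W) (hw : BM w)
    (hsup : SubW (D ∩ ball P R) (fun x => - w x) (fun x => - (W x * w x)))
    (hφ : SubW (ball P R) (fun x => max (- w x) 0) (fun _ => 0))
    (hoff : ∀ᵐ x, x ∈ ball P R → x ∉ D → 0 ≤ w x)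
    {n2 m : ℕ} {c M θ r α : ℝ} (hn2 : 5 ≤ (1 + c0 / 10) ^ n2) (hc : c = cH N a ^ n2) (hM : M = 2 / c)
    (hm : (1 - gam N c0) ^ m ≤ c / 2) (hθ : 0 < θ) (hθ1 : θ ≤ c0 / 4) (hθm : 5 * m * θ ≤ 1 / 2)
    (hr : 0 < r) (hα : 0 ≤ α) {Q : ES N} (hQ : Q ∉ D) (hQB : ball Q r ⊆ ball P R)
    (h1 : ∀ᵐ x, x ∈ ball Q r → θ * r ≤ dista D x → M * α ≤ w x)
    (h2 : ∀ᵐ x, x ∈ ball Q r → - α ≤ w x) :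
    (∀ᵐ x, x ∈ ball Q (r / 4) → θ * (r / 4) ≤ dista D x → M * ((1 - gam N c0) ^ m * α) ≤ w x) ∧
    (∀ᵐ x, x ∈ ball Q (r / 4) → - ((1 - gam N c0) ^ m * α) ≤ w x) := by
  have hc0 := hG.cpos
  have hcp : 0 < c := by rw [hc]; exact pow_pos (cH_pos N a) _
  have hMp : 0 < M := by rw [hM]; positivity
  have hcM : c * M = 2 := by rw [hM]; field_simp
  refine ⟨?_, ?_⟩
  · have hGQ := hG.sub hQ hQB
    have hspr : Spr D (ball Q r) W (fun x => w x + α) := by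
      refine ⟨hw.add (BM.const α), ?_, h2.mono fun x hx hm => by linarith [hx hm.2]⟩
      have e1 := (hsup.mono (inter_subset_inter_right D hQB)).add (subW_const (-α)) hw.neg.li
        (hW.bm.mul hw).neg.li (BM.const (-α)).li (BM.const 0).li
      have e2 := e1.rhs (G := fun x => - (W x * (w x + α))) ((hW.bm.mul hw).neg.add (BM.const 0)).li
        (hW.bm.mul (hw.add (BM.const α))).neg.li (ae_of_all _ fun x _ => by
          have := mul_nonneg (hW.nn x) hα
          linarith)
      refine e2.congr (ae_of_all _ fun x _ => ?_) (ae_of_all _ fun x _ => rfl)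
      simp only
      ring
    have hlow : ∀ᵐ x, x ∈ {x | x ∈ ball Q (r / 4) ∧ θ * (r / 4) ≤ dista D x} → c * ((M + 1) * α) ≤ w x + α := by
      refine low_ae (D := D) (fun x hx => lt_of_lt_of_le (by positivity) hx.2) ?_
      rintro y ⟨hy, hyd⟩
      have hd : 0 < dista D y := lt_of_lt_of_le (by positivity) hyd
      have hyD := dista_mem hd
      set t := θ * r / c0 with ht
      have hct : c0 * t = θ * r := by rw [ht]; field_simp
      have ht0 : 0 ≤ t := by positivity
      have htr : t ≤ r / 4 := by
        rw [ht, div_le_iff₀ hc0]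
        nlinarith
      have hacc := (hGQ.vert hW hy hyD n2 t ht0 htr (by
        rw [hct]
        have : 4 * dista D y ≤ ((1 + c0 / 10) ^ n2 - 1) * dista D y :=
          mul_le_mul_of_nonneg_right (by linarith) hd.le
        linarith)).2
      have hup := hGQ.up hy hyD ht0 htr
      rw [hct] at hup
      rw [hc]
      refine hacc _ _ hspr (by positivity) ?_
      filter_upwards [h1] with z hz hzm
      rw [mem_ball] at hzm hy
      have hl := dista_lip D (y + t • e) z
      rw [dist_comm] at hl
      have hdQ := dista_le hQ (y + t • e)
      have n3 : dist (y + t • e) y = t := by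
        rw [dist_eq_norm, add_sub_cancel_left, norm_smul, hG.ne, mul_one, Real.norm_of_nonneg ht0]
      have hyQ := dist_triangle (y + t • e) y Q
      have hzQ := dist_triangle z (y + t • e) Q
      have := hz (by rw [mem_ball]; linarith) (by nlinarith)
      linarith
    filter_upwards [hlow] with x hx hx1 hx2
    have := hx ⟨hx1, hx2⟩
    have h3 : M * ((1 - gam N c0) ^ m * α) ≤ M * (c / 2 * α) := by gcongr
    have h4 : M * (c / 2 * α) = α := by rw [show M * (c / 2 * α) = c * M / 2 * α by ring, hcM]; ring
    have h5 : c * ((M + 1) * α) = 2 * α + c * α := by rw [← hcM]; ring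
    have : 0 ≤ c * α := by positivity
    linarith
  · have := BDiter hG hw.neg.pos hφ (hoff.mono fun x hx hxB hxD => by simpa using hx hxB hxD) (σ := θ * r)
      (by positivity) hQB hα (h2.mono fun x hx hxm => max_le (by linarith [hx hxm]) hα)
      (h1.mono fun x hx hxm hxd => by
        have := hx hxm hxd.le
        have h3 : 0 ≤ M * α := by positivity
        simp only [max_le_iff]
        exact ⟨by linarith, le_rfl⟩) m
    filter_upwards [this] with x hx hxm
    have h3 := hx (ball_subset_ball (by nlinarith) hxm)
    have := (le_max_left _ _).trans h3
    linarith

theorem S3 {N : ℕ} {D : Set (ES N)} {P e : ES N} {R c0 ρ : ℝ} (hG : Geo D P e R c0)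
    (hR : 160 * ρ ≤ R) (hρ : 0 < ρ)
    {W w : ES N → ℝ} {a : ℝ} (hW : Pot D a W) (hw : BM w)
    (hsup : SubW (D ∩ ball P R) (fun x => - w x) (fun x => - (W x * w x)))
    (hφ : SubW (ball P R) (fun x => max (- w x) 0) (fun _ => 0))
    (hoff : ∀ᵐ x, x ∈ ball P R → x ∉ D → 0 ≤ w x)
    {n2 m : ℕ} {c M θ α : ℝ} (hn2 : 5 ≤ (1 + c0 / 10) ^ n2) (hc : c = cH N a ^ n2) (hM : M = 2 / c)
    (hm : (1 - gam N c0) ^ m ≤ c / 2) (hθ : 0 < θ) (hθ1 : θ ≤ c0 / 4) (hθm : 5 * m * θ ≤ 1 / 2) (hθ2 : θ ≤ 1 / 8)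
    (hα : 0 ≤ α)
    (h1 : ∀ᵐ x, x ∈ ball P (3 / 2 * ρ) → θ * (ρ / 4) ≤ dista D x → M * α ≤ w x)
    (h2 : ∀ᵐ x, x ∈ ball P (3 / 2 * ρ) → - α ≤ w x) : ∀ᵐ x, x ∈ ball P ρ → 0 ≤ w x := by
  have hg1 : 0 ≤ 1 - gam N c0 := by linarith [gam_le N c0]
  have hcp : 0 < c := by rw [hc]; exact pow_pos (cH_pos N a) _
  have hMp : 0 < M := by rw [hM]; positivity
  have hmain : ∀ᵐ x, x ∈ D ∩ ball P ρ → 0 ≤ w x := by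
    refine ae_loc fun y hy => ?_
    obtain ⟨hyD, hyP⟩ := hy
    have hd := dista_pos hG.op hG.Pn hyD
    rw [mem_ball] at hyP
    have hcont : Continuous (dista D) := continuous_infDist_pt _
    by_cases hbig : ρ / 16 ≤ dista D y
    · refine ⟨ball P (3 / 2 * ρ) ∩ {x | θ * (ρ / 4) < dista D x},
        inter_mem (isOpen_ball.mem_nhds (by rw [mem_ball]; linarith))
          ((isOpen_lt continuous_const hcont).mem_nhds ?_), ?_⟩
      · show θ * (ρ / 4) < dista D y
        nlinarith
      · filter_upwards [h1] with x hx hxm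
        have hx2 : θ * (ρ / 4) < dista D x := hxm.2
        exact le_trans (by positivity) (hx hxm.1 hx2.le)
    push Not at hbig
    obtain ⟨Q, hQ, hQd⟩ := hG.op.isClosed_compl.exists_infDist_eq_dist ⟨P, hG.Pn⟩ y
    have hQd : dista D y = dist y Q := hQd
    have hQP := dist_triangle_left Q P y
    have hsub : ball Q (ρ / 4) ⊆ ball P (3 / 2 * ρ) := ball_subset_ball' (by linarith)
    have hsubR : ball P (3 / 2 * ρ) ⊆ ball P R := ball_subset_ball (by linarith)
    have key : ∀ k : ℕ, ∃ β, 0 ≤ β ∧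
        (∀ᵐ x, x ∈ ball Q ((1 / 4) ^ k * (ρ / 4)) → θ * ((1 / 4) ^ k * (ρ / 4)) ≤ dista D x → M * β ≤ w x) ∧
        (∀ᵐ x, x ∈ ball Q ((1 / 4) ^ k * (ρ / 4)) → - β ≤ w x) := by
      intro k
      induction k with
      | zero =>
        refine ⟨α, hα, ?_, ?_⟩
        · simpa using h1.mono fun x hx hxm => hx (hsub hxm)
        · simpa using h2.mono fun x hx hxm => hx (hsub hxm)
      | succ k ih =>
        obtain ⟨β, hβ, i1, i2⟩ := ih
        have hk1 : (1 / 4 : ℝ) ^ k ≤ 1 := pow_le_one₀ (by norm_num) (by norm_num)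
        have hk0 : (0:ℝ) < (1 / 4 : ℝ) ^ k := by positivity
        have := S3step hG hW hw hsup hφ hoff hn2 hc hM hm hθ hθ1 hθm (by positivity) hβ hQ
          ((ball_subset_ball (show (1 / 4) ^ k * (ρ / 4) ≤ ρ / 4 by nlinarith)).trans (hsub.trans hsubR)) i1 i2
        rw [show (1 / 4 : ℝ) ^ (k + 1) * (ρ / 4) = (1 / 4) ^ k * (ρ / 4) / 4 by rw [pow_succ]; ring]
        exact ⟨_, by positivity, this.1, this.2⟩
    obtain ⟨k, k1, k2⟩ := exists_nat_pow_near_of_lt_one (x := dista D y / (ρ / 8)) (by positivity)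
      ((div_le_one (by positivity)).2 (by linarith)) (show (0:ℝ) < 1 / 4 by norm_num) (by norm_num)
    rw [lt_div_iff₀ (by positivity)] at k1
    rw [div_le_iff₀ (by positivity)] at k2
    have hk0 : (0:ℝ) < (1 / 4 : ℝ) ^ (k + 1) * ρ := by positivity
    obtain ⟨β, hβ, i1, -⟩ := key k
    rw [pow_succ] at k1 hk0
    have hk0' : (0:ℝ) < (1 / 4 : ℝ) ^ k * ρ := by positivity
    refine ⟨ball Q ((1 / 4) ^ k * (ρ / 4)) ∩ {x | θ * ((1 / 4) ^ k * (ρ / 4)) < dista D x},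
      inter_mem (isOpen_ball.mem_nhds (by rw [mem_ball, ← hQd]; linarith))
        ((isOpen_lt continuous_const hcont).mem_nhds ?_), ?_⟩
    · show θ * ((1 / 4) ^ k * (ρ / 4)) < dista D y
      nlinarith
    · filter_upwards [i1] with x hx hxm
      have hx2 : θ * ((1 / 4) ^ k * (ρ / 4)) < dista D x := hxm.2
      exact le_trans (by positivity) (hx hxm.1 hx2.le)
  filter_upwards [hmain, hoff] with x hx1 hx2 hxm
  by_cases hxD : x ∈ D
  · exact hx1 ⟨hxD, hxm⟩
  · exact hx2 (ball_subset_ball (by linarith) hxm) hxD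

theorem BHP (N : ℕ) {c0 a : ℝ} (hc0 : 0 < c0) (hc01 : c0 ≤ 1) (K : ℕ) :
    ∃ c : ℝ, 0 < c ∧ c ≤ 1 / 2 ∧ ∀ (D : Set (ES N)) (P e : ES N) (R ρ : ℝ) (W f s : ES N → ℝ) (x1 : ES N),
      Geo D P e R c0 → R = 160 * ρ / c0 → 0 < ρ → Pot D a W → Sol D (ball P R) W f →
      BM s → SubW (D ∩ ball P R) (fun x => - s x) (fun x => - (W x * s x)) → (∀ᵐ x, x ∈ ball P R → 0 ≤ s x) →
      x1 ∈ D → x1 ∈ ball P (2 * ρ) → ρ ≤ 2 ^ K * dista D x1 →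
      (∀ᵐ z, z ∈ ball x1 (dista D x1 / 8) → f z ≤ s z) →
      ∀ᵐ x, x ∈ ball P ρ → c * f x ≤ s x := by
  obtain ⟨n1, hch⟩ := exists_ch N hc0
  have hcH := cH_pos N a
  have hcU := cU_pos N a
  have hgp := gam_pos N hc0
  have hgl := gam_le N c0
  obtain ⟨A, hA⟩ : ∃ A : ℕ, 1 ≤ 2 ^ A * cH N a ^ n1 := by
    obtain ⟨A, hA⟩ := pow_unbounded_of_one_lt (1 / cH N a ^ n1) (show (1:ℝ) < 2 by norm_num)
    exact ⟨A, by rw [div_lt_iff₀ (by positivity)] at hA; exact hA.le⟩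
  obtain ⟨η, hη, hη2, hη3⟩ : ∃ η : ℝ, 0 < η ∧ 5 * η * A ≤ gam N c0 / 2 ∧ 5 * η ≤ 1 / 2 := by
    refine ⟨gam N c0 / (10 * (A + 1)), by positivity, ?_, ?_⟩
    · rw [show 5 * (gam N c0 / (10 * ((A:ℝ) + 1))) * A = (gam N c0 / 2) * (A / (A + 1)) by field_simp; ring]
      exact mul_le_of_le_one_right (by positivity) ((div_le_one (by positivity)).2 (by linarith))
    · have : gam N c0 / (10 * (A + 1)) ≤ gam N c0 / 10 := by
        apply div_le_div_of_nonneg_left hgp.le (by norm_num)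
        have : (0:ℝ) ≤ A := Nat.cast_nonneg A
        linarith
      linarith
  obtain ⟨n2, hn2⟩ := pow_unbounded_of_one_lt 5 (show 1 < 1 + c0 / 10 by linarith)
  set cc := cH N a ^ n2 with hcc
  have hccp : 0 < cc := by positivity
  set M := 2 / cc with hM
  have hMp : 0 < M := by positivity
  obtain ⟨m, hm⟩ := exists_pow_lt_of_lt_one (show 0 < cc / 2 by positivity) (show 1 - gam N c0 < 1 by linarith)
  obtain ⟨θ, hθ, hθ1, hθm, hθ2⟩ : ∃ θ : ℝ, 0 < θ ∧ θ ≤ c0 / 4 ∧ 5 * m * θ ≤ 1 / 2 ∧ θ ≤ 1 / 8 := by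
    have hm0 : (0:ℝ) ≤ m := Nat.cast_nonneg m
    refine ⟨min (min (c0 / 4) (1 / 8)) (1 / (10 * (m + 1))), by positivity,
      (min_le_left _ _).trans (min_le_left _ _), ?_, (min_le_left _ _).trans (min_le_right _ _)⟩
    have h1 : 5 * m * min (min (c0 / 4) (1 / 8)) (1 / (10 * ((m:ℝ) + 1))) ≤ 5 * m * (1 / (10 * (m + 1))) :=
      mul_le_mul_of_nonneg_left (min_le_right _ _) (by positivity)
    refine h1.trans ?_
    rw [mul_one_div, div_le_iff₀ (by positivity)]
    linarith
  obtain ⟨k0, hk0⟩ : ∃ k0 : ℕ, 1 ≤ 2 ^ k0 * (θ / 4) := by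
    obtain ⟨A, hA⟩ := pow_unbounded_of_one_lt (1 / (θ / 4)) (show (1:ℝ) < 2 by norm_num)
    exact ⟨A, by rw [div_lt_iff₀ (by positivity)] at hA; exact hA.le⟩
  set c2 := cH N a ^ ((K + 13) * n1) * cU N a with hc2
  have hc2p : 0 < c2 := by positivity
  set C1 := (4 / η) ^ A / c2 with hC1
  have hC1p : 0 < C1 := by positivity
  set c3 := cH N a ^ ((K + k0 + 13) * n1) with hc3
  have hc3p : 0 < c3 := by positivity
  set B' := (M + 1) * C1 / c3 with hB'
  have hB'p : 0 < B' := by positivity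
  refine ⟨min (1 / B') (1 / 2), by positivity, min_le_right _ _, ?_⟩
  intro D P e R ρ W f s x1 hG hR hρ hW hf hsB hsS hs0 hx1 hx1P hK hfs
  have hR' := sub_R hc0 hc01 hρ hR
  have hd1 := dista_pos hG.op hG.Pn hx1
  have hin1 : ball x1 (dista D x1) ⊆ D ∩ ball P R := hG.inner (ball_subset_ball (by linarith) hx1P)
  obtain ⟨h, hh0, hlow, hmax⟩ := exists_h hf.bm hd1
    (hf.nn.mono fun z hz hzm => hz (hin1 (ball_subset_ball (by linarith) hzm)).2)
  have hlows : Low D s x1 h := by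
    filter_upwards [hlow, hfs] with z h1 h2 hm
    exact (h1 hm).trans (h2 hm)
  have hspr : Spr D (ball P R) W s := ⟨hsB, hsS, hs0.mono fun x hx hm => hx hm.2⟩
  -- upper bound
  have hfu : ∀ᵐ y, y ∈ ball P (3 / 2 * ρ) → f y ≤ C1 * h := by
    have h1 := S1' hch hG hR hρ hW hf hx1 hx1P hK hmax hA
    have h2 := S2 hG hR' hρ hW hf hη hη2 hη3 (H := (2 * ρ / η) ^ A * h / c2) (by
      filter_upwards [h1] with y hy hyD hyP
      have := hy hyD hyP
      rw [show η ^ A * ((2 * ρ / η) ^ A * h / c2) = ((2 * ρ) ^ A * h) / c2 by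
        rw [div_pow]; field_simp, le_div_iff₀ hc2p]
      linarith) (by positivity)
    filter_upwards [h2, hf.nn] with y hy hyn hyP
    have hy0 := hyn (ball_subset_ball (by linarith) hyP)
    have h3 := hy (ball_subset_ball (by linarith) hyP)
    rw [mem_ball] at hyP
    have h4 : f y * (ρ / 2) ^ A ≤ f y * (2 * ρ - dist y P) ^ A :=
      mul_le_mul_of_nonneg_left (pow_le_pow_left₀ (by positivity) (by linarith) A) hy0
    have h5 : (2 * ρ / η) ^ A * h / c2 = C1 * h * (ρ / 2) ^ A := by
      rw [hC1, show 2 * ρ / η = (4 / η) * (ρ / 2) by ring, mul_pow]; ring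
    rw [h5] at h3
    exact le_of_mul_le_mul_right (h4.trans h3) (by positivity)
  -- lower bound
  have hsl : ∀ᵐ y, y ∈ ball P (3 / 2 * ρ) → θ * (ρ / 4) ≤ dista D y → c3 * h ≤ s y := by
    have : ∀ᵐ y, y ∈ {y | y ∈ ball P (3 / 2 * ρ) ∧ θ * (ρ / 4) ≤ dista D y} → c3 * h ≤ s y := by
      refine low_ae (D := D) (fun x hx => lt_of_lt_of_le (by positivity) hx.2) ?_
      rintro y ⟨hy, hyd⟩
      have hd : 0 < dista D y := lt_of_lt_of_le (by positivity) hyd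
      exact hch D P e R ρ hG hR hρ W a hW x1 y hx1 (dista_mem hd) hx1P (ball_subset_ball (by linarith) hy) K k0 hK
        (by
          have : ρ ≤ 2 ^ k0 * (θ / 4) * ρ := le_mul_of_one_le_left hρ.le hk0
          have h2 : (2:ℝ) ^ k0 * (θ * (ρ / 4)) ≤ 2 ^ k0 * dista D y := by gcongr
          linarith) s h hspr hh0 hlows
    exact this.mono fun y hy h1 h2 => hy ⟨h1, h2⟩
  have hw : BM (fun x => B' * s x - f x) := (hsB.cmul B').sub hf.bm
  have hfw : SubW (D ∩ ball P R) (fun x => f x - B' * s x) (fun x => W x * (f x - B' * s x)) := by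
    have h1 := (hf.sub.mono inter_subset_right).add (hsS.cmul hB'p.le) hf.bm.li (hW.bm.mul hf.bm).li
      (hsB.neg.cmul B').li ((hW.bm.mul hsB).neg.cmul B').li
    refine h1.congr (ae_of_all _ fun x _ => ?_) (ae_of_all _ fun x _ => ?_) <;> ring
  have hsup : SubW (D ∩ ball P R) (fun x => - (B' * s x - f x)) (fun x => - (W x * (B' * s x - f x))) := by
    refine hfw.congr (ae_of_all _ fun x _ => ?_) (ae_of_all _ fun x _ => ?_) <;> ring
  have hφ : SubW (ball P R) (fun x => max (- (B' * s x - f x)) 0) (fun _ => 0) := by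
    have h1 := extend isOpen_ball hG.op (hf.bm.sub (hsB.cmul B')) hW.bm hW.nn hfw (by
      intro z hzB hzD t ht
      obtain ⟨r, hr, hrt⟩ := BDdec hG hf.bm (hf.sub0 hW.bm hW.nn) (hf.off.mono fun x hx h1 h2 => (hx h1 h2).le) hzB hzD ht
      obtain ⟨r0, hr0, hr0B⟩ := Metric.mem_nhds_iff.1 (isOpen_ball.mem_nhds hzB)
      refine ⟨min r r0, lt_min hr hr0, ?_⟩
      filter_upwards [hrt, hs0] with y hy1 hy2 hym
      have h1 := hy1 (ball_subset_ball (min_le_left _ _) hym)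
      have h2 := hy2 (hr0B (ball_subset_ball (min_le_right _ _) hym))
      have : 0 ≤ B' * s y := by positivity
      linarith)
    have h2 := h1.rhs (G := fun _ => 0) (hW.bm.mul (hf.bm.sub (hsB.cmul B')).pos).li (BM.const 0).li
      (ae_of_all _ fun x _ => mul_nonneg (hW.nn x) (le_max_right _ _))
    refine h2.congr (ae_of_all _ fun x _ => ?_) (ae_of_all _ fun x _ => rfl)
    rw [neg_sub]
  have hoff : ∀ᵐ x, x ∈ ball P R → x ∉ D → 0 ≤ B' * s x - f x := by
    filter_upwards [hf.off, hs0] with x h1 h2 hxB hxD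
    rw [h1 hxB hxD, sub_zero]
    exact mul_nonneg hB'p.le (h2 hxB)
  have hfin := S3 hG hR' hρ hW hw hsup hφ hoff hn2.le hcc hM hm.le hθ hθ1 hθm hθ2 (α := C1 * h) (by positivity)
    (by
      filter_upwards [hfu, hsl] with x h1 h2 hx hxd
      have h3 := h1 hx
      have h4 := mul_le_mul_of_nonneg_left (h2 hx hxd) hB'p.le
      have h5 : B' * (c3 * h) = M * (C1 * h) + C1 * h := by rw [hB']; field_simp
      linarith)
    (by
      filter_upwards [hfu, hs0] with x h1 h2 hx
      have h3 := h1 hx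
      have := mul_nonneg hB'p.le (h2 (ball_subset_ball (by linarith) hx))
      linarith)
  filter_upwards [hfin, hf.nn] with x hx hxn hxm
  have h1 := hx hxm
  have h2 := hxn (ball_subset_ball (by linarith) hxm)
  have h3 : min (1 / B') (1 / 2) * f x ≤ 1 / B' * f x := mul_le_mul_of_nonneg_right (min_le_left _ _) h2
  refine h3.trans ?_
  rw [one_div, inv_mul_le_iff₀ hB'p]
  linarith

/-- inner domains -/
def Dr {N : ℕ} (Ω : Set (ES N)) (r : ℝ) : Set (ES N) := {x | r < dista Ω x}

/-- truncated potentials -/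
def Wr {N : ℕ} (Ω : Set (ES N)) (V : ES N → ℝ) (r : ℝ) : ES N → ℝ := (Dr Ω r).indicator V

theorem dista_cont {N : ℕ} (Ω : Set (ES N)) : Continuous (dista Ω) := continuous_infDist_pt _

theorem Dr_open {N : ℕ} (Ω : Set (ES N)) (r : ℝ) : IsOpen (Dr Ω r) := isOpen_lt continuous_const (dista_cont Ω)

theorem Dr_sub {N : ℕ} {Ω : Set (ES N)} {r : ℝ} (hr : 0 ≤ r) : Dr Ω r ⊆ Ω := fun _ hx => dista_mem (lt_of_le_of_lt hr hx)

theorem cone_of_lip {N : ℕ} {Ω : Set (ES N)} (hΩ : IsLipschitzDomain Ω) {P : ES N} (hP : P ∈ frontier Ω) :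
    ∃ (e : ES N) (c0 R0 : ℝ), ‖e‖ = 1 ∧ 0 < c0 ∧ c0 ≤ 1 ∧ 0 < R0 ∧ ∀ x ∈ Ω, x ∈ ball P R0 → ∀ t, 0 ≤ t →
      ∀ v : ES N, ‖v‖ ≤ c0 * t → x + t • e + v ∈ ball P R0 → x + t • e + v ∈ Ω := by
  obtain ⟨g, i, f, L, R0, hR0, hf, hfi, hiff⟩ := hΩ.2.2 P hP
  have hL : (0:ℝ) ≤ L := L.2
  refine ⟨g.symm (EuclideanSpace.single i 1), 1 / (2 * (1 + L)), R0, ?_, by positivity, ?_, hR0, ?_⟩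
  · rw [LinearIsometryEquiv.norm_map]; simp
  · rw [div_le_one (by positivity)]; linarith
  intro x hx hxB t ht v hv hB
  rw [hiff _ hB]
  rcases ht.eq_or_lt with rfl | ht
  · have : v = 0 := by simpa using hv
    simpa [this] using (hiff _ hxB).1 hx
  have h1 := (hiff _ hxB).1 hx
  have e1 : g (x + t • g.symm (EuclideanSpace.single i 1) + v) = g x + t • EuclideanSpace.single i 1 + g v := by
    simp
  have e2 : f (g (x + t • g.symm (EuclideanSpace.single i 1) + v)) = f (g x + g v) := by
    rw [e1]
    refine hfi _ _ fun j hj => ?_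
    simp [hj]
  have h2 : f (g x + g v) ≤ f (g x) + L * ‖v‖ := by
    have := hf.dist_le_mul (g x + g v) (g x)
    rw [Real.dist_eq, dist_eq_norm, add_sub_cancel_left, LinearIsometryEquiv.norm_map] at this
    linarith [le_abs_self (f (g x + g v) - f (g x))]
  have h3 : |(g v) i| ≤ ‖v‖ := by
    have := EuclideanSpace.norm_eq (g v)
    rw [← LinearIsometryEquiv.norm_map g v]
    exact PiLp.norm_apply_le (g v) i
  rw [e2, e1]
  simp only [PiLp.add_apply, PiLp.smul_apply, smul_eq_mul]
  rw [show (EuclideanSpace.single i (1:ℝ) : ES N) i = 1 by simp]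
  have h4 := neg_abs_le ((g v) i)
  have h5 : (1 + L) * ‖v‖ ≤ t / 2 := by
    have := mul_le_mul_of_nonneg_left hv (show 0 ≤ 1 + (L:ℝ) by positivity)
    refine this.trans (le_of_eq ?_)
    field_simp
  nlinarith

theorem Geo_Dr {N : ℕ} {Ω : Set (ES N)} {P e : ES N} {c0 R0 R r : ℝ} (hPΩ : P ∉ Ω) (he : ‖e‖ = 1) (hc0 : 0 < c0)
    (hc1 : c0 ≤ 1)
    (hcone : ∀ x ∈ Ω, x ∈ ball P R0 → ∀ t, 0 ≤ t →
      ∀ v : ES N, ‖v‖ ≤ c0 * t → x + t • e + v ∈ ball P R0 → x + t • e + v ∈ Ω) (hr : 0 ≤ r) (hR : R + r < R0) :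
    Geo (Dr Ω r) P e R c0 := by
  refine ⟨Dr_open Ω r, he, hc0, hc1, fun h => hPΩ (Dr_sub hr h), ?_⟩
  intro x hx hxB t ht v hv hB
  have hx' : r < dista Ω x := hx
  set r' := min (dista Ω x) (R0 - R) with hr'
  have hrr : r < r' := lt_min hx' (by linarith)
  refine lt_of_lt_of_le hrr (dista_ge hPΩ fun z hz => ?_)
  set y := x + t • e + v with hy
  have e0 : z = (x + (z - y)) + t • e + v := by rw [hy]; abel
  rw [mem_ball] at hz hxB hB
  have hz1 : dist z y < R0 - R := hz.trans_le (min_le_right _ _)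
  have hxz : dist (x + (z - y)) x = dist z y := by rw [dist_eq_norm, add_sub_cancel_left, dist_eq_norm]
  rw [e0]
  refine hcone _ (dista_ball Ω x ?_) ?_ t ht v hv ?_
  · rw [mem_ball, hxz]; exact hz.trans_le (min_le_left _ _)
  · rw [mem_ball]
    have := dist_triangle (x + (z - y)) x P
    linarith
  · rw [← e0, mem_ball]
    have := dist_triangle z y P
    linarith

theorem Pot_Wr {N : ℕ} {Ω : Set (ES N)} {a : ℝ} {V : ES N → ℝ} (ha : 0 ≤ a) (hV : VClass Ω a V) {r : ℝ} (hr : 0 < r)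
    (hΩ : (Ωᶜ).Nonempty) : Pot (Dr Ω r) a (Wr Ω V r) := by
  have hnn : ∀ x, 0 ≤ Wr Ω V r x := fun x => by
    unfold Wr
    exact indicator_nonneg (fun x hx => (hV.2 x (Dr_sub hr.le hx)).1) x
  refine ⟨⟨(hV.1.indicator (Dr_open Ω r).measurableSet).aestronglyMeasurable, a / r ^ 2, by positivity,
    ae_of_all _ fun x => ?_⟩, hnn, fun x => ?_, ha⟩
  · rw [abs_of_nonneg (hnn x), le_div_iff₀ (by positivity)]
    unfold Wr
    by_cases hx : x ∈ Dr Ω r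
    · rw [indicator_of_mem hx]
      have h1 := hV.2 x (Dr_sub hr.le hx)
      have h2 : r ^ 2 ≤ dista Ω x ^ 2 := pow_le_pow_left₀ hr.le (le_of_lt hx) 2
      exact (mul_le_mul_of_nonneg_left h2 h1.1).trans h1.2
    · rw [indicator_of_notMem hx, zero_mul]; exact ha
  · unfold Wr
    by_cases hx : x ∈ Dr Ω r
    · rw [indicator_of_mem hx]
      have h1 := hV.2 x (Dr_sub hr.le hx)
      have h2 : dista (Dr Ω r) x ≤ dista Ω x := infDist_le_infDist_of_subset (compl_subset_compl.2 (Dr_sub hr.le)) hΩ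
      have h3 : dista (Dr Ω r) x ^ 2 ≤ dista Ω x ^ 2 := pow_le_pow_left₀ (dista_nn _ _) h2 2
      exact (mul_le_mul_of_nonneg_left h3 h1.1).trans h1.2
    · rw [indicator_of_notMem hx, zero_mul]; exact ha

theorem dista_Dr {N : ℕ} {Ω : Set (ES N)} (hΩ : (Ωᶜ).Nonempty) {r : ℝ} (hr : 0 ≤ r) (x : ES N) :
    dista (Dr Ω r) x ≤ dista Ω x ∧ dista Ω x - r ≤ dista (Dr Ω r) x := by
  obtain ⟨P, hP⟩ := hΩ
  refine ⟨infDist_le_infDist_of_subset (compl_subset_compl.2 (Dr_sub hr)) ⟨P, hP⟩,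
    dista_ge (P := P) (fun h => hP (Dr_sub hr h)) fun z hz => ?_⟩
  have := dista_lip Ω x z
  rw [mem_ball, dist_comm] at hz
  show r < dista Ω z
  linarith

/-- Green potentials of D and of D minus E -/
structure GP {N : ℕ} (D E : Set (ES N)) (W p g gE : ES N → ℝ) : Prop where
  bp : BM p
  bg : BM g
  bE : BM gE
  g0 : ∀ x, 0 ≤ g x
  E0 : ∀ x, 0 ≤ gE x
  goff : ∀ x, x ∉ D → g x = 0
  Eoff : ∀ x, x ∉ D \ E → gE x = 0
  gsub : SubW univ g (fun x => W x * g x - p x)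
  gsup : SubW D (fun x => - g x) (fun x => - (W x * g x - p x))
  Esub : SubW univ gE (fun x => W x * gE x - p x)
  Esup : SubW (D \ E) (fun x => - gE x) (fun x => - (W x * gE x - p x))

theorem GP.sol {N : ℕ} {D E B : Set (ES N)} {W p g gE : ES N → ℝ} (h : GP D E W p g gE) (hp : ∀ x ∈ B, p x = 0) :
    Sol D B W g := by
  refine ⟨h.bg, ae_of_all _ fun x _ => h.g0 x, ae_of_all _ fun x _ hx => h.goff x hx, ?_, ?_⟩
  · refine (h.gsub.mono (subset_univ B)).congr (ae_of_all _ fun x hx => rfl) (ae_of_all _ fun x hx => ?_)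
    simp [hp x hx]
  · refine (h.gsup.mono inter_subset_left).congr (ae_of_all _ fun x hx => rfl) (ae_of_all _ fun x hx => ?_)
    simp [hp x hx.2]

theorem Sol.cmul {N : ℕ} {D B : Set (ES N)} {W f : ES N → ℝ} (h : Sol D B W f) {c : ℝ} (hc : 0 ≤ c) :
    Sol D B W (fun x => c * f x) := by
  refine ⟨h.bm.cmul c, h.nn.mono fun x hx hm => mul_nonneg hc (hx hm), h.off.mono fun x hx h1 h2 => by
    rw [hx h1 h2, mul_zero], ?_, ?_⟩
  · refine (h.sub.cmul hc).congr (ae_of_all _ fun x _ => rfl) (ae_of_all _ fun x _ => ?_)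
    ring
  · refine (h.sup.cmul hc).congr (ae_of_all _ fun x _ => ?_) (ae_of_all _ fun x _ => ?_) <;> ring

theorem point {N : ℕ} {Ω : Set (ES N)} (hΩ : IsLipschitzDomain Ω) {a : ℝ} (ha : 0 ≤ a) {V : ES N → ℝ}
    (hV : VClass Ω a V) {P : ES N} (hP : P ∈ frontier Ω) {p : ES N → ℝ} {s0 : ℝ} (hs0 : 0 < s0)
    (hp : ∀ x ∈ ball P s0, p x = 0) {q : ES N → Prop} {κ : ℝ} (hκ : 0 < κ)
    (hq : ∀ η > 0, ∃ x ∈ Ω, dist x P ≤ κ * dista Ω x ∧ dist x P < η ∧ q x) :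
    ∃ (F : Finset (ES N)) (ρ rP : ℝ) (e : ES N) (c0 : ℝ), 0 < ρ ∧ ρ ≤ s0 ∧ 0 < rP ∧ (∀ x ∈ F, x ∈ Ω ∧ q x) ∧
      ∀ r, 0 < r → r < rP → Geo (Dr Ω r) P e ρ c0 ∧
        ∀ (E : Set (ES N)) (g gE : ES N → ℝ), (∀ x ∈ F, closedBall x (dista Ω x / 8) ⊆ E) →
          GP (Dr Ω r) E (Wr Ω V r) p g gE → (∀ᵐ x, gE x ≤ g x) → ∀ᵐ x, x ∈ ball P ρ → gE x ≤ 1 / 2 * g x := by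
  classical
  have hPΩ : P ∉ Ω := by
    have := hP.2
    rwa [hΩ.1.interior_eq] at this
  have hne : (Ωᶜ).Nonempty := ⟨P, hPΩ⟩
  obtain ⟨e, c0, R0, he, hc0, hc1, hR0, hcone⟩ := cone_of_lip hΩ hP
  obtain ⟨K, hK⟩ := pow_unbounded_of_one_lt (2 * κ) (show (1:ℝ) < 2 by norm_num)
  obtain ⟨c, hc, hc2, hBHP⟩ := BHP N (a := a) hc0 hc1 K
  obtain ⟨m, hm⟩ := exists_pow_lt_of_lt_one (show (0:ℝ) < 1 / 2 by norm_num) (show 1 - c < 1 by linarith)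
  have key : ∀ m : ℕ, ∃ (F : Finset (ES N)) (ρ rP : ℝ), 0 < ρ ∧ ρ ≤ s0 ∧ ρ ≤ R0 / 2 ∧ 0 < rP ∧ rP ≤ R0 / 2 ∧
      (∀ x ∈ F, x ∈ Ω ∧ q x) ∧
      ∀ r, 0 < r → r < rP → 
        ∀ (E : Set (ES N)) (g gE : ES N → ℝ), (∀ x ∈ F, closedBall x (dista Ω x / 8) ⊆ E) →
          GP (Dr Ω r) E (Wr Ω V r) p g gE → (∀ᵐ x, gE x ≤ g x) → ∀ᵐ x, x ∈ ball P ρ → gE x ≤ (1 - c) ^ m * g x := by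
    intro m
    induction m with
    | zero =>
      refine ⟨∅, min s0 (R0 / 2), R0 / 2, by positivity, min_le_left _ _, min_le_right _ _, by positivity, le_rfl,
        by simp, ?_⟩
      intro r hr hr2 E g gE _ _ h
      exact h.mono fun x hx _ => by simpa using hx
    | succ m ih =>
      obtain ⟨F, ρ, rP, hρ, hρs, hρR, hrP, hrR, hF, hmain⟩ := ih
      obtain ⟨x1, hx1, hx1κ, hx1d, hx1q⟩ := hq (ρ * c0 / 160) (by positivity)
      set ρ' := dist x1 P with hρ'
      have hρ'0 : 0 < ρ' := dist_pos.2 fun h => hPΩ (h ▸ hx1)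
      have hd1 : 0 < dista Ω x1 := dista_pos hΩ.1 hPΩ hx1
      set R := 160 * ρ' / c0 with hR
      have hRρ : R ≤ ρ := by rw [hR, div_le_iff₀ hc0]; linarith
      have hR' := sub_R hc0 hc1 hρ'0 hR
      refine ⟨insert x1 F, ρ', min rP (dista Ω x1 / 2), hρ'0, by linarith, by linarith, by positivity,
        (min_le_left _ _).trans hrR, ?_, ?_⟩
      · intro x hx
        rcases Finset.mem_insert.1 hx with rfl | hx
        · exact ⟨hx1, hx1q⟩
        · exact hF x hx
      intro r hr hr2 E g gE hE hGP hle
      have hr3 : r < rP := hr2.trans_le (min_le_left _ _)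
      have hr4 : r < dista Ω x1 / 2 := hr2.trans_le (min_le_right _ _)
      have ih := hmain r hr hr3 E g gE (fun x hx => hE x (Finset.mem_insert_of_mem hx)) hGP hle
      have hG : Geo (Dr Ω r) P e R c0 := Geo_Dr hPΩ he hc0 hc1 hcone hr.le (by linarith)
      have hW := Pot_Wr ha hV hr hne
      set W := Wr Ω V r with hWdef
      have hcm : 0 ≤ (1 - c) ^ m := pow_nonneg (by linarith) m
      have hpB : ∀ x ∈ ball P R, p x = 0 := fun x hx => hp x (ball_subset_ball (hRρ.trans hρs) hx)
      have hsol := (hGP.sol hpB).cmul hcm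
      obtain ⟨hdd1, hdd2⟩ := dista_Dr hne hr.le x1
      have := hBHP (Dr Ω r) P e R ρ' W (fun x => (1 - c) ^ m * g x) (fun x => (1 - c) ^ m * g x - gE x) x1 hG hR
        hρ'0 hW hsol (hsol.bm.sub hGP.bE) (by
          have h1 := hsol.sup.add (hGP.Esub.mono (subset_univ (Dr Ω r ∩ ball P R))) hsol.bm.neg.li
            (hW.bm.mul hsol.bm).neg.li hGP.bE.li ?_
          · refine h1.congr (ae_of_all _ fun x hx => ?_) (ae_of_all _ fun x hx => ?_)
            · ring
            · rw [hpB x hx.2]; ring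
          · exact ((hW.bm.mul hGP.bE).sub hGP.bp).li)
        (ih.mono fun x hx hxm => by linarith [hx (ball_subset_ball hRρ hxm)])
        (show r < dista Ω x1 by linarith) (by rw [mem_ball]; linarith)
        (by
          have h1 : dista Ω x1 / 2 ≤ dista (Dr Ω r) x1 := by linarith
          have h2 : 2 * κ * (dista Ω x1 / 2) ≤ 2 ^ K * dista (Dr Ω r) x1 :=
            mul_le_mul hK.le h1 (by positivity) (by positivity)
          linarith)
        (ae_of_all _ fun z hz => by
          have hzE : z ∈ E := hE x1 (Finset.mem_insert_self _ _)
            (ball_subset_closedBall (ball_subset_ball (by linarith) hz))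
          rw [hGP.Eoff z fun h => h.2 hzE, sub_zero])
      filter_upwards [this] with x hx hxm
      have := hx hxm
      rw [pow_succ]
      linarith
  obtain ⟨F, ρ, rP, hρ, hρs, hρR, hrP, hrR, hF, hmain⟩ := key m
  refine ⟨F, ρ, rP, e, c0, hρ, hρs, hrP, hF, fun r hr hr2 =>
    ⟨Geo_Dr hPΩ he hc0 hc1 hcone hr.le (by linarith), fun E g gE h1 h2 h3 => ?_⟩⟩
  filter_upwards [hmain r hr hr2 E g gE h1 h2 h3] with x hx hxm
  exact (hx hxm).trans (mul_le_mul_of_nonneg_right hm.le (h2.g0 x))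

theorem bm_ind {N : ℕ} {S Ω : Set (ES N)} {u : ES N → ℝ} (hS : IsCompact S) (hSΩ : S ⊆ Ω) (hu : ContinuousOn u Ω) :
    BM (S.indicator u) := by
  have hc := hu.mono hSΩ
  obtain ⟨C, hC⟩ := (hS.image_of_continuousOn hc.norm).bddAbove
  refine ⟨(aestronglyMeasurable_indicator_iff hS.measurableSet).2
    (hc.aestronglyMeasurable hS.measurableSet), max C 0, le_max_right _ _, ae_of_all _ fun x => ?_⟩
  by_cases hx : x ∈ S
  · rw [indicator_of_mem hx]
    exact le_max_of_le_left (hC ⟨x, hx, rfl⟩)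
  · rw [indicator_of_notMem hx, abs_zero]
    exact le_max_right _ _

theorem bm_V {N : ℕ} {S Ω : Set (ES N)} {V : ES N → ℝ} {a r : ℝ} (hS : MeasurableSet S) (hSΩ : S ⊆ Ω)
    (hV : VClass Ω a V) (ha : 0 ≤ a) (hr : 0 < r) (hSr : ∀ x ∈ S, r ≤ dista Ω x) : BM (S.indicator V) := by
  refine ⟨(hV.1.indicator hS).aestronglyMeasurable, a / r ^ 2, by positivity, ae_of_all _ fun x => ?_⟩
  rw [le_div_iff₀ (by positivity)]
  by_cases hx : x ∈ S
  · have h1 := hV.2 x (hSΩ hx)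
    rw [indicator_of_mem hx, abs_of_nonneg h1.1]
    have h2 : r ^ 2 ≤ dista Ω x ^ 2 := pow_le_pow_left₀ hr.le (hSr x hx) 2
    exact (mul_le_mul_of_nonneg_left h2 h1.1).trans h1.2
  · rw [indicator_of_notMem hx, abs_zero, zero_mul]; exact ha

theorem usol {N : ℕ} {Ω S O : Set (ES N)} {V u : ES N → ℝ} (hΩ : IsOpen Ω) (hu : LVHarmonic Ω V u) (hSΩ : S ⊆ Ω)
    (hO : O ⊆ S) {φ : ES N → ℝ} (hφ : IsTestFun O φ) :
    ∫ x, S.indicator u x * lap φ x = ∫ x, S.indicator V x * S.indicator u x * φ x := by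
  have h1 := hu.2.2.2 φ (hφ.mono (hO.trans hSΩ))
  rw [← integral_indicator hΩ.measurableSet, ← integral_indicator hΩ.measurableSet] at h1
  have e1 : (fun x => S.indicator u x * lap φ x) = fun x => Ω.indicator (fun x => u x * lap φ x) x := by
    ext x
    by_cases hx : x ∈ O
    · rw [indicator_of_mem (hO hx), indicator_of_mem (hSΩ (hO hx))]
    · have : lap φ x = 0 := lap_zero_off fun h => hx (hφ.2.2 h)
      by_cases hxΩ : x ∈ Ω <;> simp [this, hxΩ]
  have e2 : (fun x => S.indicator V x * S.indicator u x * φ x) =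
      fun x => Ω.indicator (fun x => V x * u x * φ x) x := by
    ext x
    by_cases hx : x ∈ O
    · rw [indicator_of_mem (hO hx), indicator_of_mem (hO hx), indicator_of_mem (hSΩ (hO hx))]
    · have : φ x = 0 := image_eq_zero_of_notMem_tsupport fun h => hx (hφ.2.2 h)
      by_cases hxΩ : x ∈ Ω <;> simp [this, hxΩ]
  rw [e1, e2]
  exact h1

theorem uharn {N : ℕ} {Ω : Set (ES N)} {V u : ES N → ℝ} {a : ℝ} (hΩ : IsOpen Ω) (hne : (Ωᶜ).Nonempty) (ha : 0 ≤ a)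
    (hV : VClass Ω a V) (hu : LVHarmonic Ω V u) (hunn : ∀ x ∈ Ω, 0 ≤ u x) {x y : ES N} (hx : x ∈ Ω)
    (hy : y ∈ closedBall x (dista Ω x / 4)) : u y ≤ 4 * 4 ^ N * Real.exp a * u x := by
  obtain ⟨P, hP⟩ := hne
  set d := dista Ω x with hd
  have hd0 : 0 < d := dista_pos hΩ hP hx
  set S := closedBall x (7 / 8 * d) with hS
  have hSΩ : S ⊆ Ω := (closedBall_subset_ball (by linarith)).trans (dista_ball Ω x)
  have hSd : ∀ z ∈ S, d / 8 ≤ dista Ω z := fun z hz => by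
    have := dista_lip Ω x z
    rw [mem_closedBall, dist_comm] at hz
    linarith
  set f := S.indicator u with hf
  set W := S.indicator V with hW
  have hfB : BM f := bm_ind (isCompact_closedBall _ _) hSΩ hu.1
  have hWB : BM W := bm_V measurableSet_closedBall hSΩ hV ha (show 0 < d / 8 by linarith) hSd
  have hO : ball x (3 / 4 * d) ⊆ S := ball_subset_closedBall.trans (closedBall_subset_closedBall (by linarith))
  have hf0 : ∀ z, 0 ≤ f z := fun z => indicator_nonneg (fun z hz => hunn z (hSΩ hz)) z
  have hW0 : ∀ z, 0 ≤ W z := fun z => indicator_nonneg (fun z hz => (hV.2 z (hSΩ hz)).1) z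
  have hsub : SubW (ball x (3 / 4 * d)) f (fun z => W z * f z) := fun φ hφ _ => (usol hΩ hu hSΩ hO hφ).ge
  have hsup : SubW (ball x (3 / 4 * d)) (fun z => - f z) (fun z => - (W z * f z)) := fun φ hφ _ => by
    simp only [neg_mul, integral_neg]
    exact neg_le_neg (usol hΩ hu hSΩ hO hφ).le
  have hLP : ∀ z ∈ ball x (3 / 4 * d), LP f z := fun z hz => by
    refine LP.of_cont hfB.li ?_
    have h1 : ContinuousAt u z := hu.1.continuousAt (hΩ.mem_nhds (hSΩ (hO hz)))
    refine h1.congr ?_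
    filter_upwards [isOpen_ball.mem_nhds hz] with w hw
    rw [hf, indicator_of_mem (hO hw)]
  rw [mem_closedBall] at hy
  have hyb : y ∈ ball x (3 / 4 * d) := by rw [mem_ball]; linarith
  have hxb : x ∈ ball x (3 / 4 * d) := mem_ball_self (by linarith)
  have := harn isOpen_ball hfB (hWB.mul hfB).li
    (hsub.rhs (G := fun _ => 0) (hWB.mul hfB).li (BM.const 0).li (ae_of_all _ fun z _ => mul_nonneg (hW0 z) (hf0 z)))
    hsup (M := 16 * a / d ^ 2) (ρ := d / 2) (by positivity) (ae_of_all _ fun z _ => hf0 z)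
    (ae_of_all _ fun z hz => by
      refine mul_le_mul_of_nonneg_right ?_ (hf0 z)
      rw [hW, indicator_of_mem (hO hz), le_div_iff₀ (by positivity)]
      have h1 := hV.2 z (hSΩ (hO hz))
      have h3 := dista_lip Ω x z
      rw [mem_ball, dist_comm] at hz
      have h2 : (d / 4) ^ 2 ≤ dista Ω z ^ 2 := pow_le_pow_left₀ (by positivity) (by linarith) 2
      have := (mul_le_mul_of_nonneg_left h2 h1.1).trans h1.2
      linarith) (by positivity) (y := y) (z := x) (closedBall_subset_ball' (by linarith))
    (closedBall_subset_ball (by linarith)) (by rw [dist_comm]; linarith) (hLP y hyb) (hLP x hxb)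
  rw [hf, indicator_of_mem (hO hyb), indicator_of_mem (hO hxb),
    show 16 * a / d ^ 2 * (d / 2) ^ 2 / 4 = a by field_simp; ring] at this
  exact this

theorem BM.integrable_of {N : ℕ} {f : ES N → ℝ} {K : Set (ES N)} (hf : BM f) (hK : IsCompact K)
    (h : ∀ x, x ∉ K → f x = 0) : Integrable f := by
  have h1 : IntegrableOn f K := hf.li.integrableOn_isCompact hK
  rwa [integrableOn_iff_integrable_of_support_subset] at h1
  intro x hx
  by_contra hxK
  exact hx (h x hxK)

theorem gE_le {N : ℕ} (hN : 2 ≤ N) {D E K : Set (ES N)} {W p g gE : ES N → ℝ} (hD : IsOpen D) (hK : IsCompact K) (hDK : D ⊆ K)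
    (hW : BM W) (hW0 : ∀ x, 0 ≤ W x) (h : GP D E W p g gE)
    (hdec : ∀ z, z ∉ D → ∀ t > 0, ∃ r > 0, ∀ᵐ y, y ∈ ball z r → gE y ≤ t) : ∀ᵐ x, gE x ≤ g x := by
  have hf : BM (fun x => gE x - g x) := h.bE.sub h.bg
  have h1 : SubW (D ∩ univ) (fun x => gE x - g x) (fun x => W x * (gE x - g x)) := by
    have := (h.Esub.mono (subset_univ D)).add h.gsup h.bE.li ((hW.mul h.bE).sub h.bp).li h.bg.neg.li
      ((hW.mul h.bg).sub h.bp).neg.li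
    rw [inter_univ]
    refine this.congr (ae_of_all _ fun x _ => ?_) (ae_of_all _ fun x _ => ?_) <;> ring
  have h2 := extend isOpen_univ hD hf hW hW0 h1 fun z _ hz t ht => by
    obtain ⟨r, hr, hr2⟩ := hdec z hz t ht
    refine ⟨r, hr, ?_⟩
    filter_upwards [hr2] with y hy hyb
    have := hy hyb
    have := h.g0 y
    linarith
  obtain ⟨ρ, hρ⟩ := hK.isBounded.subset_ball 0
  have h0 : ∀ x, x ∉ K → max (gE x - g x) 0 = 0 := fun x hx => by
    rw [h.goff x fun hd => hx (hDK hd), h.Eoff x fun hd => hx (hDK hd.1)]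
    simp
  have h3 := maxprin (q := fun _ => 0) isOpen_ball ball_subset_closedBall hK hρ h0
    (hW.mul hf.pos).li (integrable_zero _ _ _) (fun _ => le_rfl)
    (ae_of_all _ fun x _ => by simpa using mul_nonneg (hW0 x) (le_max_right _ _)) (h2.mono (subset_univ _))
  simp only [integral_zero, mul_zero] at h3
  have hN' : (2:ℝ) ≤ N := by exact_mod_cast hN
  have h4 : ∫ x, max (gE x - g x) 0 = 0 := by
    refine le_antisymm ?_ (integral_nonneg fun x => le_max_right _ _)
    by_contra! hcon
    have : 0 < 2 * (N:ℝ) * ∫ x, max (gE x - g x) 0 := by positivity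
    linarith
  rw [integral_eq_zero_iff_of_nonneg (f := fun x => max (gE x - g x) 0) (fun x => le_max_right _ _)
    (hf.pos.integrable_of hK h0)] at h4
  filter_upwards [h4] with x hx
  have : gE x - g x ≤ 0 := (le_max_left _ _).trans hx.le
  linarith

theorem ksub {N : ℕ} {D E O : Set (ES N)} {W p g gE : ES N → ℝ} (hD : IsOpen D) (hO : IsOpen O)
    (hW : BM W) (hW0 : ∀ x, 0 ≤ W x) (h : GP D E W p g gE) (hp : ∀ x ∈ O, p x = 0) (hEO : ∀ x ∈ O, x ∉ E)
    (hk : ∀ᵐ x, x ∈ O → gE x ≤ 1 / 2 * g x)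
    (hdec : ∀ z, z ∉ D → ∀ t > 0, ∃ r > 0, ∀ᵐ y, y ∈ ball z r → g y ≤ t) :
    SubW O (fun x => 1 / 2 * g x + -gE x) (fun x => 1 / 2 * (W x * g x - p x) + - (W x * gE x - p x)) := by
  have hf : BM (fun x => 1 / 2 * g x + -gE x) := (h.bg.cmul (1/2)).add h.bE.neg
  have h1 : SubW (D ∩ O) (fun x => 1 / 2 * g x + -gE x) (fun x => W x * (1 / 2 * g x + -gE x)) := by
    have := (((h.gsub.mono (subset_univ (D ∩ O))).cmul (c := 1/2) (by norm_num))).add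
      (h.Esup.mono (O' := D ∩ O) fun x hx => ⟨hx.1, hEO x hx.2⟩) (h.bg.cmul _).li
      (((hW.mul h.bg).sub h.bp).cmul _).li h.bE.neg.li ((hW.mul h.bE).sub h.bp).neg.li
    refine this.congr (ae_of_all _ fun x _ => rfl) (ae_of_all _ fun x hx => ?_)
    simp only [hp x hx.2]; ring
  have h2 := extend hO hD hf hW hW0 h1 fun z _ hz t ht => by
    obtain ⟨r, hr, hr2⟩ := hdec z hz t ht
    refine ⟨r, hr, ?_⟩
    filter_upwards [hr2] with y hy hyb
    have := hy hyb
    have := h.g0 y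
    have := h.E0 y
    linarith
  refine h2.congr ?_ ?_
  · filter_upwards [hk] with x hx hxO
    rw [max_eq_left]
    linarith [hx hxO]
  · filter_upwards [hk] with x hx hxO
    rw [max_eq_left (by linarith [hx hxO]), hp x hxO]
    ring

theorem mol_add {N n : ℕ} {f g : ES N → ℝ} (hf : LocallyIntegrable f) (hg : LocallyIntegrable g) (x : ES N) :
    mol n (fun y => f y + g y) x = mol n f x + mol n g x := by
  simp only [mol, cv, add_mul]
  exact integral_add (intg hf ((eta_sm N n).refl x).continuous (cs_refl (eta_cs N n) x))
    (intg hg ((eta_sm N n).refl x).continuous (cs_refl (eta_cs N n) x))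

/-- the mollified defect -/
def Mn {N : ℕ} (n : ℕ) (f F : ES N → ℝ) (x : ES N) : ℝ := lap (mol n f) x - mol n F x

theorem Mn_half {N n : ℕ} {O : Set (ES N)} {f F g G : ES N → ℝ} (hf : BM f) (hF : BM F)
    (hg : BM g) (hG : BM G)
    (h : SubW O (fun x => 1 / 2 * f x + - g x) (fun x => 1 / 2 * F x + - G x)) {x : ES N}
    (hx : closedBall x (1 / (n + 1)) ⊆ O) : Mn n g G x ≤ 1 / 2 * Mn n f F x := by
  have h1 := h.mol ((hf.cmul (1 / 2)).add hg.neg).li hx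
  have e1 : mol n (fun x => 1 / 2 * f x + - g x) = fun x => (1 / 2 * mol n f x) + (- mol n g x) := by
    ext y
    rw [mol_add (hf.cmul (1 / 2)).li hg.neg.li, mol_cmul, mol_neg]
  rw [mol_add (hF.cmul (1 / 2)).li hG.neg.li, mol_cmul, mol_neg, e1] at h1
  rw [lap_add (contDiff_const.mul (mol_sm hf.li)) (mol_sm hg.li).neg, lap_const_mul _ (mol_sm hf.li), lap_neg (mol_sm hg.li)] at h1
  unfold Mn
  linarith

theorem Mn_nonneg {N n : ℕ} {f F : ES N → ℝ} (hf : LocallyIntegrable f) (h : SubW univ f F) (x : ES N) :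
    0 ≤ Mn n f F x := sub_nonneg.2 (h.mol hf (subset_univ _))

theorem Mn_nonpos {N n : ℕ} {O : Set (ES N)} {f F : ES N → ℝ} (hf : LocallyIntegrable f)
    (h : SubW O (fun x => - f x) (fun x => - F x)) {x : ES N}
    (hx : closedBall x (1 / (n + 1)) ⊆ O) : Mn n f F x ≤ 0 := by
  have h1 := h.mol hf.neg hx
  have e1 : mol n (fun x => - f x) = fun x => (- mol n f x) := by
    ext y
    rw [mol_neg]
  rw [mol_neg, e1, lap_neg (mol_sm hf)] at h1
  unfold Mn
  linarith

theorem mol_int {N : ℕ} {f : ES N → ℝ} (hf : Integrable f) (n : ℕ) : Integrable (mol n f) ∧ ∫ x, mol n f x = ∫ x, f x := by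
  have hη : Integrable (eta N n) := (eta_sm N n).continuous.integrable_of_hasCompactSupport (eta_cs N n)
  refine ⟨hf.integrable_convolution (ContinuousLinearMap.lsmul ℝ ℝ) hη, ?_⟩
  have := integral_convolution (ContinuousLinearMap.lsmul ℝ ℝ) hf hη (μ := volume) (ν := volume)
  rw [eta_int] at this
  simpa [mol, cv_eq] using this

theorem dc {N : ℕ} {b f : ES N → ℝ} (hb : Integrable b) (hf : BM f) :
    Tendsto (fun n => ∫ x, b x * mol n f x) atTop (𝓝 (∫ x, b x * f x)) := by
  obtain ⟨C, hC0, hC⟩ := hf.2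
  refine tendsto_integral_of_dominated_convergence (fun x => C * |b x|)
    (fun n => hb.1.mul (mol_sm hf.li).continuous.aestronglyMeasurable) (hb.abs.const_mul C) (fun n => ?_) ?_
  · refine ae_of_all _ fun x => ?_
    rw [norm_mul, mul_comm, Real.norm_eq_abs, Real.norm_eq_abs]
    exact mul_le_mul_of_nonneg_right (mol_bound hC x) (abs_nonneg _)
  · filter_upwards [mol_tendsto hf.li] with x hx using hx.const_mul _

theorem mol_test {N n : ℕ} {Ω : Set (ES N)} {r : ℝ} (hr : 0 < r) (hbd : Bornology.IsBounded Ω)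
    {f : ES N → ℝ} (hf : LocallyIntegrable f) (h0 : ∀ x, x ∉ Dr Ω r → f x = 0) (hn : 1 / ((n:ℝ) + 1) ≤ r / 4) :
    IsTestFun (Dr Ω (r / 2)) (mol n f) := by
  have hts : tsupport (mol n f) ⊆ {x | 3 / 4 * r ≤ dista Ω x} := by
    refine closure_minimal ?_ (isClosed_le continuous_const (dista_cont Ω))
    intro x hx
    by_contra hcon
    rw [mem_ofPred_eq, not_le] at hcon
    apply hx
    rw [mol_congr (g := fun _ => 0), mol_const]
    refine ae_of_all _ fun y hy => h0 y fun hyD => ?_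
    have h1 := dista_lip Ω y x
    have h2 : r < dista Ω y := hyD
    rw [mem_closedBall] at hy
    linarith
  have h2 : tsupport (mol n f) ⊆ Dr Ω (r / 2) := hts.trans fun x hx => by
    have : 3 / 4 * r ≤ dista Ω x := hx
    show r / 2 < dista Ω x
    linarith
  refine ⟨mol_sm hf, ?_, h2⟩
  exact isCompact_of_isClosed_isBounded (isClosed_tsupport _) (hbd.subset (h2.trans (Dr_sub (by linarith))))

theorem small_n {r : ℝ} (hr : 0 < r) : ∀ᶠ n : ℕ in atTop, 1 / ((n:ℝ) + 1) ≤ r := by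
  have h1 : Tendsto (fun n : ℕ => 1 / ((n : ℝ) + 1)) atTop (𝓝 0) := tendsto_one_div_add_atTop_nhds_zero_nat
  filter_upwards [h1.eventually (gt_mem_nhds hr)] with n hn using hn.le

theorem lap_int {N : ℕ} {φ : ES N → ℝ} (hφ : Sm φ) (hc : HasCompactSupport φ) : ∫ x, lap φ x = 0 := by
  have := green (v := fun _ => 1) contDiff_const hφ hc
  have h0 : ∀ x : ES N, lap (fun _ : ES N => (1:ℝ)) x = 0 := fun x => by simp [lap]
  simpa [h0] using this

theorem BM.mol {N : ℕ} {f : ES N → ℝ} (hf : BM f) (n : ℕ) : BM (Anc.mol n f) := by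
  obtain ⟨C, hC0, hC⟩ := hf.2
  exact ⟨(mol_sm hf.li).continuous.aestronglyMeasurable, C, hC0, ae_of_all _ fun x => mol_bound hC x⟩

/-- compact inner sets -/
def Sr {N : ℕ} (Ω : Set (ES N)) (r : ℝ) : Set (ES N) := {x | r ≤ dista Ω x}

theorem Sr_sub {N : ℕ} {Ω : Set (ES N)} {r : ℝ} (hr : 0 < r) : Sr Ω r ⊆ Ω := fun _ hx => dista_mem (lt_of_lt_of_le hr hx)

theorem Sr_closed {N : ℕ} (Ω : Set (ES N)) (r : ℝ) : IsClosed (Sr Ω r) := isClosed_le continuous_const (dista_cont Ω)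

theorem Sr_compact {N : ℕ} {Ω : Set (ES N)} {r : ℝ} (hbd : Bornology.IsBounded Ω) (hr : 0 < r) : IsCompact (Sr Ω r) :=
  isCompact_of_isClosed_isBounded (Sr_closed Ω r) (hbd.subset (Sr_sub hr))

theorem Dr_sub_Sr {N : ℕ} (Ω : Set (ES N)) (r : ℝ) : Dr Ω r ⊆ Sr Ω r := fun x hx =>
  show r ≤ dista Ω x from le_of_lt (show r < dista Ω x from hx)

theorem Mn_int {N n : ℕ} {Ω : Set (ES N)} {r : ℝ} (hr : 0 < r) (hbd : Bornology.IsBounded Ω)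
    {f F b : ES N → ℝ} (hf : BM f) (hF : BM F) (h0 : ∀ x, x ∉ Dr Ω r → f x = 0) (hn : 1 / ((n:ℝ) + 1) ≤ r / 4)
    (hb : BM b) (hb0 : ∀ x, x ∉ Sr Ω (r / 2) → b x = 0) :
    Integrable (fun x => b x * Mn n f F x) ∧
      ∫ x, b x * Mn n f F x = (∫ x, b x * lap (mol n f) x) - ∫ x, b x * mol n F x := by
  have ht := mol_test hr hbd hf.li h0 hn
  have i1 : Integrable (fun x => b x * lap (mol n f) x) := intg hb.li ht.sm.lap.continuous ht.lapcs
  have i2 : Integrable (fun x => b x * mol n F x) := (hb.mul (hF.mol n)).integrable_of (Sr_compact hbd (half_pos hr))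
    fun x hx => by rw [hb0 x hx, zero_mul]
  have e : (fun x => b x * Mn n f F x) = fun x => b x * lap (mol n f) x - b x * mol n F x := by
    ext x; unfold Mn; ring
  rw [e]
  exact ⟨i1.sub i2, integral_sub i1 i2⟩

theorem Mn_total {N n : ℕ} {Ω : Set (ES N)} {r : ℝ} (hr : 0 < r) (hbd : Bornology.IsBounded Ω)
    {f F p : ES N → ℝ} (hf : BM f) (hF : Integrable F) (hp : Integrable p) (hFp : ∀ x, - p x ≤ F x)
    (h0 : ∀ x, x ∉ Dr Ω r → f x = 0) (hn : 1 / ((n:ℝ) + 1) ≤ r / 4) :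
    Integrable (Mn n f F) ∧ ∫ x, Mn n f F x ≤ ∫ x, p x := by
  have ht := mol_test hr hbd hf.li h0 hn
  have i1 : Integrable (lap (mol n f)) := ht.sm.lap.continuous.integrable_of_hasCompactSupport ht.lapcs
  obtain ⟨i2, e2⟩ := mol_int hF n
  refine ⟨i1.sub i2, ?_⟩
  have : ∫ x, Mn n f F x = (∫ x, lap (mol n f) x) - ∫ x, mol n F x := integral_sub i1 i2
  rw [this, lap_int ht.sm ht.cs, e2]
  have h3 : ∫ x, - p x ≤ ∫ x, F x := integral_mono hp.neg hF hFp
  rw [integral_neg] at h3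
  linarith

theorem Mn_conv {N : ℕ} {Ω : Set (ES N)} {V u : ES N → ℝ} {a r : ℝ} (hΩ : IsOpen Ω) (ha : 0 ≤ a) (hr : 0 < r) (hbd : Bornology.IsBounded Ω)
    (hne : (Ωᶜ).Nonempty)
    (hV : VClass Ω a V) (hu : LVHarmonic Ω V u) 
    {f p : ES N → ℝ} (hf : BM f) (hp : BM p) (h0 : ∀ x, x ∉ Dr Ω r → f x = 0) :
    Tendsto (fun n => ∫ x, (Sr Ω (r / 2)).indicator u x * Mn n f (fun x => Wr Ω V r x * f x - p x) x) atTop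
      (𝓝 (∫ x, (Sr Ω (r / 2)).indicator u x * p x)) := by
  have hr2 := half_pos hr
  set S := Sr Ω (r / 2) with hS
  have hSΩ : S ⊆ Ω := Sr_sub hr2
  have hSc : IsCompact S := Sr_compact hbd hr2
  have hbu : BM (S.indicator u) := bm_ind hSc hSΩ hu.1
  have hbV : BM (S.indicator V) := bm_V hSc.measurableSet hSΩ hV ha hr2 fun x hx => hx
  have hW : BM (Wr Ω V r) := (Pot_Wr ha hV hr hne).bm
  have hF : BM (fun x => Wr Ω V r x * f x - p x) := (hW.mul hf).sub hp
  have iu : Integrable (S.indicator u) := hbu.integrable_of hSc fun x hx => indicator_of_notMem hx _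
  have iVu : Integrable (fun x => S.indicator V x * S.indicator u x) := (hbV.mul hbu).integrable_of hSc fun x hx => by
    rw [indicator_of_notMem hx, zero_mul]
  have t := (dc iVu hf).sub (dc iu hF)
  have iA : Integrable (fun x => S.indicator V x * S.indicator u x * f x) := ((hbV.mul hbu).mul hf).integrable_of hSc fun x hx => by
    rw [indicator_of_notMem hx, zero_mul, zero_mul]
  have iB : Integrable (fun x => S.indicator u x * (Wr Ω V r x * f x - p x)) := (hbu.mul hF).integrable_of hSc fun x hx => by
    rw [indicator_of_notMem hx, zero_mul]
  rw [← integral_sub iA iB] at t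
  have e : (fun x => S.indicator V x * S.indicator u x * f x - S.indicator u x * (Wr Ω V r x * f x - p x)) =
      fun x => S.indicator u x * p x := by
    ext x
    by_cases hx : x ∈ Dr Ω r
    · have hxS : x ∈ S := by
        have : r < dista Ω x := hx
        show r / 2 ≤ dista Ω x
        linarith
      rw [Wr, indicator_of_mem hx, indicator_of_mem hxS, indicator_of_mem hxS]; ring
    · rw [h0 x hx]; ring
  rw [e] at t
  refine t.congr' ?_
  filter_upwards [small_n (show 0 < r / 4 by linarith)] with n hn
  rw [(Mn_int hr hbd hf hF h0 hn hbu fun x hx => indicator_of_notMem hx _).2,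
    usol hΩ hu hSΩ (Dr_sub_Sr Ω (r / 2)) (mol_test hr hbd hf.li h0 hn)]

theorem fin_int {N : ℕ} {Ω E : Set (ES N)} {V u : ES N → ℝ} {a r : ℝ} (hΩ : IsOpen Ω) (ha : 0 ≤ a) (hr : 0 < r) (hbd : Bornology.IsBounded Ω)
    (hne : (Ωᶜ).Nonempty)
    (hV : VClass Ω a V) (hu : LVHarmonic Ω V u) {p g gE : ES N → ℝ}
    (h : GP (Dr Ω r) E (Wr Ω V r) p g gE) (hp : Integrable p) {c : ℝ} (hc : 0 ≤ c)
    (hpt : ∀ᶠ n in atTop, ∀ x, (Sr Ω (r / 2)).indicator u x * Mn n gE (fun x => Wr Ω V r x * gE x - p x) x ≤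
      1 / 2 * ((Sr Ω (r / 2)).indicator u x * Mn n g (fun x => Wr Ω V r x * g x - p x) x) +
        c * Mn n gE (fun x => Wr Ω V r x * gE x - p x) x) :
    ∫ x, (Sr Ω (r / 2)).indicator u x * p x ≤ 2 * (c * ∫ x, p x) := by
  have hE0 : ∀ x, x ∉ Dr Ω r → gE x = 0 := fun x hx => h.Eoff x fun h => hx h.1
  have hr2 := half_pos hr
  have hSc : IsCompact (Sr Ω (r / 2)) := Sr_compact hbd hr2
  have hbu : BM ((Sr Ω (r / 2)).indicator u) := bm_ind hSc (Sr_sub hr2) hu.1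
  have hPW := Pot_Wr ha hV hr hne
  have hFE : BM (fun x => Wr Ω V r x * gE x - p x) := (hPW.bm.mul h.bE).sub h.bp
  have hF : BM (fun x => Wr Ω V r x * g x - p x) := (hPW.bm.mul h.bg).sub h.bp
  have t1 := Mn_conv hΩ ha hr hbd hne hV hu h.bE h.bp hE0
  have t2 := Mn_conv hΩ ha hr hbd hne hV hu h.bg h.bp h.goff
  have key := le_of_tendsto_of_tendsto t1 ((t2.const_mul (1 / 2)).add_const (c * ∫ x, p x)) (by
    filter_upwards [hpt, small_n (show 0 < r / 4 by linarith)] with n hn hn4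
    obtain ⟨i1, -⟩ := Mn_int hr hbd h.bE hFE hE0 hn4 hbu fun x hx => indicator_of_notMem hx _
    obtain ⟨i2, -⟩ := Mn_int hr hbd h.bg hF h.goff hn4 hbu fun x hx => indicator_of_notMem hx _
    have iWE : Integrable (fun x => Wr Ω V r x * gE x) := (hPW.bm.mul h.bE).integrable_of (Sr_compact hbd hr) fun x hx => by
      rw [hE0 x fun hd => hx (Dr_sub_Sr _ _ hd), mul_zero]
    obtain ⟨i3, e3⟩ := Mn_total (n := n) (p := p) hr hbd h.bE (iWE.sub hp) hp (fun x => by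
      have := mul_nonneg (hPW.nn x) (h.E0 x)
      simp only [Pi.sub_apply]
      linarith) hE0 hn4
    have := integral_mono i1 ((i2.const_mul (1 / 2)).add (i3.const_mul c)) hn
    refine this.trans ?_
    simp only [Pi.add_apply]
    rw [integral_add (i2.const_mul (1 / 2)) (i3.const_mul c), integral_const_mul, integral_const_mul]
    exact add_le_add le_rfl (mul_le_mul_of_nonneg_left e3 hc))
  linarith

theorem exGP {N : ℕ} (hN : 2 ≤ N) {D E : Set (ES N)} (hD : IsOpen D) (hDb : Bornology.IsBounded D) (hE : IsClosed E)
    {W p : ES N → ℝ} (hW : BM W) (hW0 : ∀ x, 0 ≤ W x) (hp0 : ∀ x, 0 ≤ p x) (hpc : Continuous p)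
    (hps : HasCompactSupport p) : ∃ g gE, GP D E W p g gE := by
  obtain ⟨ρ, hρ⟩ := hDb.subset_closedBall 0
  have hp : BM p := BM.of_cs hpc hps
  obtain ⟨C, hC0, hC⟩ := hp.2
  have hb : ∀ f : ES N → ℝ, Integrable f → (∀ x, 0 ≤ f x) → SubW univ f (fun x => W x * f x - p x) → BM f := by
    intro f hf hf0 hs
    have h1 : SubW univ f (fun x => - p x) := by
      refine hs.rhs ?_ hp.neg.li (ae_of_all _ fun x _ => ?_)
      · obtain ⟨CW, hCW0, hCW⟩ := hW.2
        exact ((hf.bdd_mul hW.1 hCW).locallyIntegrable).sub hp.li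
      · have := mul_nonneg (hW0 x) (hf0 x)
        linarith
    refine bm_of_sub hf hf0 hp.neg.li h1 hC0 ?_
    filter_upwards [hC] with x hx
    exact neg_le_neg ((le_abs_self _).trans hx)
  obtain ⟨g, ig, g0, goff, gsub, gsup⟩ := exist_g hN hD hρ hW hW0 hp0 hpc hps
  obtain ⟨gE, iE, E0, Eoff, Esub, Esup⟩ := exist_g hN (hD.sdiff hE) (sdiff_subset.trans hρ) hW hW0 hp0 hpc hps
  exact ⟨g, gE, hp, hb g ig g0 gsub, hb gE iE E0 Esub, g0, E0, goff, Eoff, gsub, gsup, Esub, Esup⟩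

theorem near_frontier {N : ℕ} {Ω : Set (ES N)} (hΩ : IsOpen Ω) (hne : (Ωᶜ).Nonempty) {x : ES N} {η : ℝ} (hx : x ∈ Ω)
    (hη : dista Ω x < η) : x ∈ thickening η (frontier Ω) := by
  obtain ⟨y, hy, hxy⟩ := hΩ.isClosed_compl.exists_infDist_eq_dist hne x
  have h0 : 0 < dista Ω x := dista_pos hΩ hy hx
  rw [mem_thickening_iff]
  refine ⟨y, ⟨?_, ?_⟩, by rw [← hxy]; exact hη⟩
  · refine closure_mono (dista_ball Ω x) ?_
    rw [closure_ball _ h0.ne', mem_closedBall, dist_comm]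
    exact hxy.ge
  · rw [hΩ.interior_eq]; exact hy

theorem est {N : ℕ} (hN : 2 ≤ N) {Ω : Set (ES N)} (hΩ : IsLipschitzDomain Ω) (hbd : Bornology.IsBounded Ω)
    {a : ℝ} (ha : 0 ≤ a) {V u : ES N → ℝ} (hV : VClass Ω a V) (hu : LVHarmonic Ω V u) (hunn : ∀ x ∈ Ω, 0 ≤ u x)
    (hne : (Ωᶜ).Nonempty) {p : ES N → ℝ} (hp0 : ∀ x, 0 ≤ p x) (hpc : Continuous p)
    (hps : HasCompactSupport p) {s0 : ℝ} (hs0 : 0 < s0) (hpz : ∀ x, dista Ω x < s0 → p x = 0) {ε : ℝ} (hε : 0 < ε)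
    (hq : ∀ P ∈ frontier Ω, ∃ κ > 0, ∀ η > 0, ∃ x ∈ Ω, dist x P ≤ κ * dista Ω x ∧ dist x P < η ∧ u x < ε) :
    ∫ x, (Sr Ω s0).indicator u x * p x ≤ 2 * (4 * 4 ^ N * Real.exp a * ε * ∫ x, p x) := by
  classical
  have hop := hΩ.1
  have hPn : ∀ P ∈ frontier Ω, P ∉ Ω := fun P hP => by
    have := hP.2
    rwa [hop.interior_eq] at this
  have hpP : ∀ P ∈ frontier Ω, ∀ x ∈ ball P s0, p x = 0 := fun P hP x hx =>
    hpz x ((dista_le (hPn P hP) x).trans_lt hx)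
  have hpt : ∀ P ∈ frontier Ω, ∃ (F : Finset (ES N)) (ρ rP : ℝ) (e : ES N) (c0 : ℝ), 0 < ρ ∧ ρ ≤ s0 ∧ 0 < rP ∧ (∀ x ∈ F, x ∈ Ω ∧ u x < ε) ∧
      ∀ r, 0 < r → r < rP → Geo (Dr Ω r) P e ρ c0 ∧
        ∀ (E : Set (ES N)) (g gE : ES N → ℝ), (∀ x ∈ F, closedBall x (dista Ω x / 8) ⊆ E) →
          GP (Dr Ω r) E (Wr Ω V r) p g gE → (∀ᵐ x, gE x ≤ g x) → ∀ᵐ x, x ∈ ball P ρ → gE x ≤ 1 / 2 * g x := by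
    intro P hP
    obtain ⟨κ, hκ, hκq⟩ := hq P hP
    exact point hΩ ha hV hP hs0 (hpP P hP) hκ hκq
  choose F ρ rP e c0 hρ0 hρs hrP hF hgeo using hpt
  have hfc : IsCompact (frontier Ω) := isCompact_of_isClosed_isBounded isClosed_frontier
    (hbd.closure.subset frontier_subset_closure)
  obtain ⟨t, ht⟩ := hfc.elim_nhds_subcover' (fun P hP => ball P (ρ P hP)) (fun P hP => ball_mem_nhds _ (hρ0 P hP))
  obtain ⟨η, hη, hηt⟩ := hfc.exists_thickening_subset_open (isOpen_biUnion fun P _ => isOpen_ball) ht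
  set FF : Finset (ES N) := t.biUnion fun P => F P.1 P.2 with hFF
  have hFFq : ∀ x ∈ FF, x ∈ Ω ∧ u x < ε := fun x hx => by
    obtain ⟨P, hPt, hxP⟩ := Finset.mem_biUnion.1 hx
    exact hF P.1 P.2 x hxP
  have hd0 : ∀ x ∈ Ω, 0 < dista Ω x := fun x hx => by
    obtain ⟨y, hy⟩ := hne
    exact dista_pos hop hy hx
  set E : Set (ES N) := ⋃ x ∈ FF, closedBall x (dista Ω x / 8) with hE
  have hEc : IsCompact E := FF.isCompact_biUnion fun x _ => isCompact_closedBall _ _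
  -- choice of r
  have hlt : ∀ c : ℝ, 0 < c → ∀ᶠ r in 𝓝[>] (0:ℝ), r < c := fun c hc =>
    mem_nhdsWithin_of_mem_nhds (gt_mem_nhds hc)
  obtain ⟨r, hr, hr1, hr2, hr3, hr4⟩ : ∃ r : ℝ, 0 < r ∧ (∀ P ∈ t, r < rP P.1 P.2) ∧ r < η / 2 ∧
      (∀ x ∈ FF, r < dista Ω x * (7 / 16)) ∧ r < s0 / 2 := by
    have := (eventually_mem_nhdsWithin (a := (0:ℝ)) (s := Ioi 0)).and
      (((Finset.eventually_all t).2 fun P _ => hlt _ (hrP P.1 P.2)).and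
      ((hlt _ (half_pos hη)).and (((Finset.eventually_all FF).2 fun x hx => hlt _ (mul_pos (hd0 x (hFFq x hx).1) (by norm_num : (0:ℝ) < 7 / 16))).and
        (hlt _ (half_pos hs0)))))
    exact this.exists
  set D := Dr Ω r with hD
  have hDo : IsOpen D := Dr_open Ω r
  have hPW := Pot_Wr ha hV hr hne
  obtain ⟨g, gE, hGP⟩ := exGP hN hDo (hbd.subset (Dr_sub hr.le)) hEc.isClosed hPW.bm hPW.nn hp0 hpc hps
  have hcov : ∀ x ∈ Ω, dista Ω x < η → ∃ P ∈ t, x ∈ ball P.1 (ρ P.1 P.2) := fun x hx hxη => by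
    have := hηt (near_frontier hop hne hx hxη)
    simpa using this
  have hdec : ∀ f : ES N → ℝ, BM f → (∀ x, 0 ≤ f x) → (∀ x, x ∉ D → f x = 0) →
      SubW univ f (fun x => Wr Ω V r x * f x - p x) →
      ∀ z, z ∉ D → ∀ t > 0, ∃ r > 0, ∀ᵐ y, y ∈ ball z r → f y ≤ t := by
    intro f hf hf0 hoff hs z hz τ hτ
    have hz1 : dista Ω z ≤ r := not_lt.1 hz
    rcases hz1.lt_or_eq with hlt' | heq
    · obtain ⟨s, hs0', hsb⟩ := Metric.isOpen_iff.1 (isOpen_lt (dista_cont Ω) (continuous_const (y := r))) z hlt'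
      refine ⟨s, hs0', ae_of_all _ fun y hy => ?_⟩
      rw [hoff y fun hd => lt_asymm (show r < dista Ω y from hd) (hsb hy)]
      exact hτ.le
    · obtain ⟨P, hPt, hzP⟩ := hcov z (dista_mem (by rw [heq]; exact hr)) (by rw [heq]; linarith)
      refine BDdec ((hgeo P.1 P.2 r hr (hr1 P hPt)).1) hf ?_ (ae_of_all _ fun x _ hx => (hoff x hx).le) hzP hz hτ
      refine (hs.mono (subset_univ _)).rhs ((hPW.bm.mul hf).sub hGP.bp).li (BM.const 0).li (ae_of_all _ fun x hx => ?_)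
      rw [hpP P.1 P.2 x (ball_subset_ball (hρs P.1 P.2) hx), sub_zero]
      exact mul_nonneg (hPW.nn x) (hf0 x)
  have hE0 : ∀ x, x ∉ D → gE x = 0 := fun x hx => hGP.Eoff x fun h => hx h.1
  have hle := gE_le hN hDo (Sr_compact hbd hr) (Dr_sub_Sr Ω r) hPW.bm hPW.nn hGP
    (hdec gE hGP.bE hGP.E0 hE0 hGP.Esub)
  set O : Set (ES N) := {x | dista Ω x < 2 * r} with hO
  have hOo : IsOpen O := isOpen_lt (dista_cont Ω) continuous_const
  have hpO : ∀ x ∈ O, p x = 0 := fun x hx => hpz x (by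
    have : dista Ω x < 2 * r := hx
    linarith)
  have hEd : ∀ x ∈ E, 2 * r < dista Ω x := fun x hx => by
    simp only [hE, mem_iUnion, exists_prop] at hx
    obtain ⟨y, hy, hxy⟩ := hx
    have h1 := dista_lip Ω y x
    rw [mem_closedBall, dist_comm] at hxy
    have := hr3 y hy
    linarith
  have hhalf : ∀ᵐ x, x ∈ O → gE x ≤ 1 / 2 * g x := by
    have h1 : ∀ᵐ x, ∀ P ∈ t, x ∈ ball P.1 (ρ P.1 P.2) → gE x ≤ 1 / 2 * g x :=
      (Finset.eventually_all t).2 fun P hPt => (hgeo P.1 P.2 r hr (hr1 P hPt)).2 E g gE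
        (fun x hx => subset_biUnion_of_mem (u := fun x => closedBall x (dista Ω x / 8))
          (show x ∈ FF from Finset.mem_biUnion.2 ⟨P, hPt, hx⟩)) hGP hle
    filter_upwards [h1] with x hx hxO
    by_cases hxD : x ∈ D
    · obtain ⟨P, hPt, hxP⟩ := hcov x (Dr_sub hr.le hxD) (by
        have : dista Ω x < 2 * r := hxO
        linarith)
      exact hx P hPt hxP
    · rw [hE0 x hxD, hGP.goff x hxD, mul_zero]
  have hks := ksub hDo hOo hPW.bm hPW.nn hGP hpO (fun x hx hxE => lt_asymm (show dista Ω x < 2 * r from hx) (hEd x hxE)) hhalf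
    (hdec g hGP.bg hGP.g0 hGP.goff hGP.gsub)
  have hip : Integrable p := hpc.integrable_of_hasCompactSupport hps
  have hK0 : 0 ≤ 4 * 4 ^ N * Real.exp a := by positivity
  have hfin := fin_int (c := 4 * 4 ^ N * Real.exp a * ε) hop ha hr hbd hne hV hu hGP hip (by positivity) (by
    have hsm : ∀ᶠ n : ℕ in atTop, ∀ x ∈ FF, 1 / ((n:ℝ) + 1) ≤ dista Ω x / 8 :=
      (Finset.eventually_all FF).2 fun x hx => small_n (div_pos (hd0 x (hFFq x hx).1) (by norm_num))
    filter_upwards [hsm, small_n (show 0 < r / 4 by linarith)] with n hn hn4 x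
    have hFb : BM (fun x => Wr Ω V r x * g x - p x) := (hPW.bm.mul hGP.bg).sub hGP.bp
    have hFEb : BM (fun x => Wr Ω V r x * gE x - p x) := (hPW.bm.mul hGP.bE).sub hGP.bp
    have m0 := Mn_nonneg (n := n) hGP.bg.li hGP.gsub x
    have mE0 := Mn_nonneg (n := n) hGP.bE.li hGP.Esub x
    have hu0 : 0 ≤ (Sr Ω (r / 2)).indicator u x :=
      indicator_nonneg (fun z hz => hunn z (Sr_sub (half_pos hr) hz)) x
    set m := Mn n g (fun x => Wr Ω V r x * g x - p x) x with hm
    set mE := Mn n gE (fun x => Wr Ω V r x * gE x - p x) x with hmE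
    set w := (Sr Ω (r / 2)).indicator u x with hw
    have hc0 : 0 ≤ 4 * 4 ^ N * Real.exp a * ε := by positivity
    by_cases hxF : ∃ y ∈ FF, x ∈ closedBall y (dista Ω y / 4)
    · obtain ⟨y, hy, hxy⟩ := hxF
      have h1 := uharn hop hne ha hV hu hunn (hFFq y hy).1 hxy
      have h2 : w ≤ 4 * 4 ^ N * Real.exp a * ε := by
        rw [hw]
        by_cases hxS : x ∈ Sr Ω (r / 2)
        · rw [indicator_of_mem hxS]
          exact h1.trans (mul_le_mul_of_nonneg_left (hFFq y hy).2.le hK0)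
        · rw [indicator_of_notMem hxS]; exact hc0
      have h3 := mul_le_mul_of_nonneg_right h2 mE0
      have := mul_nonneg hu0 m0
      linarith
    · push Not at hxF
      have hdis : ∀ z ∈ closedBall x (1 / ((n:ℝ) + 1)), z ∉ E := fun z hz hzE => by
        simp only [hE, mem_iUnion, exists_prop] at hzE
        obtain ⟨y, hy, hzy⟩ := hzE
        refine hxF y hy ?_
        rw [mem_closedBall] at hz hzy ⊢
        have := dist_triangle_left x y z
        have := hn y hy
        linarith
      by_cases hxr : dista Ω x < 3 / 2 * r
      · have h1 : mE ≤ 1 / 2 * m := Mn_half hGP.bg hFb hGP.bE hFEb hks fun z hz => by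
          have := dista_lip Ω z x
          rw [mem_closedBall] at hz
          show dista Ω z < 2 * r
          linarith
        have := mul_le_mul_of_nonneg_left h1 hu0
        have := mul_nonneg hc0 mE0
        linarith
      · have h1 : mE ≤ 0 := Mn_nonpos hGP.bE.li hGP.Esup fun z hz => ⟨by
          have := dista_lip Ω x z
          rw [mem_closedBall, dist_comm] at hz
          show r < dista Ω z
          linarith, hdis z hz⟩
        have h2 : mE = 0 := le_antisymm h1 mE0
        have := mul_nonneg hu0 m0
        rw [h2]
        linarith)
  refine le_trans (le_of_eq ?_) hfin
  congr 1
  ext x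
  by_cases hx : dista Ω x < s0
  · rw [hpz x hx, mul_zero, mul_zero]
  · rw [indicator_of_mem (show x ∈ Sr Ω s0 from not_lt.1 hx),
      indicator_of_mem (show x ∈ Sr Ω (r / 2) from (by linarith : r / 2 ≤ s0).trans (not_lt.1 hx))]

/-- Proposition `MM`. A nonnegative `L_V`-solution `u` in `Ω` such
that for every `P ∈ ∂Ω` and every `ε > 0` there is a sequence converging
nontangentially to `P` along which `liminf u ≤ ε`, must vanish identically. -/
theorem statement7 {N : ℕ} (hN : 2 ≤ N) (Ω : Set (ES N))
    (hΩ : IsLipschitzDomain Ω) (hbd : Bornology.IsBounded Ω)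
    (a : ℝ) (ha : 0 < a) (V : ES N → ℝ) (hV : VClass Ω a V)
    (u : ES N → ℝ) (hu : LVHarmonic Ω V u) (hunn : ∀ x ∈ Ω, 0 ≤ u x)
    (hlim : ∀ P ∈ frontier Ω, ∀ ε > (0:ℝ), ∃ (x : ℕ → ES N) (κ : ℝ), 0 < κ ∧
      (∀ m, x m ∈ ntRegion Ω P κ) ∧ Tendsto x atTop (𝓝 P) ∧
      liminf (fun m => (u (x m) : EReal)) atTop ≤ (ε : EReal)) :
    ∀ x ∈ Ω, u x = 0 := by
  intro x0 hx0
  have hne : (Ωᶜ).Nonempty := by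
    rw [nonempty_compl]
    rintro rfl
    have : Nonempty (Fin N) := ⟨⟨0, by omega⟩⟩
    exact NormedSpace.unbounded_univ ℝ (ES N) hbd
  have hd0 : 0 < dista Ω x0 := by
    obtain ⟨y, hy⟩ := hne
    exact dista_pos hΩ.1 hy hx0
  set s0 := dista Ω x0 / 2 with hs0
  have hs0p : 0 < s0 := half_pos hd0
  obtain ⟨p, hpt, hp01, hp1⟩ := cutoff (isCompact_singleton (x := x0)) isOpen_ball
    (singleton_subset_iff.2 (mem_ball_self hs0p))
  have hpz : ∀ x, dista Ω x < s0 → p x = 0 := fun x hx => by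
    refine image_eq_zero_of_notMem_tsupport fun h => ?_
    have h1 := hpt.2.2 h
    have h2 := dista_lip Ω x0 x
    rw [mem_ball, dist_comm] at h1
    linarith
  have hS : Sr Ω s0 ⊆ Ω := Sr_sub hs0p
  have hest : ∀ ε > 0, ∫ x, (Sr Ω s0).indicator u x * p x ≤ 2 * (4 * 4 ^ N * Real.exp a * ε * ∫ x, p x) := by
    intro ε hε
    refine est hN hΩ hbd ha.le hV hu hunn hne (fun x => (hp01 x).1) hpt.sm.continuous hpt.cs hs0p hpz hε ?_
    intro P hP
    obtain ⟨x, κ, hκ, hx, hxP, hxl⟩ := hlim P hP (ε / 2) (half_pos hε)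
    refine ⟨κ, hκ, fun η hη => ?_⟩
    have h1 : ∃ᶠ m in atTop, (u (x m) : EReal) < (ε : EReal) :=
      frequently_lt_of_liminf_lt (hu := by isBoundedDefault) (hxl.trans_lt (EReal.coe_lt_coe_iff.2 (half_lt_self hε)))
    obtain ⟨m, hm1, hm2⟩ := (h1.and_eventually (hxP.eventually (ball_mem_nhds P hη))).exists
    exact ⟨x m, (hx m).1, (hx m).2, hm2, EReal.coe_lt_coe_iff.1 hm1⟩
  have hnn : ∀ x, 0 ≤ (Sr Ω s0).indicator u x * p x := fun x =>
    mul_nonneg (indicator_nonneg (fun z hz => hunn z (hS hz)) x) (hp01 x).1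
  have hI : Integrable (fun x => (Sr Ω s0).indicator u x * p x) :=
    intg (bm_ind (Sr_compact hbd hs0p) hS hu.1).li hpt.sm.continuous hpt.cs
  have h0 : ∫ x, (Sr Ω s0).indicator u x * p x = 0 := by
    refine le_antisymm ?_ (integral_nonneg hnn)
    have ht : Tendsto (fun ε : ℝ => 2 * (4 * 4 ^ N * Real.exp a * ε * ∫ x, p x)) (𝓝[>] 0) (𝓝 0) := by
      have : Continuous (fun ε : ℝ => 2 * (4 * 4 ^ N * Real.exp a * ε * ∫ x, p x)) := by fun_prop
      have h2 := (this.tendsto 0).mono_left (nhdsWithin_le_nhds (s := Ioi 0))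
      simpa using h2
    refine ge_of_tendsto ht ?_
    filter_upwards [self_mem_nhdsWithin] with ε hε using hest ε hε
  rw [integral_eq_zero_iff_of_nonneg hnn hI] at h0
  by_contra hcon
  have hpos : 0 < u x0 := lt_of_le_of_ne (hunn x0 hx0) (Ne.symm hcon)
  have hc : ContinuousAt u x0 := hu.1.continuousAt (hΩ.1.mem_nhds hx0)
  have hD : ∀ᶠ x in 𝓝 x0, x ∈ Dr Ω s0 := (Dr_open Ω s0).mem_nhds (half_lt_self hd0)
  have hev : ∀ᶠ x in 𝓝 x0, 0 < (Sr Ω s0).indicator u x * p x := by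
    filter_upwards [hc.eventually (lt_mem_nhds hpos), hD, hp1 x0 rfl] with x h1 h2 h3
    rw [indicator_of_mem (Dr_sub_Sr Ω s0 h2), h3, mul_one]
    exact h1
  have hm := MeasureTheory.Measure.measure_pos_of_mem_nhds (volume : Measure (ES N)) hev
  refine hm.ne' (measure_mono_null ?_ (ae_iff.1 h0))
  intro x hx hx2
  exact (ne_of_gt hx) hx2
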